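/- arXiv:2109.13882 — 9 statements merged into one kernel-verified Lean document; each statement's English description precedes it below -/
import Mathlib

section
/- Let G be a finite group acting transitively and faithfully on a finite set Ω, and let α ∈ Ω. If |Ω_{α,1}| + |Ω_{α,2}| > (5/6)·|Ω|, then every orbit of the point stabilizer G_α on Ω has cardinality at most 2 (equivalently, Ω = Ω_{α,1} ∪ Ω_{α,2}). -/
open MulAction

namespace Subgroup

variable {G : Type*} [Group G]

theorem inv_mul_mem_of_relIndex_le_two [Finite G] {A D : Subgroup G} (h : D.relIndex A ≤ 2)
    {x y : G} (hx : x ∈ A) (hy : y ∈ A) (hxD : x ∉ D) (hyD : y ∉ D) : x⁻¹ * y ∈ D := by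
  have h0 : D.relIndex A ≠ 0 := index_ne_zero_of_finite
  have h1 : D.relIndex A ≠ 1 := fun h1 => hxD (relIndex_eq_one.1 h1 hx)
  have h2 : (D.subgroupOf A).index = 2 := by
    change D.relIndex A = 2
    omega
  have := mul_mem_iff_of_index_two h2 (a := (⟨x, hx⟩ : A)⁻¹) (b := ⟨y, hy⟩)
  simpa [mem_subgroupOf, hxD, hyD] using this

theorem relIndex_comm_of_card_eq [Finite G] {A B : Subgroup G} (h : Nat.card A = Nat.card B) :
    A.relIndex B = B.relIndex A := by
  have h1 := relIndex_mul_relIndex ⊥ (A ⊓ B) B bot_le inf_le_right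
  have h2 := relIndex_mul_relIndex ⊥ (A ⊓ B) A bot_le inf_le_left
  rw [inf_relIndex_right] at h1
  rw [inf_relIndex_left] at h2
  simp only [relIndex_bot_left] at h1 h2
  exact Nat.eq_of_mul_eq_mul_left (Nat.card_pos (α := (A ⊓ B : Subgroup G)))
    (h1.trans (h.symm.trans h2.symm))

/-- `D` meets each of `A` and `B` in index at most two (on both sides), while `A` and `B` do not
meet each other in index at most two. -/
structure IsBridge (A B D : Subgroup G) : Prop where
  far : ¬ B.relIndex A ≤ 2
  far' : ¬ A.relIndex B ≤ 2
  left : D.relIndex A ≤ 2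
  left' : A.relIndex D ≤ 2
  right : D.relIndex B ≤ 2
  right' : B.relIndex D ≤ 2

namespace IsBridge

variable {A B D D' : Subgroup G}

theorem symm (h : IsBridge A B D) : IsBridge B A D :=
  ⟨h.far', h.far, h.right, h.right', h.left, h.left'⟩

variable [Finite G]

theorem mem_of_mem_inf (h : IsBridge A B D) {x : G} (hA : x ∈ A) (hB : x ∈ B) : x ∈ D := by
  have h1 := relIndex_inf_mul_relIndex D B A
  have h2 := relIndex_inf_mul_relIndex B D A
  rw [inf_comm B D] at h2
  have h3 : B.relIndex (D ⊓ A) ≤ 2 :=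
    (relIndex_le_of_le_right inf_le_left index_ne_zero_of_finite).trans h.right'
  have h4 : D.relIndex (B ⊓ A) ≠ 0 := index_ne_zero_of_finite
  have h5 : D.relIndex (B ⊓ A) = 1 := by
    have hf := h.far
    have hle : B.relIndex (D ⊓ A) * D.relIndex A ≤ 2 * 2 := Nat.mul_le_mul h3 h.left
    by_contra hne
    have hlt : 2 * 3 ≤ D.relIndex (B ⊓ A) * B.relIndex A :=
      Nat.mul_le_mul (by omega) (by omega)
    omega
  exact relIndex_eq_one.1 h5 ⟨hB, hA⟩

theorem exists_mem_notMem (h : IsBridge A B D) : ∃ m ∈ A, m ∈ D ∧ m ∉ B := by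
  by_contra! hc
  apply h.far
  have hle : D ⊓ A ≤ B := fun x hx => hc x hx.2 hx.1
  refine (relIndex_le_of_le_left hle index_ne_zero_of_finite).trans ?_
  rw [inf_relIndex_right]
  exact h.left

theorem inf_le_of_mem (h : IsBridge A B D) (h' : IsBridge A B D') {x : G} (hA : x ∈ A)
    (hD : x ∈ D) (hD' : x ∈ D') (hB : x ∉ B) : A ⊓ D ≤ A ⊓ D' := by
  rintro m ⟨hmA, hmD⟩
  refine ⟨hmA, ?_⟩
  by_cases hmB : m ∈ B
  · exact h'.mem_of_mem_inf hmA hmB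
  · have := h'.mem_of_mem_inf (mul_mem (inv_mem hA) hmA)
      (inv_mul_mem_of_relIndex_le_two h.right' hD hmD hB hmB)
    simpa using mul_mem hD' this

theorem mem_right_of_inf_ne (h : IsBridge A B D) (h' : IsBridge A B D') (hne : A ⊓ D ≠ A ⊓ D')
    {x : G} (hA : x ∈ A) (hD : x ∈ D) (hD' : x ∈ D') : x ∈ B := by
  by_contra hB
  exact hne (le_antisymm (h.inf_le_of_mem h' hA hD hD' hB) (h'.inf_le_of_mem h hA hD' hD hB))

theorem le_of_inf_eq (h : IsBridge A B D) (hA : A ⊓ D = A ⊓ D') (hB : B ⊓ D = B ⊓ D') :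
    D ≤ D' := by
  have hA' : ∀ y ∈ A, y ∈ D → y ∈ D' := fun y hy hyD => (hA.le ⟨hy, hyD⟩).2
  have hB' : ∀ y ∈ B, y ∈ D → y ∈ D' := fun y hy hyD => (hB.le ⟨hy, hyD⟩).2
  intro x hx
  by_cases hxB : x ∈ B
  · exact hB' x hxB hx
  · obtain ⟨m, hmA, hmD, hmB⟩ := h.exists_mem_notMem
    have := hB' _ (inv_mul_mem_of_relIndex_le_two h.right' hmD hx hmB hxB)
      (mul_mem (inv_mem hmD) hx)
    simpa using mul_mem (hA' m hmA hmD) this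

theorem eq_of_inf_eq (h : IsBridge A B D) (h' : IsBridge A B D') (hA : A ⊓ D = A ⊓ D')
    (hB : B ⊓ D = B ⊓ D') : D = D' :=
  le_antisymm (h.le_of_inf_eq hA hB) (h'.le_of_inf_eq hA.symm hB.symm)

theorem not_relIndex_le_two (h : IsBridge A B D) (h' : IsBridge A B D') (hA : A ⊓ D ≠ A ⊓ D')
    (hB : B ⊓ D ≠ B ⊓ D') : ¬ D'.relIndex D ≤ 2 := by
  intro hc
  obtain ⟨m, hmA, hmD, hmB⟩ := h.exists_mem_notMem
  obtain ⟨k, hkB, hkD, hkA⟩ := h.symm.exists_mem_notMem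
  obtain ⟨n, hnA, hnD', hnB⟩ := h'.exists_mem_notMem
  have hmD' : m ∉ D' := fun hm => hmB (h.mem_right_of_inf_ne h' hA hmA hmD hm)
  have hkD' : k ∉ D' := fun hk => hkA (h.symm.mem_right_of_inf_ne h'.symm hB hkB hkD hk)
  have hx : m⁻¹ * k ∈ D' := inv_mul_mem_of_relIndex_le_two hc hmD hkD hmD' hkD'
  have hxB : m⁻¹ * k ∉ B := fun hb => hmB (by simpa using (mul_mem_cancel_right hkB).1 hb)
  have h1 := inv_mul_mem_of_relIndex_le_two h'.right' hnD' hx hnB hxB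
  rw [← mul_assoc, mul_mem_cancel_right hkB] at h1
  have h2 := h.mem_of_mem_inf (mul_mem (inv_mem hnA) (inv_mem hmA)) h1
  have hnD : n ∈ D := by simpa using (mul_mem_cancel_right (inv_mem hmD)).1 h2
  exact hnB (h.mem_right_of_inf_ne h' hA hnA hnD hnD')

/-- At most three subgroups arise as the intersection of `A` with a bridge between `A` and `B`. -/
theorem inf_eq_of_three {D₁ D₂ D₃ D₄ : Subgroup G} (h₁ : IsBridge A B D₁) (h₂ : IsBridge A B D₂)
    (h₃ : IsBridge A B D₃) (h₄ : IsBridge A B D₄) (h12 : A ⊓ D₁ ≠ A ⊓ D₂)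
    (h13 : A ⊓ D₁ ≠ A ⊓ D₃) (h23 : A ⊓ D₂ ≠ A ⊓ D₃) (h14 : A ⊓ D₁ ≠ A ⊓ D₄)
    (h24 : A ⊓ D₂ ≠ A ⊓ D₄) : A ⊓ D₃ = A ⊓ D₄ := by
  by_contra h34
  obtain ⟨x₁, a₁, d₁, b₁⟩ := h₁.exists_mem_notMem
  obtain ⟨x₂, a₂, d₂, b₂⟩ := h₂.exists_mem_notMem
  obtain ⟨x₃, a₃, d₃, b₃⟩ := h₃.exists_mem_notMem
  obtain ⟨x₄, a₄, d₄, b₄⟩ := h₄.exists_mem_notMem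
  have n12 : x₁ ∉ D₂ := fun hx => b₁ (h₁.mem_right_of_inf_ne h₂ h12 a₁ d₁ hx)
  have n21 : x₂ ∉ D₁ := fun hx => b₂ (h₁.mem_right_of_inf_ne h₂ h12 a₂ hx d₂)
  have n31 : x₃ ∉ D₁ := fun hx => b₃ (h₁.mem_right_of_inf_ne h₃ h13 a₃ hx d₃)
  have n32 : x₃ ∉ D₂ := fun hx => b₃ (h₂.mem_right_of_inf_ne h₃ h23 a₃ hx d₃)
  have n41 : x₄ ∉ D₁ := fun hx => b₄ (h₁.mem_right_of_inf_ne h₄ h14 a₄ hx d₄)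
  have n42 : x₄ ∉ D₂ := fun hx => b₄ (h₂.mem_right_of_inf_ne h₄ h24 a₄ hx d₄)
  have m1 : x₃⁻¹ * x₄ ∈ D₁ := inv_mul_mem_of_relIndex_le_two h₁.left a₃ a₄ n31 n41
  have m2 : x₃⁻¹ * x₄ ∈ D₂ := inv_mul_mem_of_relIndex_le_two h₂.left a₃ a₄ n32 n42
  have mA : x₃⁻¹ * x₄ ∈ A := mul_mem (inv_mem a₃) a₄
  have m3 := h₃.mem_of_mem_inf mA (h₁.mem_right_of_inf_ne h₂ h12 mA m1 m2)
  have h43 : x₄ ∈ D₃ := by simpa using mul_mem d₃ m3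
  exact b₄ (h₃.mem_right_of_inf_ne h₄ h34 a₄ h43 d₄)

end IsBridge

section Family

variable {ι : Type*} {S : ι → Subgroup G} [Finite G]

/-- If bridges between `S a` and `S b` other than `S d` can be found adjacent to `S d` and to any
two prescribed members, then no bridge `S e` has the same intersection with `S a` as `S d` but a
different one with `S b`. -/
theorem false_of_arm (a b e d : ι)
    (hcommon : ∀ i₁ i₂ : ι, ∃ j, IsBridge (S a) (S b) (S j) ∧ S j ≠ S d ∧
      (S j).relIndex (S d) ≤ 2 ∧ (S j).relIndex (S i₁) ≤ 2 ∧ (S j).relIndex (S i₂) ≤ 2)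
    (hfar : ∀ i, ∃ j, ¬ (S i).relIndex (S j) ≤ 2)
    (hd : IsBridge (S a) (S b) (S d)) (he : IsBridge (S a) (S b) (S e))
    (hea : S a ⊓ S d = S a ⊓ S e) (heb : S b ⊓ S d ≠ S b ⊓ S e) : False := by
  by_cases harm : ∃ f, IsBridge (S a) (S b) (S f) ∧ S a ⊓ S d ≠ S a ⊓ S f ∧
      S b ⊓ S d = S b ⊓ S f
  · obtain ⟨f, hf, hfa, hfb⟩ := harm
    obtain ⟨j, hj, hjd, h0, h1, h2⟩ := hcommon e f
    by_cases hja : S a ⊓ S d = S a ⊓ S j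
    · by_cases hjb : S b ⊓ S d = S b ⊓ S j
      · exact hjd (hd.eq_of_inf_eq hj hja hjb).symm
      · exact hf.not_relIndex_le_two hj (by rw [← hja]; exact hfa.symm) (by rwa [← hfb]) h2
    · by_cases hjb : S b ⊓ S d = S b ⊓ S j
      · exact he.not_relIndex_le_two hj (by rwa [← hea]) (by rw [← hjb]; exact heb.symm) h1
      · exact hd.not_relIndex_le_two hj hja hjb h0
  · have key : ∀ j, IsBridge (S a) (S b) (S j) → S j ≠ S d → (S j).relIndex (S d) ≤ 2 →
        S a ⊓ S d = S a ⊓ S j ∧ S b ⊓ S d ≠ S b ⊓ S j := by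
      intro j hj hjd h0
      by_cases hjb : S b ⊓ S d = S b ⊓ S j
      · by_cases hja : S a ⊓ S d = S a ⊓ S j
        · exact absurd (hd.eq_of_inf_eq hj hja hjb).symm hjd
        · exact absurd ⟨j, hj, hja, hjb⟩ harm
      · by_cases hja : S a ⊓ S d = S a ⊓ S j
        · exact ⟨hja, hjb⟩
        · exact absurd h0 (hd.not_relIndex_le_two hj hja hjb)
    obtain ⟨e', he'⟩ := hfar e
    obtain ⟨f, hf, hfd, hf0, hf1, -⟩ := hcommon e' e'
    obtain ⟨hfa, hfb⟩ := key f hf hfd hf0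
    have hfe : S b ⊓ S e ≠ S b ⊓ S f := fun heq =>
      he' (he.eq_of_inf_eq hf (hea.symm.trans hfa) heq ▸ hf1)
    obtain ⟨f', hf'⟩ := hfar f
    obtain ⟨j, hj, hjd, hj0, hj1, hj2⟩ := hcommon e' f'
    obtain ⟨hja, hjb⟩ := key j hj hjd hj0
    have hje : S b ⊓ S e ≠ S b ⊓ S j := fun heq =>
      he' (he.eq_of_inf_eq hj (hea.symm.trans hja) heq ▸ hj1)
    have hfj := hd.symm.inf_eq_of_three he.symm hf.symm hj.symm heb hfb hfe hjb hje
    exact hf' (hf.eq_of_inf_eq hj (hfa.symm.trans hja) hfj ▸ hj2)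

/-- In a family of subgroups of the same order in which any six members have a common neighbour,
two subgroups being adjacent when they meet in index at most two, some member is adjacent to all
the others. -/
theorem exists_forall_relIndex_le_two (hcard : ∀ i j, Nat.card (S i) = Nat.card (S j))
    (hcommon : ∀ f : Fin 6 → ι, ∃ j, ∀ k, (S j).relIndex (S (f k)) ≤ 2) [Nonempty ι] :
    ∃ i, ∀ j, (S j).relIndex (S i) ≤ 2 := by
  by_contra! hall
  have hcomm : ∀ i j, (S i).relIndex (S j) = (S j).relIndex (S i) := fun i j =>
    relIndex_comm_of_card_eq (hcard i j)
  have hfar : ∀ i, ∃ j, ¬ (S i).relIndex (S j) ≤ 2 := fun i => by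
    obtain ⟨j, hj⟩ := hall i
    exact ⟨j, by rw [hcomm]; omega⟩
  obtain ⟨a⟩ := ‹Nonempty ι›
  obtain ⟨b, hab⟩ := hfar a
  have hbridge : ∀ j, (S j).relIndex (S a) ≤ 2 → (S j).relIndex (S b) ≤ 2 →
      IsBridge (S a) (S b) (S j) := fun j h1 h2 =>
    ⟨hcomm a b ▸ hab, hab, h1, hcomm j a ▸ h1, h2, hcomm j b ▸ h2⟩
  obtain ⟨d, hd⟩ := hcommon ![a, b, a, a, a, a]
  have hd := hbridge d (hd 0) (hd 1)
  obtain ⟨d', hd'⟩ := hfar d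
  have hc : ∀ i₁ i₂ : ι, ∃ j, IsBridge (S a) (S b) (S j) ∧ S j ≠ S d ∧
      (S j).relIndex (S d) ≤ 2 ∧ (S j).relIndex (S i₁) ≤ 2 ∧ (S j).relIndex (S i₂) ≤ 2 := by
    intro i₁ i₂
    obtain ⟨j, hj⟩ := hcommon ![a, b, d, d', i₁, i₂]
    exact ⟨j, hbridge j (hj 0) (hj 1), fun h => hd' (h ▸ hj 3), hj 2, hj 4, hj 5⟩
  obtain ⟨e, he, hed, h0, -, -⟩ := hc a a
  by_cases hea : S a ⊓ S d = S a ⊓ S e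
  · by_cases heb : S b ⊓ S d = S b ⊓ S e
    · exact hed (hd.eq_of_inf_eq he hea heb).symm
    · exact false_of_arm a b e d hc hfar hd he hea heb
  · by_cases heb : S b ⊓ S d = S b ⊓ S e
    · refine false_of_arm b a e d (fun i₁ i₂ => ?_) hfar hd.symm he.symm heb hea
      obtain ⟨j, hj, h⟩ := hc i₁ i₂
      exact ⟨j, hj.symm, h⟩
    · exact hd.not_relIndex_le_two he hea heb h0

end Family

end Subgroup

namespace MulAction

variable {G Ω : Type*} [Group G] [MulAction G Ω]

theorem card_orbit_stabilizer_eq_relIndex (α δ : Ω) :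
    Nat.card (orbit (stabilizer G α) δ) = (stabilizer G δ).relIndex (stabilizer G α) := by
  rw [Nat.card_coe_set_eq, ← index_stabilizer]
  rfl

theorem relIndex_stabilizer_smul (g : G) (α δ : Ω) :
    (stabilizer G (g • δ)).relIndex (stabilizer G (g • α)) =
      (stabilizer G δ).relIndex (stabilizer G α) := by
  rw [stabilizer_smul_eq_stabilizer_map_conj, stabilizer_smul_eq_stabilizer_map_conj]
  exact Subgroup.relIndex_map_map_of_injective _ _ (MulAut.conj g).injective

variable (G) in
theorem card_stabilizer_eq [IsPretransitive G Ω] (α δ : Ω) :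
    Nat.card (stabilizer G α) = Nat.card (stabilizer G δ) := by
  obtain ⟨g, rfl⟩ := exists_smul_eq G α δ
  rw [stabilizer_smul_eq_stabilizer_map_conj]
  exact (Subgroup.card_map_of_injective (MulAut.conj g).injective).symm

variable (G) in
/-- The points lying in an orbit of the stabilizer of `α` of length more than two. -/
def farSet (α : Ω) : Set Ω := {δ | ¬ (stabilizer G δ).relIndex (stabilizer G α) ≤ 2}

theorem ncard_farSet_eq [IsPretransitive G Ω] (α β : Ω) :
    (farSet G α).ncard = (farSet G β).ncard := by
  obtain ⟨g, rfl⟩ := exists_smul_eq G α β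
  rw [← Set.ncard_image_of_injective (farSet G α) (MulAction.injective g)]
  congr 1
  ext δ
  constructor
  · rintro ⟨δ, hδ, rfl⟩
    simpa only [farSet, Set.mem_ofPred_eq, relIndex_stabilizer_smul] using hδ
  · intro hδ
    refine ⟨g⁻¹ • δ, ?_, smul_inv_smul g δ⟩
    rw [farSet, Set.mem_ofPred_eq, ← relIndex_stabilizer_smul g, smul_inv_smul]
    exact hδ

end MulAction

theorem stmt_0 {G Ω : Type*} [Group G] [Finite G] [Finite Ω] [MulAction G Ω]
    [IsPretransitive G Ω] [FaithfulSMul G Ω] (α : Ω)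
    (h : (5 : ℚ) / 6 * Nat.card Ω <
      ({δ : Ω | Nat.card (orbit (stabilizer G α) δ) = 1}.ncard : ℚ)
      + ({δ : Ω | Nat.card (orbit (stabilizer G α) δ) = 2}.ncard : ℚ)) :
    ∀ δ : Ω, Nat.card (orbit (stabilizer G α) δ) ≤ 2 := by
  have hunion : {δ : Ω | Nat.card (orbit (stabilizer G α) δ) = 1} ∪
      {δ : Ω | Nat.card (orbit (stabilizer G α) δ) = 2} = (farSet G α)ᶜ := by
    ext δ
    have h0 : (stabilizer G δ).relIndex (stabilizer G α) ≠ 0 := Subgroup.index_ne_zero_of_finite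
    simp only [card_orbit_stabilizer_eq_relIndex, farSet, Set.mem_union, Set.mem_ofPred_eq,
      Set.mem_compl_iff, not_not]
    omega
  have hdisj : Disjoint {δ : Ω | Nat.card (orbit (stabilizer G α) δ) = 1}
      {δ : Ω | Nat.card (orbit (stabilizer G α) δ) = 2} := by
    rw [Set.disjoint_left]
    intro δ h1 h2
    simp only [Set.mem_ofPred_eq] at h1 h2
    omega
  have hadd := Set.ncard_union_eq hdisj
  rw [hunion] at hadd
  have hcompl := Set.ncard_add_ncard_compl (farSet G α)
  have hfar : 6 * (farSet G α).ncard < Nat.card Ω := by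
    rw [← Nat.cast_add, ← hadd] at h
    have : ((farSet G α).ncard : ℚ) + ((farSet G α)ᶜ.ncard : ℚ) = Nat.card Ω := by
      exact_mod_cast hcompl
    have : (6 : ℚ) * (farSet G α).ncard < Nat.card Ω := by linarith
    exact_mod_cast this
  have hcommon : ∀ f : Fin 6 → Ω,
      ∃ δ : Ω, ∀ k, (stabilizer G δ).relIndex (stabilizer G (f k)) ≤ 2 := by
    intro f
    by_contra! hc
    have huniv : (⋃ k, farSet G (f k)) = Set.univ := by
      refine Set.eq_univ_of_forall fun δ => Set.mem_iUnion.2 ?_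
      obtain ⟨k, hk⟩ := hc δ
      exact ⟨k, not_le.2 hk⟩
    have hle := Set.ncard_iUnion_le_of_fintype fun k : Fin 6 => farSet G (f k)
    simp only [huniv, Set.ncard_univ, ncard_farSet_eq _ α, Finset.sum_const, Finset.card_univ,
      Fintype.card_fin, smul_eq_mul] at hle
    omega
  have : Nonempty Ω := ⟨α⟩
  obtain ⟨β, hβ⟩ := Subgroup.exists_forall_relIndex_le_two (S := fun δ : Ω => stabilizer G δ)
    (fun i j => card_stabilizer_eq G i j) hcommon
  obtain ⟨g, rfl⟩ := exists_smul_eq G α β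
  intro δ
  rw [card_orbit_stabilizer_eq_relIndex, ← relIndex_stabilizer_smul g]
  exact hβ (g • δ)
end

section
/- Let G be a finite group containing an elementary abelian normal 2-subgroup V of order 16, regarded as a 4-dimensional vector space over the field with 2 elements with basis e₁, e₂, e₃, e₄. Suppose the image of the conjugation action G → GL(V) ≅ GL₄(2) equals (with respect to this basis) either the group H₁ generated by the matrices M₁ with rows (0,0,0,1),(1,1,0,0),(0,0,1,0),(1,0,0,1) and M₂ with rows (1,1,1,1),(0,0,1,0),(0,1,0,0),(0,0,0,1), or the group H₂ generated by M₁, M₂ and M₃ with rows (1,0,0,0),(0,1,0,0),(1,1,0,1),(1,1,1,0). Let W := ⟨e₁,e₂⟩ and let Ω be the set of right cosets of W in G, with G acting by right multiplication. Then |Ω| = 4·|G : V|, and the proportion of elements of Ω lying in an orbit of the stabilizer of the coset W of cardinality at most 2 equals 5/6. -/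
open MulAction

section Counting

variable {G X : Type*} [Group G]

/-- If `f a = f b` implies `f (a * c) = f (b * c)`, then all nonempty fibers of `f` have the same
cardinality, so the density of a union of fibers is the proportion of values it comprises. -/
lemma card_setOf_mul_card_range [Finite G] [DecidableEq X] (f : G → X) (p : X → Prop) [DecidablePred p]
    (L : Finset X) (hf : ∀ a b c, f a = f b → f (a * c) = f (b * c)) (hL : ∀ g, f g ∈ L)
    (hsurj : ∀ x ∈ L, ∃ g, f g = x) :
    Nat.card {g | p (f g)} * L.card = (L.filter p).card * Nat.card G := by
  have := Fintype.ofFinite G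
  have fiber : ∀ x ∈ L, (Finset.univ.filter fun g => f g = x).card =
      (Finset.univ.filter fun g => f g = f 1).card := by
    intro x hx
    obtain ⟨t, rfl⟩ := hsurj x hx
    refine Finset.card_bij' (fun g _ => g * t⁻¹) (fun g _ => g * t) ?_ ?_ ?_ ?_
    · intro g hg
      simpa using hf g t t⁻¹ (by simpa using hg)
    · intro g hg
      simpa using hf g 1 t (by simpa using hg)
    · simp
    · simp
  have total : Nat.card G = L.card * (Finset.univ.filter fun g => f g = f 1).card := by
    rw [Nat.card_eq_fintype_card, ← Finset.card_univ,
      Finset.card_eq_sum_card_fiberwise (f := f) (t := L) (fun g _ => hL g),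
      Finset.sum_congr rfl fiber, Finset.sum_const, smul_eq_mul]
  have part : Nat.card {g | p (f g)} =
      (L.filter p).card * (Finset.univ.filter fun g => f g = f 1).card := by
    rw [Nat.card_eq_fintype_card, ← Set.toFinset_card, Set.toFinset_ofPred,
      Finset.card_eq_sum_card_fiberwise (f := f) (t := L.filter p)
        (fun g hg => by simpa [hL g] using hg), ← smul_eq_mul, ← Finset.sum_const]
    refine Finset.sum_congr rfl fun x hx => ?_
    rw [Finset.mem_filter] at hx
    rw [← fiber x hx.1]
    congr 1
    ext g
    simp only [Finset.mem_filter, Finset.mem_univ, true_and]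
    exact ⟨fun h => h.2, fun h => ⟨h ▸ hx.2, h⟩⟩
  rw [part, total]
  ring

lemma card_setOf_mk (W : Subgroup G) (P : G ⧸ W → Prop) :
    Nat.card {g : G | P g} = Nat.card W * {δ | P δ}.ncard := by
  rw [← Nat.card_coe_set_eq, ← Nat.card_prod]
  exact Nat.card_congr (QuotientGroup.preimageMkEquivSubgroupProdSet W {δ | P δ})

/-- The suborbit of a subgroup of order `4` containing `gW` has at most two elements
iff `W` meets its conjugate by `g` nontrivially. -/
lemma card_suborbit_le_two_iff [Finite G] (W : Subgroup G) (hW : Nat.card W = 4) (g : G) :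
    Nat.card (orbit (stabilizer G ((1 : G) : G ⧸ W)) (g : G ⧸ W)) ≤ 2 ↔
      ∃ w ∈ W, w ≠ 1 ∧ g⁻¹ * w * g ∈ W := by
  have hstab : stabilizer G ((1 : G) : G ⧸ W) = W := stabilizer_quotient W
  rw [hstab]
  have hmem : ∀ w : W, w ∈ stabilizer W (g : G ⧸ W) ↔ g⁻¹ * w * g ∈ W := by
    intro w
    rw [mem_stabilizer_iff, eq_comm, mul_assoc]
    exact QuotientGroup.eq (b := (w : G) * g)
  have hcard : Nat.card (orbit W (g : G ⧸ W)) * Nat.card (stabilizer W (g : G ⧸ W)) =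
      Nat.card W := by
    rw [← Nat.card_prod]
    exact Nat.card_congr (orbitProdStabilizerEquivGroup W (g : G ⧸ W))
  have hbot : (∃ w ∈ W, w ≠ 1 ∧ g⁻¹ * w * g ∈ W) ↔ stabilizer W (g : G ⧸ W) ≠ ⊥ := by
    rw [Subgroup.ne_bot_iff_exists_ne_one]
    constructor
    · rintro ⟨w, hw, hw1, h⟩
      exact ⟨⟨⟨w, hw⟩, (hmem ⟨w, hw⟩).2 h⟩, fun h1 => hw1 (by simpa using congrArg (·.1.1) h1)⟩
    · rintro ⟨⟨w, h⟩, hw⟩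
      exact ⟨w, w.2, fun h1 => hw (Subtype.ext (Subtype.ext h1)), (hmem w).1 h⟩
  rw [hbot, ← Subgroup.one_lt_card_iff_ne_bot]
  rw [hW] at hcard
  constructor <;> intro h <;> nlinarith

end Counting

section Plane

/-- The nonzero vectors of the plane spanned by the first two basis vectors. -/
def planeVectors : Finset (Fin 4 → ZMod 2) := {![1,0,0,0], ![0,1,0,0], ![1,1,0,0]}

def planeImage (M : Matrix (Fin 4) (Fin 4) (ZMod 2)) : Finset (Fin 4 → ZMod 2) :=
  planeVectors.image (Matrix.vecMul · M)

def matA : Matrix (Fin 4) (Fin 4) (ZMod 2) := !![0,0,0,1; 1,1,0,0; 0,0,1,0; 1,0,0,1]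

def matB : Matrix (Fin 4) (Fin 4) (ZMod 2) := !![1,1,1,1; 0,0,1,0; 0,1,0,0; 0,0,0,1]

def matC : Matrix (Fin 4) (Fin 4) (ZMod 2) := !![1,0,0,0; 0,1,0,0; 1,1,0,1; 1,1,1,0]

/-- The orbit of the plane under the group generated by `matA` and `matB`. -/
def planeOrbit : Finset (Finset (Fin 4 → ZMod 2)) :=
  {{![1,0,0,0], ![0,1,0,0], ![1,1,0,0]}, {![0,0,0,1], ![1,1,0,0], ![1,1,0,1]},
    {![1,1,1,1], ![0,0,1,0], ![1,1,0,1]}, {![1,0,0,1], ![0,1,0,0], ![1,1,0,1]},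
    {![0,0,1,0], ![0,1,0,0], ![0,1,1,0]}, {![0,0,1,0], ![1,1,0,0], ![1,1,1,0]}}

lemma card_planeOrbit : planeOrbit.card = 6 := by decide +kernel

lemma card_planeOrbit_filter :
    (planeOrbit.filter fun S => (S ∩ planeVectors).Nonempty).card = 5 := by decide +kernel

lemma planeImage_one : planeImage 1 = planeVectors := by simp [planeImage]

lemma planeImage_mul (M N : Matrix (Fin 4) (Fin 4) (ZMod 2)) :
    planeImage (M * N) = (planeImage M).image (Matrix.vecMul · N) := by
  simp [planeImage, Finset.image_image, Function.comp_def, Matrix.vecMul_vecMul]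

lemma image_mem_planeOrbit {M : Matrix (Fin 4) (Fin 4) (ZMod 2)}
    (hM : M = matA ∨ M = matB ∨ M = matC) :
    ∀ S ∈ planeOrbit, S.image (Matrix.vecMul · M) ∈ planeOrbit := by
  intro S hS
  simp only [planeOrbit, Finset.mem_insert, Finset.mem_singleton] at hS
  rcases hM with rfl | rfl | rfl <;> rcases hS with rfl | rfl | rfl | rfl | rfl | rfl <;>
    simp only [Finset.image_insert, Finset.image_singleton] <;> decide +kernel

lemma planeImage_mem_planeOrbit {A : Set (GL (Fin 4) (ZMod 2))}
    (hA : ∀ a ∈ A, a.val = matA ∨ a.val = matB ∨ a.val = matC)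
    {h : GL (Fin 4) (ZMod 2)} (hh : h ∈ Subgroup.closure A) :
    planeImage h.val ∈ planeOrbit := by
  rw [← Subgroup.mem_toSubmonoid, Subgroup.closure_toSubmonoid_of_finite] at hh
  induction hh using Submonoid.closure_induction_right with
  | one =>
    rw [Units.val_one, planeImage_one]
    simp [planeOrbit, planeVectors]
  | mul_right x _ y hy ih =>
    rw [Units.val_mul, planeImage_mul]
    exact image_mem_planeOrbit (hA y hy) _ ih

lemma exists_planeImage_eq (H : Subgroup (GL (Fin 4) (ZMod 2))) {a b : GL (Fin 4) (ZMod 2)}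
    (ha : a ∈ H) (hb : b ∈ H) (haA : a.val = matA) (hbB : b.val = matB) :
    ∀ S ∈ planeOrbit, ∃ h ∈ H, planeImage h.val = S := by
  intro S hS
  simp only [planeOrbit, Finset.mem_insert, Finset.mem_singleton] at hS
  rcases hS with rfl | rfl | rfl | rfl | rfl | rfl
  · exact ⟨1, H.one_mem, planeImage_one⟩
  · exact ⟨a, ha, by rw [haA]; decide +kernel⟩
  · exact ⟨b, hb, by rw [hbB]; decide +kernel⟩
  · exact ⟨a * a, H.mul_mem ha ha, by rw [Units.val_mul, haA]; decide +kernel⟩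
  · exact ⟨b * a, H.mul_mem hb ha, by rw [Units.val_mul, haA, hbB]; decide +kernel⟩
  · exact ⟨a * a * b, H.mul_mem (H.mul_mem ha ha) hb, by
      rw [Units.val_mul, Units.val_mul, haA, hbB]; decide +kernel⟩

end Plane

section Coordinates

variable {G : Type*} [Group G]

def coordProd (e : Fin 4 → G) (v : Fin 4 → ZMod 2) : G :=
  e 0 ^ (v 0).val * e 1 ^ (v 1).val * e 2 ^ (v 2).val * e 3 ^ (v 3).val

lemma coordProd_zero (e : Fin 4 → G) : coordProd e 0 = 1 := by simp [coordProd]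

lemma coordProd_single (e : Fin 4 → G) (i : Fin 4) : coordProd e (Pi.single i 1) = e i := by
  fin_cases i <;> simp [coordProd, ZMod.val_one]

lemma pow_val_add {x : G} (hx : x ^ 2 = 1) (a b : ZMod 2) :
    x ^ (a + b).val = x ^ a.val * x ^ b.val := by
  rw [ZMod.val_add, ← pow_add, ← pow_mod_orderOf x (a.val + b.val),
    ← pow_mod_orderOf x ((a.val + b.val) % 2), Nat.mod_mod_of_dvd _ (orderOf_dvd_of_pow_eq_one hx)]

variable {V : Subgroup G} {e : Fin 4 → G}

lemma coordProd_mem (he : ∀ i, e i ∈ V) (v : Fin 4 → ZMod 2) : coordProd e v ∈ V :=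
  V.mul_mem (V.mul_mem (V.mul_mem (V.pow_mem (he 0) _) (V.pow_mem (he 1) _))
    (V.pow_mem (he 2) _)) (V.pow_mem (he 3) _)

lemma commute_of_sq_eq_one (hV : ∀ v ∈ V, v ^ 2 = 1) {a b : G} (ha : a ∈ V) (hb : b ∈ V) :
    Commute a b := by
  have inv : ∀ v ∈ V, v⁻¹ = v := fun v hv => inv_eq_of_mul_eq_one_left (by rw [← sq, hV v hv])
  calc a * b = (a * b)⁻¹ := (inv _ (V.mul_mem ha hb)).symm
    _ = b * a := by rw [mul_inv_rev, inv a ha, inv b hb]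

lemma coordProd_add (hV : ∀ v ∈ V, v ^ 2 = 1) (he : ∀ i, e i ∈ V) (u v : Fin 4 → ZMod 2) :
    coordProd e (u + v) = coordProd e u * coordProd e v := by
  have hp : ∀ i (a : ZMod 2), e i ^ a.val ∈ V := fun i a => V.pow_mem (he i) _
  have hc : ∀ {a b : G}, a ∈ V → b ∈ V → Commute a b := commute_of_sq_eq_one hV
  simp only [coordProd, Pi.add_apply, pow_val_add (hV _ (he _))]
  rw [(hc (hp 3 (u 3)) (V.mul_mem (V.mul_mem (hp 0 (v 0)) (hp 1 (v 1)))
      (hp 2 (v 2)))).mul_mul_mul_comm,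
    (hc (hp 2 (u 2)) (V.mul_mem (hp 0 (v 0)) (hp 1 (v 1)))).mul_mul_mul_comm,
    (hc (hp 1 (u 1)) (hp 0 (v 0))).mul_mul_mul_comm]

/-- A set of generators `e i` with `i ∈ I` generates the products with coordinates in any
set `K` of vectors that contains `0` and the `i`-th unit vectors and is closed under addition. -/
lemma exists_coordProd_eq (hV : ∀ v ∈ V, v ^ 2 = 1) (he : ∀ i, e i ∈ V) {I : Set (Fin 4)}
    {K : Set (Fin 4 → ZMod 2)} (h0 : 0 ∈ K) (hadd : ∀ u ∈ K, ∀ v ∈ K, u + v ∈ K)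
    (hI : ∀ i ∈ I, Pi.single i 1 ∈ K) {w : G} (hw : w ∈ Subgroup.closure (e '' I)) :
    ∃ v ∈ K, coordProd e v = w := by
  induction hw using Subgroup.closure_induction with
  | mem x hx =>
    obtain ⟨i, hi, rfl⟩ := hx
    exact ⟨_, hI i hi, coordProd_single e i⟩
  | one => exact ⟨0, h0, coordProd_zero e⟩
  | mul x y _ _ hx hy =>
    obtain ⟨u, hu, rfl⟩ := hx
    obtain ⟨v, hv, rfl⟩ := hy
    exact ⟨u + v, hadd u hu v hv, coordProd_add hV he u v⟩
  | inv x _ hx =>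
    obtain ⟨u, hu, rfl⟩ := hx
    exact ⟨u, hu, eq_inv_of_mul_eq_one_left (by rw [← sq, hV _ (coordProd_mem he u)])⟩

lemma coordProd_injective (hV : ∀ v ∈ V, v ^ 2 = 1) (he : ∀ i, e i ∈ V)
    (hgen : V = Subgroup.closure (Set.range e)) (hcard : Nat.card V = 16) :
    Function.Injective (coordProd e) := by
  let f : (Fin 4 → ZMod 2) → V := fun v => ⟨coordProd e v, coordProd_mem he v⟩
  have hf : Function.Surjective f := by
    rintro ⟨w, hw⟩
    rw [hgen, ← Set.image_univ] at hw
    obtain ⟨v, -, hv⟩ := exists_coordProd_eq hV he (K := Set.univ) trivial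
      (fun _ _ _ _ => trivial) (fun _ _ => trivial) hw
    exact ⟨v, Subtype.ext hv⟩
  have hinj := (hf.bijective_of_nat_card_le (by simp [hcard])).injective
  exact fun u v huv => hinj (Subtype.ext huv)

lemma conj_coordProd (hV : ∀ v ∈ V, v ^ 2 = 1) (he : ∀ i, e i ∈ V) {g : G}
    {M : Matrix (Fin 4) (Fin 4) (ZMod 2)} (hM : ∀ i, g⁻¹ * e i * g = coordProd e (M i))
    (v : Fin 4 → ZMod 2) : g⁻¹ * coordProd e v * g = coordProd e (Matrix.vecMul v M) := by
  have hpow : ∀ i, g⁻¹ * e i ^ (v i).val * g = coordProd e (v i • M i) := by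
    intro i
    obtain h | h : v i = 0 ∨ v i = 1 := by generalize v i = a; revert a; decide
    · simp [h, coordProd_zero]
    · simpa [h, ZMod.val_one] using hM i
  have hsum : Matrix.vecMul v M = v 0 • M 0 + v 1 • M 1 + v 2 • M 2 + v 3 • M 3 := by
    rw [Matrix.vecMul_eq_sum, Fin.sum_univ_four]
  rw [hsum]
  simp only [coordProd_add hV he, ← hpow]
  simp only [coordProd]
  group

/-- The subgroup generated by the first two basis elements, in coordinates. -/
lemma mem_closure_pair_iff (hV : ∀ v ∈ V, v ^ 2 = 1) (he : ∀ i, e i ∈ V) {w : G} :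
    w ∈ Subgroup.closure {e 0, e 1} ↔ ∃ v ∈ insert 0 planeVectors, coordProd e v = w := by
  constructor
  · intro hw
    refine exists_coordProd_eq (I := {0, 1}) (K := {v | v ∈ insert 0 planeVectors}) hV he
      (by simp) ?_ ?_ (by rwa [Set.image_pair])
    · change ∀ u ∈ insert 0 planeVectors, ∀ v ∈ insert 0 planeVectors,
        u + v ∈ insert 0 planeVectors
      decide +kernel
    · change ∀ i ∈ ({0, 1} : Set (Fin 4)), Pi.single i 1 ∈ insert 0 planeVectors
      simp only [Set.mem_insert_iff, Set.mem_singleton_iff, forall_eq_or_imp, forall_eq]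
      decide +kernel
  · have h0 : e 0 ∈ Subgroup.closure {e 0, e 1} := Subgroup.subset_closure (by simp)
    have h1 : e 1 ∈ Subgroup.closure {e 0, e 1} := Subgroup.subset_closure (by simp)
    rintro ⟨v, hv, rfl⟩
    have hv' : v 2 = 0 ∧ v 3 = 0 := by revert v; decide +kernel
    simpa [coordProd, hv'] using
      Subgroup.mul_mem _ (Subgroup.pow_mem _ h0 (v 0).val) (Subgroup.pow_mem _ h1 (v 1).val)

end Coordinates



theorem stmt_2 {G : Type*} [Group G] [Finite G]
    (V : Subgroup G) (hVn : V.Normal) (hV2 : ∀ v ∈ V, v ^ 2 = 1)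
    (hV16 : Nat.card V = 16)
    (e : Fin 4 → G) (hVgen : V = Subgroup.closure {e 0, e 1, e 2, e 3})
    (ρ : G →* GL (Fin 4) (ZMod 2))
    (hρ : ∀ (g : G) (i : Fin 4),
      g⁻¹ * e i * g =
        e 0 ^ (((ρ g : Matrix (Fin 4) (Fin 4) (ZMod 2))) i 0).val *
        e 1 ^ (((ρ g : Matrix (Fin 4) (Fin 4) (ZMod 2))) i 1).val *
        e 2 ^ (((ρ g : Matrix (Fin 4) (Fin 4) (ZMod 2))) i 2).val *
        e 3 ^ (((ρ g : Matrix (Fin 4) (Fin 4) (ZMod 2))) i 3).val)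
    (A₁ A₂ A₃ : GL (Fin 4) (ZMod 2))
    (hA₁ : (A₁ : Matrix (Fin 4) (Fin 4) (ZMod 2)) = !![0,0,0,1; 1,1,0,0; 0,0,1,0; 1,0,0,1])
    (hA₂ : (A₂ : Matrix (Fin 4) (Fin 4) (ZMod 2)) = !![1,1,1,1; 0,0,1,0; 0,1,0,0; 0,0,0,1])
    (hA₃ : (A₃ : Matrix (Fin 4) (Fin 4) (ZMod 2)) = !![1,0,0,0; 0,1,0,0; 1,1,0,1; 1,1,1,0])
    (himg : ρ.range = Subgroup.closure {A₁, A₂} ∨ ρ.range = Subgroup.closure {A₁, A₂, A₃})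
    (W : Subgroup G) (hW : W = Subgroup.closure {e 0, e 1}) :
    Nat.card (G ⧸ W) = 4 * V.index ∧
    ({δ : G ⧸ W | Nat.card (orbit (stabilizer G ((1 : G) : G ⧸ W)) δ) ≤ 2}.ncard : ℚ)
      = 5 / 6 * Nat.card (G ⧸ W) := by
  have hVrange : V = Subgroup.closure (Set.range e) := by
    rw [hVgen]
    congr 1
    ext x
    simp [Fin.exists_fin_succ, eq_comm]
  have he : ∀ i, e i ∈ V := fun i => hVrange ▸ Subgroup.subset_closure ⟨i, rfl⟩
  have hinj := coordProd_injective hV2 he hVrange hV16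
  have hWmem : ∀ {w : G}, w ∈ W ↔ ∃ v ∈ insert 0 planeVectors, coordProd e v = w :=
    hW ▸ mem_closure_pair_iff hV2 he
  have hWcard : Nat.card W = 4 := by
    classical
    have : (W : Set G) = (insert 0 planeVectors).image (coordProd e) := by
      ext w
      simp only [SetLike.mem_coe, hWmem, Finset.coe_image, Set.mem_image]
    rw [← SetLike.coe_sort_coe, this, Nat.card_eq_card_toFinset, Finset.toFinset_coe,
      Finset.card_image_of_injective _ hinj]
    decide +kernel
  have hconj : ∀ g v, g⁻¹ * coordProd e v * g = coordProd e (Matrix.vecMul v (ρ g).val) :=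
    fun g v => conj_coordProd hV2 he (hρ g) v
  have hsub : ∀ g : G, (∃ w ∈ W, w ≠ 1 ∧ g⁻¹ * w * g ∈ W) ↔
      (planeImage (ρ g).val ∩ planeVectors).Nonempty := by
    intro g
    have hv0 : (0 : Fin 4 → ZMod 2) ∉ planeVectors := by decide +kernel
    constructor
    · rintro ⟨w, hw, hw1, h⟩
      obtain ⟨v, hv, rfl⟩ := hWmem.1 hw
      rw [hconj] at h
      obtain ⟨u, hu, huv⟩ := hWmem.1 h
      have hne : v ≠ 0 := by rintro rfl; exact hw1 (coordProd_zero e)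
      have hune : u ≠ 0 := by
        rintro rfl
        rw [← hconj, coordProd_zero, eq_comm, mul_assoc, inv_mul_eq_one, right_eq_mul] at huv
        exact hw1 huv
      refine ⟨u, Finset.mem_inter.2 ⟨?_, (Finset.mem_insert.1 hu).resolve_left hune⟩⟩
      rw [hinj huv]
      exact Finset.mem_image_of_mem _ ((Finset.mem_insert.1 hv).resolve_left hne)
    · rintro ⟨u, hu⟩
      rw [Finset.mem_inter, planeImage, Finset.mem_image] at hu
      obtain ⟨⟨v, hv, rfl⟩, hu⟩ := hu
      refine ⟨coordProd e v, hWmem.2 ⟨v, Finset.mem_insert_of_mem hv, rfl⟩, ?_, ?_⟩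
      · rw [← coordProd_zero e]
        exact fun h => hv0 (hinj h ▸ hv)
      · rw [hconj]
        exact hWmem.2 ⟨_, Finset.mem_insert_of_mem hu, rfl⟩
  have hmemOrbit : ∀ g, planeImage (ρ g).val ∈ planeOrbit := by
    intro g
    have hg : ρ g ∈ ρ.range := ⟨g, rfl⟩
    rcases himg with h | h <;> rw [h] at hg <;> refine planeImage_mem_planeOrbit ?_ hg <;>
      simp [matA, matB, matC, hA₁, hA₂, hA₃]
  have hA₁mem : A₁ ∈ ρ.range := by
    rcases himg with h | h <;> rw [h] <;> exact Subgroup.subset_closure (by simp)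
  have hA₂mem : A₂ ∈ ρ.range := by
    rcases himg with h | h <;> rw [h] <;> exact Subgroup.subset_closure (by simp)
  have hsurj : ∀ S ∈ planeOrbit, ∃ g, planeImage (ρ g).val = S := by
    intro S hS
    obtain ⟨_, ⟨g, rfl⟩, hg⟩ := exists_planeImage_eq ρ.range hA₁mem hA₂mem hA₁ hA₂ S hS
    exact ⟨g, hg⟩
  have hcount := card_setOf_mul_card_range (fun g => planeImage (ρ g).val)
    (fun S => (S ∩ planeVectors).Nonempty) planeOrbit
    (fun a b c hab => by simp only [map_mul, Units.val_mul, planeImage_mul, hab])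
    hmemOrbit hsurj
  have hlift := card_setOf_mk W
    (fun δ => Nat.card (orbit (stabilizer G ((1 : G) : G ⧸ W)) δ) ≤ 2)
  simp only [card_suborbit_le_two_iff W hWcard, hsub] at hlift
  have hGW := W.card_eq_card_quotient_mul_card_subgroup
  have hGV := V.index_mul_card
  rw [hlift, card_planeOrbit, card_planeOrbit_filter, hWcard, hGW, hWcard] at hcount
  rw [hV16, hGW, hWcard] at hGV
  refine ⟨by omega, ?_⟩
  have : ({δ : G ⧸ W | Nat.card (orbit (stabilizer G ((1 : G) : G ⧸ W)) δ) ≤ 2}.ncard : ℚ) * 6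
      = 5 * Nat.card (G ⧸ W) := by
    norm_cast
    omega
  linarith
end

section
/- Let G be a finite group acting transitively and faithfully on a finite set Ω and properly containing a subgroup R that acts regularly on Ω. Identifying Ω with R, the number of subsets S ⊆ R such that G ≤ Aut(Cay(R,S)) is at most 2^{3|R|/4}. -/
/-- Twice the number of orbits is at most the number of points plus the number of fixed points. -/
theorem MulAction.two_mul_card_orbits_le {H X : Type*} [Group H] [MulAction H X] [Finite X] :
    2 * Nat.card (MulAction.orbitRel.Quotient H X) ≤
      Nat.card X + Nat.card (MulAction.fixedPoints H X) := by
  classical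
  let Q := MulAction.orbitRel.Quotient H X
  let π : X → Q := Quotient.mk''
  have hπ : ∀ (h : H) (x : X), π (h • x) = π x := fun h x =>
    Quotient.sound (MulAction.mem_orbit x h)
  have hout : ∀ q : Q, π q.out = q := fun q => Quotient.out_eq' q
  have hmove : ∀ q : Q, q.out ∉ MulAction.fixedPoints H X → ∃ h : H, h • q.out ≠ q.out := by
    intro q hq
    by_contra! hc
    exact hq hc
  choose m hm using hmove
  let f : Q ⊕ Q → X ⊕ MulAction.fixedPoints H X := Sum.elim (fun q => Sum.inl q.out)
    (fun q => if hq : q.out ∈ MulAction.fixedPoints H X then Sum.inr ⟨q.out, hq⟩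
      else Sum.inl (m q hq • q.out))
  have hfix : ∀ (q : Q) (hq : q.out ∈ MulAction.fixedPoints H X),
      f (Sum.inr q) = Sum.inr ⟨q.out, hq⟩ := fun q hq => dif_pos hq
  have hfne : ∀ (q : Q) (hq : q.out ∉ MulAction.fixedPoints H X),
      f (Sum.inr q) = Sum.inl (m q hq • q.out) := fun q hq => dif_neg hq
  have hf : Function.Injective f := by
    let p : X ⊕ MulAction.fixedPoints H X → Q := Sum.elim π (fun x => π x)
    have hl : ∀ q, p (f (Sum.inl q)) = q := hout
    have hr : ∀ q, p (f (Sum.inr q)) = q := by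
      intro q
      by_cases hq : q.out ∈ MulAction.fixedPoints H X
      · rw [hfix q hq]
        exact hout q
      · rw [hfne q hq]
        exact (hπ _ _).trans (hout q)
    have hne : ∀ q, f (Sum.inl q) ≠ f (Sum.inr q) := by
      intro q h
      by_cases hq : q.out ∈ MulAction.fixedPoints H X
      · rw [hfix q hq] at h
        exact Sum.inl_ne_inr h
      · rw [hfne q hq] at h
        exact hm q hq (Sum.inl_injective h).symm
    rintro (a | a) (b | b) h
    · rw [← hl a, h, hl b]
    · have hab : a = b := by rw [← hl a, h, hr b]
      subst hab
      exact (hne a h).elim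
    · have hab : a = b := by rw [← hr a, h, hl b]
      subst hab
      exact (hne a h.symm).elim
    · rw [← hr a, h, hr b]
  have hcard := Nat.card_le_card_of_injective f hf
  rw [Nat.card_sum, Nat.card_sum] at hcard
  change 2 * Nat.card Q ≤ _
  omega

/-- If a permutation group `G` properly contains the right regular representation of `R`, then
at most half of the points are fixed by the stabilizer of `1`. -/
theorem two_mul_card_fixedPoints_stabilizer_one_le {R : Type*} [Group R] [Finite R]
    (G : Subgroup (Equiv.Perm R))
    (hreg : Set.range (fun r : R => Equiv.mulRight r) ⊂ (G : Set (Equiv.Perm R))) :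
    2 * Nat.card (MulAction.fixedPoints
      ↥(G ⊓ MulAction.stabilizer (Equiv.Perm R) (1 : R)) R) ≤ Nat.card R := by
  have hR : ∀ r : R, Equiv.mulRight r ∈ G := fun r => hreg.1 ⟨r, rfl⟩
  let M : Submonoid R :=
    { carrier := {r | ∀ g ∈ G, g 1 = 1 → g r = r}
      one_mem' := fun g _ h => h
      mul_mem' := by
        intro s r hs hr g hg h1
        have h := hs (Equiv.mulRight r⁻¹ * g * Equiv.mulRight r)
          (mul_mem (mul_mem (hR _) hg) (hR _)) (by simp [hr g hg h1])
        simpa [mul_inv_eq_iff_eq_mul] using h }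
  let F : Subgroup R :=
    { M with
      inv_mem' := by
        intro x hx
        have h : x⁻¹ ∈ Submonoid.powers x := by
          rw [mem_powers_iff_mem_zpowers]
          exact inv_mem (Subgroup.mem_zpowers x)
        exact (Submonoid.powers_le.2 (show x ∈ M from hx)) h }
  have hF : MulAction.fixedPoints ↥(G ⊓ MulAction.stabilizer (Equiv.Perm R) (1 : R)) R
      = (F : Set R) := by
    ext r
    constructor
    · intro h g hg h1
      exact h ⟨g, hg, h1⟩
    · rintro h ⟨g, hg, h1⟩
      exact h g hg h1
  have hne : F.index ≠ 1 := by
    intro h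
    rw [Subgroup.index_eq_one] at h
    obtain ⟨g, hg, hgR⟩ := Set.exists_of_ssubset hreg
    refine hgR ⟨g 1, Equiv.ext fun x => ?_⟩
    have hx : x ∈ F := h ▸ Subgroup.mem_top x
    have := hx (Equiv.mulRight (g 1)⁻¹ * g) (mul_mem (hR _) hg) (by simp)
    exact (mul_inv_eq_iff_eq_mul.1 this).symm
  have h0 : F.index ≠ 0 := Subgroup.index_ne_zero_of_finite
  rw [hF, ← F.card_mul_index, mul_comm]
  exact Nat.mul_le_mul_left _ (by omega)

theorem stmt_3 {R : Type*} [Group R] [Finite R] (G : Subgroup (Equiv.Perm R))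
    (hreg : Set.range (fun r : R => Equiv.mulRight r) ⊂ (G : Set (Equiv.Perm R)))
    (htrans : MulAction.IsPretransitive G R) :
    ({S : Set R | ∀ g ∈ G, ∀ r t : R, t * r⁻¹ ∈ S ↔ g t * (g r)⁻¹ ∈ S}.ncard : ℝ)
      ≤ 2 ^ ((3 : ℝ) * Nat.card R / 4) := by
  let H := G ⊓ MulAction.stabilizer (Equiv.Perm R) (1 : R)
  let Q := MulAction.orbitRel.Quotient H R
  let π : R → Q := Quotient.mk''
  have hsub : {S : Set R | ∀ g ∈ G, ∀ r t : R, t * r⁻¹ ∈ S ↔ g t * (g r)⁻¹ ∈ S} ⊆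
      Set.range (fun T : Set Q => π ⁻¹' T) := by
    intro S hS
    refine ⟨π '' S, Set.Subset.antisymm ?_ (Set.subset_preimage_image π S)⟩
    rintro x ⟨y, hy, hyx⟩
    obtain ⟨⟨g, hg, h1⟩, rfl⟩ : y ∈ MulAction.orbit H x := Quotient.exact hyx
    have h1' : g 1 = 1 := h1
    have h := hS g hg 1 x
    rw [h1', inv_one, mul_one, mul_one] at h
    exact h.2 hy
  have hcard : {S : Set R | ∀ g ∈ G, ∀ r t : R, t * r⁻¹ ∈ S ↔ g t * (g r)⁻¹ ∈ S}.ncard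
      ≤ 2 ^ Nat.card Q := by
    refine (Set.ncard_le_ncard hsub (Set.toFinite _)).trans ?_
    rw [← Set.image_univ]
    refine (Set.ncard_image_le (Set.toFinite _)).trans ?_
    rw [Set.ncard_univ]
    have := Fintype.ofFinite Q
    simp [Nat.card_eq_fintype_card]
  have hQ : 4 * Nat.card Q ≤ 3 * Nat.card R := by
    have h1 := MulAction.two_mul_card_orbits_le (H := H) (X := R)
    have h2 := two_mul_card_fixedPoints_stabilizer_one_le G hreg
    change 2 * Nat.card Q ≤ _ at h1
    change 2 * Nat.card (MulAction.fixedPoints H R) ≤ _ at h2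
    omega
  have hQ' : (4 : ℝ) * Nat.card Q ≤ 3 * Nat.card R := by exact_mod_cast hQ
  calc _ ≤ (2 : ℝ) ^ Nat.card Q := by exact_mod_cast hcard
    _ = (2 : ℝ) ^ (Nat.card Q : ℝ) := (Real.rpow_natCast _ _).symm
    _ ≤ _ := Real.rpow_le_rpow_of_exponent_le one_le_two (by linarith)
end

section
/- Let G be a finite group acting transitively and faithfully on a finite set Ω and properly containing a subgroup R that acts regularly on Ω. Identifying Ω with R, at least one of the following holds: (a) the number of inverse-closed subsets S ⊆ R with G ≤ Aut(Cay(R,S)) is at most 2^{c(R) − |R|/96}; (b) R is abelian of exponent greater than 2; (c) R is generalized dicyclic. -/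
/-- A group is generalized dicyclic if it is `Dic(A,y,x) = ⟨A, x | x² = y, aˣ = a⁻¹ ∀a ∈ A⟩`
for some abelian subgroup `A` of index 2 of exponent greater than 2 and
some involution `y = x² ∈ A`. -/
def IsGeneralizedDicyclic (R : Type*) [Group R] : Prop :=
  ∃ (A : Subgroup R) (x : R), (∀ a b : A, a * b = b * a) ∧
    2 < Monoid.exponent A ∧ A.index = 2 ∧ x ∉ A ∧ x ^ 2 ∈ A ∧ x ^ 2 ≠ 1 ∧
    (x ^ 2) ^ 2 = 1 ∧ ∀ a ∈ A, x * a * x⁻¹ = a⁻¹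

section Counting

variable {R : Type*} [Group R]

theorem Subgroup.ncard_coe (H : Subgroup R) : (H : Set R).ncard = Nat.card H :=
  (Nat.card_coe_set_eq _).symm

theorem mem_centralizer_singleton {x y : R} :
    y ∈ Subgroup.centralizer {x} ↔ y * x = x * y := by
  simp [Subgroup.mem_centralizer_iff, eq_comm]

theorem ncard_mul_right_mem (s : Set R) (x : R) : {y | y * x ∈ s}.ncard = s.ncard := by
  have : {y | y * x ∈ s} = (fun y => y * x⁻¹) '' s := by
    ext y
    simp only [Set.mem_ofPred_eq, Set.mem_image]
    exact ⟨fun h => ⟨_, h, by group⟩, by rintro ⟨z, hz, rfl⟩; simpa using hz⟩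
  rw [this, Set.ncard_image_of_injective _ (mul_left_injective _)]

theorem ncard_mul_left_mem (s : Set R) (x : R) : {y | x * y ∈ s}.ncard = s.ncard := by
  have : {y | x * y ∈ s} = (fun y => x⁻¹ * y) '' s := by
    ext y
    simp only [Set.mem_ofPred_eq, Set.mem_image]
    exact ⟨fun h => ⟨_, h, by group⟩, by rintro ⟨z, hz, rfl⟩; simpa using hz⟩
  rw [this, Set.ncard_image_of_injective _ (mul_right_injective _)]

theorem centralizer_singleton_ne_top {x : R} (hx : x ∉ Subgroup.center R) :
    Subgroup.centralizer {x} ≠ ⊤ := by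
  intro h
  refine hx (Subgroup.mem_center_iff.2 fun g => ?_)
  exact mem_centralizer_singleton.1 (h ▸ Subgroup.mem_top g)

variable [Finite R]

theorem Subgroup.two_mul_card_le_of_ne_top {H : Subgroup R} (h : H ≠ ⊤) :
    2 * Nat.card H ≤ Nat.card R := by
  rw [← H.card_mul_index, mul_comm]
  have : H.index ≠ 1 := fun h1 => h (Subgroup.index_eq_one.1 h1)
  have : H.index ≠ 0 := Subgroup.index_ne_zero_of_finite
  exact Nat.mul_le_mul_left _ (by omega)

theorem Subgroup.eq_top_of_card_lt {H : Subgroup R} {s : Set R} (hs : s ⊆ H)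
    (hcard : Nat.card R < 2 * s.ncard) : H = ⊤ := by
  by_contra h
  have h1 := Subgroup.two_mul_card_le_of_ne_top h
  have h2 := Set.ncard_le_ncard hs
  rw [Subgroup.ncard_coe] at h2
  omega

theorem four_mul_card_center_le {x : R} (hx : x ∉ Subgroup.center R) :
    4 * Nat.card (Subgroup.center R) ≤ Nat.card R := by
  have h1 := Subgroup.two_mul_card_le_of_ne_top (centralizer_singleton_ne_top hx)
  have hle : Subgroup.center R ≤ Subgroup.centralizer {x} := Subgroup.center_le_centralizer _
  have h2 : (Subgroup.center R).subgroupOf (Subgroup.centralizer {x}) ≠ ⊤ := by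
    intro h
    rw [Subgroup.subgroupOf_eq_top] at h
    exact hx (h (mem_centralizer_singleton.2 rfl))
  have h3 := Subgroup.two_mul_card_le_of_ne_top h2
  rw [Nat.card_congr (Subgroup.subgroupOfEquivOfLe hle).toEquiv] at h3
  omega

theorem ncard_inverters_le (x : R) :
    {y : R | y * x * y⁻¹ = x⁻¹}.ncard ≤ Nat.card (Subgroup.centralizer {x}) := by
  rcases Set.eq_empty_or_nonempty {y : R | y * x * y⁻¹ = x⁻¹} with h | ⟨y₀, hy₀⟩
  · simp [h]
  · rw [← Subgroup.ncard_coe, ← ncard_mul_left_mem _ y₀]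
    refine Set.ncard_le_ncard fun y hy => ?_
    simp only [Set.mem_ofPred_eq, SetLike.mem_coe, mem_centralizer_singleton,
      mul_inv_eq_iff_eq_mul] at hy hy₀ ⊢
    rwa [← mul_assoc, ← hy₀, mul_assoc, mul_assoc, mul_left_cancel_iff] at hy

/-- A homomorphism inverting more than three quarters of the elements inverts all of them. -/
theorem inverts_of_card_lt (φ : R →* R) (h : 4 * {x : R | φ x ≠ x⁻¹}.ncard < Nat.card R) :
    (∀ x y : R, x * y = y * x) ∧ ∀ x, φ x = x⁻¹ := by
  set B : Set R := {x | φ x ≠ x⁻¹} with hB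
  have hcard : Bᶜ.ncard + B.ncard = Nat.card R := by
    rw [add_comm, Set.ncard_add_ncard_compl]
  have hcent : Bᶜ ⊆ (Subgroup.center R : Set R) := by
    intro a ha
    by_contra hac
    have h1 := Subgroup.two_mul_card_le_of_ne_top (centralizer_singleton_ne_top hac)
    have h2 : (Set.univ : Set R) ⊆
        (Subgroup.centralizer {a} : Set R) ∪ B ∪ {y | a * y ∈ B} := by
      intro m _
      by_contra hm
      simp only [hB, Set.mem_union, SetLike.mem_coe, mem_centralizer_singleton, Set.mem_ofPred_eq,
        not_or, not_not, Set.mem_compl_iff] at hm ha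
      obtain ⟨⟨h3, h4⟩, h5⟩ := hm
      rw [map_mul, ha, h4, ← mul_inv_rev] at h5
      exact h3 (inv_injective h5)
    have h3 := Set.ncard_le_ncard h2
    have h4 := Set.ncard_union_le ((Subgroup.centralizer {a} : Set R) ∪ B) {y | a * y ∈ B}
    have h5 := Set.ncard_union_le (Subgroup.centralizer {a} : Set R) B
    rw [ncard_mul_left_mem] at h4
    rw [Set.ncard_univ] at h3
    rw [Subgroup.ncard_coe] at h5
    omega
  have htop := Subgroup.eq_top_of_card_lt hcent (by omega)
  have hcomm : ∀ x y : R, x * y = y * x := fun x y =>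
    Subgroup.mem_center_iff.1 (htop ▸ Subgroup.mem_top y) x
  refine ⟨hcomm, fun x => ?_⟩
  let H : Subgroup R :=
    { carrier := Bᶜ
      mul_mem' := by
        intro a b ha hb
        simp only [hB, Set.mem_compl_iff, Set.mem_ofPred_eq, not_not] at ha hb ⊢
        rw [map_mul, ha, hb, mul_inv_rev, hcomm]
      one_mem' := by simp [hB]
      inv_mem' := by
        intro a ha
        simp only [hB, Set.mem_compl_iff, Set.mem_ofPred_eq, not_not] at ha ⊢
        rw [map_inv, ha] }
  have hH : H = ⊤ := Subgroup.eq_top_of_card_lt (s := Bᶜ) le_rfl (by omega)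
  have : x ∈ H := hH ▸ Subgroup.mem_top x
  exact not_not.1 this

theorem two_lt_exponent_of_sq_ne_one {x : R} (hx : x ^ 2 ≠ 1) : 2 < Monoid.exponent R := by
  by_contra h
  have h0 : Monoid.exponent R ≠ 0 := Monoid.exponent_ne_zero_of_finite
  have h1 : Monoid.exponent R ∣ 2 := by
    have : Monoid.exponent R = 1 ∨ Monoid.exponent R = 2 := by omega
    rcases this with h | h <;> simp [h]
  exact hx (Monoid.exponent_dvd_iff_forall_pow_eq_one.1 h1 x)

theorem abelian_or_dicyclic_of_index_two {A : Subgroup R} (hA : A.index = 2) {y : R} (hy : y ∉ A)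
    (hy2 : y ^ 2 ≠ 1)
    (hcard : 8 * {a : R | a ∈ A ∧ y * a * y⁻¹ ≠ a⁻¹}.ncard < Nat.card R) :
    ((∀ x y : R, x * y = y * x) ∧ 2 < Monoid.exponent R) ∨ IsGeneralizedDicyclic R := by
  have : A.Normal := Subgroup.normal_of_index_eq_two hA
  have hcA : Nat.card A * 2 = Nat.card R := hA ▸ A.card_mul_index
  obtain ⟨hcomm, hinv⟩ := inverts_of_card_lt (MulAut.conjNormal y : A ≃* A).toMonoidHom (by
    have : {x : A | (MulAut.conjNormal y : A ≃* A).toMonoidHom x ≠ x⁻¹}.ncard ≤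
        {a : R | a ∈ A ∧ y * a * y⁻¹ ≠ a⁻¹}.ncard := by
      rw [← Set.ncard_image_of_injective _ (Subtype.val_injective (p := (· ∈ A)))]
      refine Set.ncard_le_ncard ?_
      rintro _ ⟨a, ha, rfl⟩
      refine ⟨a.2, fun h => ha (Subtype.ext ?_)⟩
      simpa using h
    omega)
  have hinv' : ∀ a ∈ A, y * a * y⁻¹ = a⁻¹ := fun a ha => by
    simpa using congrArg Subtype.val (hinv ⟨a, ha⟩)
  have hyA : y ^ 2 ∈ A := Subgroup.sq_mem_of_index_two hA y
  have hy4 : (y ^ 2) ^ 2 = 1 := by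
    have h1 := hinv' _ hyA
    have h2 : y * y ^ 2 * y⁻¹ = y ^ 2 := by group
    rw [h2] at h1
    rw [sq (y ^ 2)]
    nth_rewrite 1 [h1]
    group
  by_cases hexp : 2 < Monoid.exponent A
  · exact Or.inr ⟨A, y, hcomm, hexp, hA, hy, hyA, hy2, hy4, hinv'⟩
  · left
    refine ⟨?_, two_lt_exponent_of_sq_ne_one hy2⟩
    have hsq : ∀ a ∈ A, a⁻¹ = a := fun a ha => by
      by_contra h
      refine hexp (two_lt_exponent_of_sq_ne_one (x := (⟨a, ha⟩ : A)) fun h2 => h ?_)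
      have h3 : a ^ 2 = 1 := by simpa using congrArg Subtype.val h2
      rw [inv_eq_iff_mul_eq_one, ← sq, h3]
    have hyc : ∀ a ∈ A, y * a = a * y := fun a ha => by
      have := hinv' a ha
      rwa [hsq a ha, mul_inv_eq_iff_eq_mul] at this
    have hcomm' : ∀ a ∈ A, ∀ b ∈ A, a * b = b * a := fun a ha b hb => by
      simpa using congrArg Subtype.val (hcomm ⟨a, ha⟩ ⟨b, hb⟩)
    have hdec : ∀ g : R, ∃ a ∈ A, g = a ∨ g = a * y := fun g => by
      by_cases hg : g ∈ A
      · exact ⟨g, hg, Or.inl rfl⟩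
      · refine ⟨g * y⁻¹, ?_, Or.inr (by group)⟩
        rw [Subgroup.mul_mem_iff_of_index_two hA]
        simp [hg, hy]
    intro g k
    obtain ⟨a, ha, rfl | rfl⟩ := hdec g <;> obtain ⟨b, hb, rfl | rfl⟩ := hdec k
    · exact hcomm' _ ha _ hb
    · rw [mul_assoc, hyc _ ha, ← mul_assoc, ← mul_assoc, hcomm' _ ha _ hb]
    · rw [mul_assoc, hyc _ hb, ← mul_assoc, ← mul_assoc, hcomm' _ ha _ hb]
    · have h1 : a * y * (b * y) = a * b * y * y := by
        rw [mul_assoc, ← mul_assoc y b, hyc _ hb]; group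
      have h2 : b * y * (a * y) = b * a * y * y := by
        rw [mul_assoc, ← mul_assoc y a, hyc _ ha]; group
      rw [h1, h2, hcomm' _ ha _ hb]

end Counting

section Dense

theorem exists_notMem_of_sum_ncard_lt {α : Type*} [Finite α] (l : List (Set α))
    (h : (l.map Set.ncard).sum < Nat.card α) : ∃ y, ∀ s ∈ l, y ∉ s := by
  have hle : ∀ l : List (Set α), {y | ∃ s ∈ l, y ∈ s}.ncard ≤ (l.map Set.ncard).sum := by
    intro l
    induction l with
    | nil => simp
    | cons a l ih =>
      have h1 : {y | ∃ s ∈ a :: l, y ∈ s} = a ∪ {y | ∃ s ∈ l, y ∈ s} := by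
        ext y; simp
      rw [h1, List.map_cons, List.sum_cons]
      exact (Set.ncard_union_le _ _).trans (by omega)
  by_contra! hcon
  have h1 : {y | ∃ s ∈ l, y ∈ s} = Set.univ := Set.eq_univ_of_forall hcon
  have h2 := hle l
  rw [h1, Set.ncard_univ] at h2
  omega

variable {R : Type*} [Group R]

theorem ncard_mul_right_notMem (D : Set R) (x : R) : {y | y * x ∉ D}.ncard = Dᶜ.ncard :=
  ncard_mul_right_mem Dᶜ x

theorem ncard_mul_left_notMem (D : Set R) (x : R) : {y | x * y ∉ D}.ncard = Dᶜ.ncard :=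
  ncard_mul_left_mem Dᶜ x

theorem sq_eq_inv_sq_of_inverts {x y : R} (h : x * y * x⁻¹ = y⁻¹) (h' : y * x * y⁻¹ = x⁻¹) :
    y ^ 2 = (x ^ 2)⁻¹ := by
  rw [mul_inv_eq_iff_eq_mul] at h h'
  have h1 : y * x * y = x := by rw [mul_assoc, h]; group
  have h2 : x * y * x = y := by rw [mul_assoc, h']; group
  have h3 : y * x * x * y * x = x := by
    calc y * x * x * y * x = y * x * (x * y * x) := by simp only [mul_assoc]
      _ = x := by rw [h2, h1]
  rw [mul_eq_right, mul_eq_one_iff_eq_inv, mul_assoc, ← sq] at h3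
  rw [eq_inv_iff_mul_eq_one, sq y, mul_assoc, h3, mul_inv_cancel]

variable [Finite R]

/-- If the squares of almost all non-central elements coincide and are involutions, then `R` is
generalized dicyclic. -/
theorem isGeneralizedDicyclic_of_forall_sq_eq {D : Set R} (hD : 24 * Dᶜ.ncard < Nat.card R)
    {x : R} (hx : x ∉ Subgroup.center R) (hx2 : x ^ 2 ≠ 1)
    (hsq : ∀ y ∈ D, y ∉ Subgroup.center R → y ^ 2 = x ^ 2) :
    ((∀ x y : R, x * y = y * x) ∧ 2 < Monoid.exponent R) ∨ IsGeneralizedDicyclic R := by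
  have hZ := four_mul_card_center_le hx
  have hcent : ∀ w ∈ Subgroup.center R, w ^ 2 = 1 := by
    intro w hw
    obtain ⟨y, hy⟩ := exists_notMem_of_sum_ncard_lt
      [(Subgroup.center R : Set R), Dᶜ, {y | y * w ∉ D}] (by
        simp only [List.map_cons, List.map_nil, List.sum_cons, List.sum_nil, Subgroup.ncard_coe,
          ncard_mul_right_notMem]
        omega)
    simp only [List.mem_cons, List.not_mem_nil, or_false, forall_eq_or_imp, forall_eq,
      SetLike.mem_coe, Set.mem_compl_iff, Set.mem_ofPred_eq, not_not] at hy
    obtain ⟨hyZ, hyD, hywD⟩ := hy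
    have h1 := hsq _ hywD (fun h => hyZ ((Subgroup.mul_mem_cancel_right _ hw).1 h))
    have hc : Commute y w := Subgroup.mem_center_iff.1 hw y
    rw [hc.mul_pow, hsq _ hyD hyZ] at h1
    exact mul_eq_left.1 h1
  have hinv : ∀ y ∈ D, y * x ∈ D → y ∉ Subgroup.centralizer {x} → y * x * y⁻¹ = x⁻¹ := by
    intro y hyD hyxD hyC
    have hyC' : ¬ y * x = x * y := fun h => hyC (mem_centralizer_singleton.2 h)
    have hyZ : y ∉ Subgroup.center R := fun h => hyC' (Subgroup.mem_center_iff.1 h x).symm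
    have hyxZ : y * x ∉ Subgroup.center R := fun h => hyC' (by
      have := Subgroup.mem_center_iff.1 h x
      rw [← mul_assoc] at this
      exact mul_right_cancel this.symm)
    have h1 := hsq _ hyxD hyxZ
    rw [← hsq _ hyD hyZ, sq, sq, mul_assoc, mul_left_cancel_iff, ← mul_assoc] at h1
    rw [mul_inv_eq_iff_eq_mul, eq_inv_mul_iff_mul_eq, ← mul_assoc, h1]
  have hindex : (Subgroup.centralizer {x}).index = 2 := by
    have h0 : (Subgroup.centralizer {x}).index ≠ 0 := Subgroup.index_ne_zero_of_finite
    have h1 : (Subgroup.centralizer {x}).index ≠ 1 := fun h =>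
      centralizer_singleton_ne_top hx (Subgroup.index_eq_one.1 h)
    by_contra h2
    have h3 := (Subgroup.centralizer {x}).card_mul_index
    have h4 : Nat.card (Subgroup.centralizer {x}) * 3 ≤ Nat.card R := by
      rw [← h3]; exact Nat.mul_le_mul_left _ (by omega)
    have h5 := ncard_inverters_le x
    obtain ⟨y, hy⟩ := exists_notMem_of_sum_ncard_lt
      [(Subgroup.centralizer {x} : Set R), Dᶜ, {y | y * x ∉ D}, {y | y * x * y⁻¹ = x⁻¹}] (by
        simp only [List.map_cons, List.map_nil, List.sum_cons, List.sum_nil, Subgroup.ncard_coe,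
          ncard_mul_right_notMem]
        omega)
    simp only [List.mem_cons, List.not_mem_nil, or_false, forall_eq_or_imp, forall_eq,
      SetLike.mem_coe, Set.mem_compl_iff, Set.mem_ofPred_eq, not_not] at hy
    exact hy.2.2.2 (hinv y hy.2.1 hy.2.2.1 hy.1)
  have hcard := (Subgroup.centralizer {x}).card_mul_index
  rw [hindex] at hcard
  obtain ⟨y, hy⟩ := exists_notMem_of_sum_ncard_lt
    [(Subgroup.centralizer {x} : Set R), Dᶜ, {y | y * x ∉ D}] (by
      simp only [List.map_cons, List.map_nil, List.sum_cons, List.sum_nil, Subgroup.ncard_coe,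
        ncard_mul_right_notMem]
      omega)
  simp only [List.mem_cons, List.not_mem_nil, or_false, forall_eq_or_imp, forall_eq,
    SetLike.mem_coe, Set.mem_compl_iff, Set.mem_ofPred_eq, not_not] at hy
  obtain ⟨hyC, hyD, hyxD⟩ := hy
  have hyx := hinv y hyD hyxD hyC
  have hyZ : y ∉ Subgroup.center R := fun h => hyC (Subgroup.center_le_centralizer _ h)
  refine abelian_or_dicyclic_of_index_two hindex hyC (by rwa [hsq y hyD hyZ]) ?_
  have hsub : {a : R | a ∈ Subgroup.centralizer {x} ∧ y * a * y⁻¹ ≠ a⁻¹} ⊆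
      Dᶜ ∪ {a | x * a ∉ D} := by
    rintro a ⟨haC, ha⟩
    by_contra h
    simp only [Set.mem_union, Set.mem_compl_iff, Set.mem_ofPred_eq, not_or, not_not] at h
    obtain ⟨haD, hxaD⟩ := h
    have hZinv : ∀ w ∈ Subgroup.center R, w⁻¹ = w := fun w hw => by
      rw [inv_eq_iff_mul_eq_one, ← sq, hcent w hw]
    by_cases haZ : a ∈ Subgroup.center R
    · refine ha ?_
      rw [Subgroup.mem_center_iff.1 haZ y, mul_inv_cancel_right, hZinv a haZ]
    · by_cases hxaZ : x * a ∈ Subgroup.center R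
      · refine ha ?_
        obtain ⟨w, hw, rfl⟩ : ∃ w ∈ Subgroup.center R, a = x⁻¹ * w := ⟨x * a, hxaZ, by group⟩
        have h1 := Subgroup.mem_center_iff.1 hw
        have h2 : y * x⁻¹ * y⁻¹ = x := by
          simpa [mul_assoc] using congrArg (·⁻¹) hyx
        calc y * (x⁻¹ * w) * y⁻¹ = y * x⁻¹ * (w * y⁻¹) := by group
          _ = y * x⁻¹ * y⁻¹ * w := by rw [← h1]; group
          _ = (x⁻¹ * w)⁻¹ := by rw [h2, mul_inv_rev, inv_inv, hZinv w hw, h1]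
      · have hc : Commute x a := (mem_centralizer_singleton.1 haC).symm
        have h1 := hsq _ hxaD hxaZ
        rw [hc.mul_pow, hsq a haD haZ] at h1
        exact hx2 (mul_eq_left.1 h1)
  have h1 := Set.ncard_le_ncard hsub
  have h2 := Set.ncard_union_le Dᶜ {a | x * a ∉ D}
  rw [ncard_mul_left_notMem] at h2
  omega

theorem abelian_or_dicyclic_of_dense {D : Set R} {N : Subgroup R}
    (hD : 24 * Dᶜ.ncard < Nat.card R) (hinv : ∀ x ∈ D, x⁻¹ ∈ D) (hN : N ≠ ⊤)
    (hsq : ∀ x ∈ D, x ∉ N → x ^ 2 ≠ 1)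
    (hfix : ∀ x ∈ D, x ∈ N → ∀ y ∈ D, y ∉ N → y * x ∈ D → y * x * y⁻¹ = x⁻¹)
    (hmov : ∀ x ∈ D, x ∉ N → ∀ y ∈ D, y * x ∈ D →
      x * y = y * x ∨ x * y * x⁻¹ = y⁻¹ ∨ y ^ 2 = (x ^ 2)⁻¹) :
    ((∀ x y : R, x * y = y * x) ∧ 2 < Monoid.exponent R) ∨ IsGeneralizedDicyclic R := by
  have hN2 := Subgroup.two_mul_card_le_of_ne_top hN
  have hNcard := N.card_mul_index
  obtain ⟨x₁, hx₁⟩ := exists_notMem_of_sum_ncard_lt [(N : Set R), Dᶜ] (by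
    simp only [List.map_cons, List.map_nil, List.sum_cons, List.sum_nil, Subgroup.ncard_coe]
    omega)
  simp only [List.mem_cons, List.not_mem_nil, or_false, forall_eq_or_imp, forall_eq,
    SetLike.mem_coe, Set.mem_compl_iff, not_not] at hx₁
  by_cases hN3 : N.index = 2
  · refine abelian_or_dicyclic_of_index_two hN3 hx₁.1 (hsq _ hx₁.2 hx₁.1) ?_
    have hsub : {a : R | a ∈ N ∧ x₁ * a * x₁⁻¹ ≠ a⁻¹} ⊆ Dᶜ ∪ {a | x₁ * a ∉ D} := by
      rintro a ⟨haN, ha⟩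
      by_contra h
      simp only [Set.mem_union, Set.mem_compl_iff, Set.mem_ofPred_eq, not_or, not_not] at h
      exact ha (hfix a h.1 haN x₁ hx₁.2 hx₁.1 h.2)
    have h1 := Set.ncard_le_ncard hsub
    have h2 := Set.ncard_union_le Dᶜ {a | x₁ * a ∉ D}
    rw [ncard_mul_left_notMem] at h2
    omega
  have hN3' : Nat.card N * 3 ≤ Nat.card R := by
    have h0 : N.index ≠ 0 := Subgroup.index_ne_zero_of_finite
    have h1 : N.index ≠ 1 := fun h => hN (Subgroup.index_eq_one.1 h)
    rw [← hNcard]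
    exact Nat.mul_le_mul_left _ (by omega)
  by_cases hab : ∀ x y : R, x * y = y * x
  · exact Or.inl ⟨hab, two_lt_exponent_of_sq_ne_one (hsq _ hx₁.2 hx₁.1)⟩
  obtain ⟨u, hu⟩ : ∃ u, u ∉ Subgroup.center R := by
    by_contra! h
    exact hab fun x y => Subgroup.mem_center_iff.1 (h y) x
  have hZ := four_mul_card_center_le hu
  have hNZ : ∀ x ∈ D, x ∉ Subgroup.center R → x ∉ N := by
    intro x hxD hxZ hxN
    have h1 := ncard_inverters_le x
    have h2 := Subgroup.two_mul_card_le_of_ne_top (centralizer_singleton_ne_top hxZ)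
    obtain ⟨y, hy⟩ := exists_notMem_of_sum_ncard_lt
      [(N : Set R), Dᶜ, {y | y * x ∉ D}, {y | y * x * y⁻¹ = x⁻¹}] (by
        simp only [List.map_cons, List.map_nil, List.sum_cons, List.sum_nil, Subgroup.ncard_coe,
          ncard_mul_right_notMem]
        omega)
    simp only [List.mem_cons, List.not_mem_nil, or_false, forall_eq_or_imp, forall_eq,
      SetLike.mem_coe, Set.mem_compl_iff, Set.mem_ofPred_eq, not_not] at hy
    exact hy.2.2.2 (hfix x hxD hxN y hy.2.1 hy.1 hy.2.2.1)
  have hpair : ∀ x ∈ D, ∀ y ∈ D, x * y ≠ y * x → x * y ∈ D → y * x ∈ D →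
      y ^ 2 = (x ^ 2)⁻¹ := by
    intro x hxD y hyD hxy hxyD hyxD
    have hxZ : x ∉ Subgroup.center R := fun h => hxy (Subgroup.mem_center_iff.1 h y).symm
    have hyZ : y ∉ Subgroup.center R := fun h => hxy (Subgroup.mem_center_iff.1 h x)
    rcases hmov x hxD (hNZ x hxD hxZ) y hyD hyxD with h | h | h
    · exact absurd h hxy
    · rcases hmov y hyD (hNZ y hyD hyZ) x hxD hxyD with h' | h' | h'
      · exact absurd h'.symm hxy
      · exact sq_eq_inv_sq_of_inverts h h'
      · rw [h', inv_inv]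
    · exact h
  have hsqinv : ∀ x ∈ D, x ∉ Subgroup.center R → (x ^ 2)⁻¹ = x ^ 2 := by
    intro x hxD hxZ
    have h2 := Subgroup.two_mul_card_le_of_ne_top (centralizer_singleton_ne_top hxZ)
    obtain ⟨y, hy⟩ := exists_notMem_of_sum_ncard_lt
      [(Subgroup.centralizer {x} : Set R), Dᶜ, {y | y * x ∉ D}, {y | x * y ∉ D},
        {y | y * x⁻¹ ∉ D}, {y | x⁻¹ * y ∉ D}] (by
        simp only [List.map_cons, List.map_nil, List.sum_cons, List.sum_nil, Subgroup.ncard_coe,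
          ncard_mul_right_notMem, ncard_mul_left_notMem]
        omega)
    simp only [List.mem_cons, List.not_mem_nil, or_false, forall_eq_or_imp, forall_eq,
      SetLike.mem_coe, Set.mem_compl_iff, Set.mem_ofPred_eq, not_not,
      mem_centralizer_singleton] at hy
    obtain ⟨hyx, hyD, h3, h4, h5, h6⟩ := hy
    have h7 := hpair x hxD y hyD (Ne.symm hyx) h4 h3
    have hcomm : ¬ Commute x⁻¹ y := fun h => hyx (Commute.inv_left_iff.1 h).symm
    have h8 := hpair x⁻¹ (hinv x hxD) y hyD hcomm h6 h5
    rw [inv_pow, inv_inv] at h8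
    rw [← h7, h8]
  have hpair' : ∀ x ∈ D, ∀ y ∈ D, x * y ≠ y * x → x * y ∈ D → y * x ∈ D → y ^ 2 = x ^ 2 := by
    intro x hxD y hyD hxy hxyD hyxD
    have hxZ : x ∉ Subgroup.center R := fun h => hxy (Subgroup.mem_center_iff.1 h y).symm
    rw [hpair x hxD y hyD hxy hxyD hyxD, hsqinv x hxD hxZ]
  have hclass : ∀ x ∈ D, x ∉ Subgroup.center R →
      3 * Nat.card R < 8 * {y | y ∈ D ∧ y ^ 2 = x ^ 2}.ncard := by
    intro x hxD hxZ
    have h2 := Subgroup.two_mul_card_le_of_ne_top (centralizer_singleton_ne_top hxZ)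
    by_contra hlt
    obtain ⟨y, hy⟩ := exists_notMem_of_sum_ncard_lt
      [(Subgroup.centralizer {x} : Set R), Dᶜ, {y | y * x ∉ D}, {y | x * y ∉ D},
        {y | y ∈ D ∧ y ^ 2 = x ^ 2}] (by
        simp only [List.map_cons, List.map_nil, List.sum_cons, List.sum_nil, Subgroup.ncard_coe,
          ncard_mul_right_notMem, ncard_mul_left_notMem]
        omega)
    simp only [List.mem_cons, List.not_mem_nil, or_false, forall_eq_or_imp, forall_eq,
      SetLike.mem_coe, Set.mem_compl_iff, Set.mem_ofPred_eq, not_not,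
      mem_centralizer_singleton] at hy
    obtain ⟨hyx, hyD, h3, h4, h5⟩ := hy
    exact h5 ⟨hyD, hpair' x hxD y hyD (Ne.symm hyx) h4 h3⟩
  obtain ⟨x, hx⟩ := exists_notMem_of_sum_ncard_lt [(Subgroup.center R : Set R), Dᶜ] (by
    simp only [List.map_cons, List.map_nil, List.sum_cons, List.sum_nil, Subgroup.ncard_coe]
    omega)
  simp only [List.mem_cons, List.not_mem_nil, or_false, forall_eq_or_imp, forall_eq,
    SetLike.mem_coe, Set.mem_compl_iff, not_not] at hx
  obtain ⟨hxZ, hxD⟩ := hx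
  refine isGeneralizedDicyclic_of_forall_sq_eq hD hxZ (hsq x hxD (hNZ x hxD hxZ)) ?_
  intro y hyD hyZ
  by_contra hne
  have hx2 := hsq x hxD (hNZ x hxD hxZ)
  have hy2 := hsq y hyD (hNZ y hyD hyZ)
  have hdisj : ∀ a b : R, a ≠ b →
      Disjoint {w : R | w ∈ D ∧ w ^ 2 = a} {w : R | w ∈ D ∧ w ^ 2 = b} := by
    intro a b hab
    rw [Set.disjoint_left]
    rintro w ⟨-, h1⟩ ⟨-, h2⟩
    exact hab (h1 ▸ h2)
  have hPx := hclass x hxD hxZ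
  have hPy := hclass y hyD hyZ
  have hle : {w | w ∈ D ∧ w ^ 2 = y ^ 2} ⊆
      {w | w * x ∉ D} ∪ {w | x * w ∉ D} ∪ {w | x * w ∈ (Subgroup.center R : Set R)} := by
    rintro w ⟨hwD, hw⟩
    by_contra h
    simp only [Set.mem_union, Set.mem_ofPred_eq, not_or, not_not, SetLike.mem_coe] at h
    obtain ⟨⟨hwxD, hxwD⟩, hxwZ⟩ := h
    have hc : x * w = w * x := by
      by_contra hc
      exact hne (hw ▸ hpair' x hxD w hwD hc hxwD hwxD)
    have hP := hclass _ hxwD hxwZ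
    rw [Commute.mul_pow hc, hw] at hP
    have h1 := Set.ncard_union_eq (hdisj _ _ hne)
    have h2 := Set.ncard_union_eq
      (s := {w : R | w ∈ D ∧ w ^ 2 = y ^ 2} ∪ {w | w ∈ D ∧ w ^ 2 = x ^ 2})
      (t := {w | w ∈ D ∧ w ^ 2 = x ^ 2 * y ^ 2}) (by
        rw [Set.disjoint_union_left]
        exact ⟨hdisj _ _ fun h => hx2 (right_eq_mul.1 h), hdisj _ _ fun h => hy2 (left_eq_mul.1 h)⟩)
    have h3 := Set.ncard_le_ncard (Set.subset_univ
      (({w : R | w ∈ D ∧ w ^ 2 = y ^ 2} ∪ {w | w ∈ D ∧ w ^ 2 = x ^ 2}) ∪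
        {w | w ∈ D ∧ w ^ 2 = x ^ 2 * y ^ 2}))
    rw [Set.ncard_univ] at h3
    omega
  have h1 := Set.ncard_le_ncard hle
  have h2 := Set.ncard_union_le ({w | w * x ∉ D} ∪ {w | x * w ∉ D})
    {w | x * w ∈ (Subgroup.center R : Set R)}
  have h3 := Set.ncard_union_le {w | w * x ∉ D} {w | x * w ∉ D}
  rw [ncard_mul_right_notMem, ncard_mul_left_notMem] at h3
  rw [ncard_mul_left_mem, Subgroup.ncard_coe] at h2
  omega

end Dense


section InvariantSets

variable {R : Type*}

/-- A family of sets has at most as many members as there are sets of classes of points that no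
member separates. -/
theorem ncard_le_two_pow_quotient [Finite R] (F : Set (Set R)) (s : Setoid R)
    (hs : ∀ S ∈ F, ∀ x y, s x y → (x ∈ S ↔ y ∈ S)) :
    F.ncard ≤ 2 ^ Nat.card (Quotient s) := by
  have := Fintype.ofFinite (Quotient s)
  rw [Nat.card_eq_fintype_card, ← Fintype.card_set, ← Nat.card_eq_fintype_card, ← Set.ncard_univ]
  refine Set.ncard_le_ncard_of_injOn (fun S => Quotient.mk s '' S) (fun _ _ => Set.mem_univ _) ?_
  have key : ∀ S ∈ F, Quotient.mk s ⁻¹' (Quotient.mk s '' S) = S := by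
    intro S hS
    refine Set.Subset.antisymm ?_ (Set.subset_preimage_image _ _)
    rintro x ⟨y, hy, hyx⟩
    exact (hs S hS y x (Quotient.exact hyx)).1 hy
  intro S hS T hT hST
  rw [← key S hS, ← key T hT]
  exact congrArg _ hST

variable [Group R]

/-- Weights summing to two or more over every inverse-closed pair `{x, x⁻¹}`. -/
noncomputable def involutionWeight (x : R) : ℕ := by
  classical exact if x ^ 2 = 1 then 2 else 1

theorem one_le_involutionWeight (x : R) : 1 ≤ involutionWeight x := by
  unfold involutionWeight
  split_ifs <;> omega

theorem two_le_sum_involutionWeight [DecidableEq R] (x : R) :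
    2 ≤ ∑ y ∈ {x, x⁻¹}, involutionWeight y := by
  by_cases h : x ^ 2 = 1
  · refine le_trans ?_ (Finset.single_le_sum (fun _ _ => Nat.zero_le _)
      (Finset.mem_insert_self x {x⁻¹}))
    simp [involutionWeight, h]
  · have hne : x ≠ x⁻¹ := fun hx => h (by rw [sq]; exact mul_eq_one_iff_eq_inv.2 hx)
    rw [Finset.sum_pair hne]
    have h1 := one_le_involutionWeight x
    have h2 := one_le_involutionWeight x⁻¹
    omega

theorem sum_involutionWeight [Fintype R] :
    ∑ x : R, involutionWeight x = Nat.card R + {x : R | x ^ 2 = 1}.ncard := by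
  classical
  have h1 : ∀ x : R, involutionWeight x = 1 + if x ^ 2 = 1 then 1 else 0 := by
    intro x
    unfold involutionWeight
    split_ifs <;> rfl
  simp only [h1, Finset.sum_add_distrib, Finset.sum_boole]
  simp [Set.ncard_eq_toFinset_card']

theorem four_mul_card_quotient_add_le [Finite R] (s : Setoid R) (hinv : ∀ x, s x x⁻¹) (B : Set R)
    (hB : ∀ x ∈ B, ∃ y, s x y ∧ y ≠ x ∧ y ≠ x⁻¹) :
    4 * Nat.card (Quotient s) + B.ncard ≤
      2 * (Nat.card R + {x : R | x ^ 2 = 1}.ncard) := by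
  classical
  have := Fintype.ofFinite R
  have hfib : ∀ q : Quotient s,
      4 + ∑ x with Quotient.mk s x = q, (if x ∈ B then 1 else 0) ≤
        2 * ∑ x with Quotient.mk s x = q, involutionWeight x := by
    intro q
    obtain ⟨x, rfl⟩ := Quotient.exists_rep q
    have hpair : ∀ y, s x y → ({y, y⁻¹} : Finset R) ⊆
        Finset.univ.filter fun z => Quotient.mk s z = Quotient.mk s x := by
      intro y hy z hz
      rw [Finset.mem_insert, Finset.mem_singleton] at hz
      refine Finset.mem_filter.2 ⟨Finset.mem_univ _, Quotient.sound ?_⟩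
      rcases hz with rfl | rfl
      · exact s.symm hy
      · exact s.symm (s.trans hy (hinv y))
    by_cases hx : ∃ y ∈ B, s x y
    · obtain ⟨y, hyB, hxy⟩ := hx
      obtain ⟨z, hyz, hzy, hzy'⟩ := hB y hyB
      have hdisj : Disjoint ({y, y⁻¹} : Finset R) {z, z⁻¹} := by
        rw [Finset.disjoint_left]
        intro a ha hb
        rw [Finset.mem_insert, Finset.mem_singleton] at ha hb
        rcases ha with rfl | rfl <;> rcases hb with h | h
        · exact hzy h.symm
        · exact hzy' (by rw [h, inv_inv])
        · exact hzy' h.symm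
        · exact hzy (inv_injective h).symm
      have h1 := Finset.sum_le_sum_of_subset (f := involutionWeight)
        (Finset.union_subset (hpair y hxy) (hpair z (s.trans hxy hyz)))
      rw [Finset.sum_union hdisj] at h1
      have h2 := two_le_sum_involutionWeight y
      have h3 := two_le_sum_involutionWeight z
      have h4 : ∑ z with Quotient.mk s z = Quotient.mk s x, (if z ∈ B then 1 else 0) ≤
          ∑ z with Quotient.mk s z = Quotient.mk s x, involutionWeight z := by
        refine Finset.sum_le_sum fun z _ => le_trans ?_ (one_le_involutionWeight z)
        split_ifs <;> omega
      omega
    · have h0 : ∑ z with Quotient.mk s z = Quotient.mk s x, (if z ∈ B then 1 else 0) = 0 := by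
        refine Finset.sum_eq_zero fun z hz => if_neg fun hzB => hx ⟨z, hzB, ?_⟩
        exact s.symm (Quotient.exact (Finset.mem_filter.1 hz).2)
      have h1 := Finset.sum_le_sum_of_subset (f := involutionWeight) (hpair x (s.refl x))
      have h2 := two_le_sum_involutionWeight x
      rw [h0]
      omega
  have hsum := Finset.sum_le_sum fun q (_ : q ∈ Finset.univ) => hfib q
  rw [Finset.sum_add_distrib, ← Finset.mul_sum, Finset.sum_fiberwise, Finset.sum_fiberwise,
    sum_involutionWeight, Finset.sum_boole] at hsum
  simpa [Set.ncard_eq_toFinset_card', mul_comm] using hsum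

end InvariantSets

section PointStabilizer

variable {R : Type*} [Group R]

theorem abelian_or_dicyclic_of_stabilizer [Finite R] (G : Subgroup (Equiv.Perm R))
    (hreg : Set.range (fun r : R => Equiv.mulRight r) ⊂ (G : Set (Equiv.Perm R)))
    (hcard : 24 * {x : R | ∀ h ∈ G, h 1 = 1 → h x = x ∨ h x = x⁻¹}ᶜ.ncard < Nat.card R) :
    ((∀ x y : R, x * y = y * x) ∧ 2 < Monoid.exponent R) ∨ IsGeneralizedDicyclic R := by
  have htr : ∀ r : R, Equiv.mulRight r ∈ G := fun r => hreg.1 ⟨r, rfl⟩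
  have hconj : ∀ h ∈ G, ∀ r : R, ∃ k ∈ G, ∀ x, k x = h (x * r) * (h r)⁻¹ := fun h hh r =>
    ⟨Equiv.mulRight (h r)⁻¹ * h * Equiv.mulRight r,
      G.mul_mem (G.mul_mem (htr _) hh) (htr r), fun x => by simp⟩
  let N : Subgroup R :=
    { carrier := {x | ∀ h ∈ G, h 1 = 1 → h x = x}
      mul_mem' := by
        intro a b ha hb h hh h1
        obtain ⟨k, hk, hkx⟩ := hconj h hh b
        have h2 := hkx a
        rw [ha k hk (by simp [hkx]), hb h hh h1, eq_mul_inv_iff_mul_eq] at h2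
        exact h2.symm
      one_mem' := fun h _ h1 => h1
      inv_mem' := by
        intro a ha h hh h1
        obtain ⟨k, hk, hkx⟩ := hconj h hh a⁻¹
        have h2 := hkx a
        rw [ha k hk (by simp [hkx]), mul_inv_cancel, h1, one_mul] at h2
        exact (inv_eq_iff_eq_inv.2 h2).symm }
  have hN : ∀ x, x ∈ N ↔ ∀ h ∈ G, h 1 = 1 → h x = x := fun _ => Iff.rfl
  have hNtop : N ≠ ⊤ := by
    intro htop
    obtain ⟨g, hg, hgr⟩ := Set.exists_of_ssubset hreg
    refine hgr ⟨g 1, Equiv.ext fun x => ?_⟩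
    obtain ⟨k, hk, hkx⟩ := hconj g hg 1
    have h1 := (hN x).1 (htop ▸ Subgroup.mem_top x) k hk (by simp [hkx])
    rw [hkx, mul_one, mul_inv_eq_iff_eq_mul] at h1
    exact h1.symm
  have hmoved : ∀ x ∈ {x : R | ∀ h ∈ G, h 1 = 1 → h x = x ∨ h x = x⁻¹}, x ∉ N →
      ∃ h ∈ G, h 1 = 1 ∧ h x = x⁻¹ ∧ x ≠ x⁻¹ := by
    intro x hxD hxN
    rw [hN] at hxN
    push Not at hxN
    obtain ⟨h, hh, h1, hx⟩ := hxN
    have hx' := (hxD h hh h1).resolve_left hx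
    exact ⟨h, hh, h1, hx', fun h => hx (hx'.trans h.symm)⟩
  refine abelian_or_dicyclic_of_dense (N := N) hcard ?_ hNtop ?_ ?_ ?_
  · intro x hxD h hh h1
    obtain ⟨k, hk, hkx⟩ := hconj h hh x⁻¹
    have h2 := hkx x
    rw [mul_inv_cancel, h1, one_mul] at h2
    rcases hxD k hk (by simp [hkx]) with h3 | h3
    · left; rw [← inv_inv (h x⁻¹), ← h2, h3]
    · right; rw [← inv_inv (h x⁻¹), ← h2, h3]
  · intro x hxD hxN h2
    obtain ⟨h, -, -, -, hne⟩ := hmoved x hxD hxN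
    exact hne (mul_eq_one_iff_eq_inv.1 (by rwa [← sq]))
  · intro x _ hxN y hyD hyN hyxD
    obtain ⟨k, hk, hk1, hky, hne⟩ := hmoved y hyD hyN
    obtain ⟨h, hh, hhx⟩ := hconj k hk x⁻¹
    have hx' : k x⁻¹ = x⁻¹ := (hN _).1 (N.inv_mem hxN) k hk hk1
    have h2 := hhx (y * x)
    rw [mul_inv_cancel_right, hky, hx', inv_inv] at h2
    rcases hyxD h hh (by simp [hhx]) with h3 | h3
    · exact absurd (mul_right_cancel (h3.symm.trans h2)) hne
    · rw [h2, mul_inv_rev, eq_inv_mul_iff_mul_eq, ← mul_assoc] at h3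
      rw [eq_inv_iff_mul_eq_one, mul_assoc, mul_assoc, ← mul_assoc x, h3, mul_inv_cancel]
  · intro x hxD hxN y hyD hyxD
    obtain ⟨h, hh, hh1, hhx, hne⟩ := hmoved x hxD hxN
    obtain ⟨k, hk, hkx⟩ := hconj h hh x
    have h2 := hkx y
    rw [hhx, inv_inv] at h2
    rcases hyxD h hh hh1 with h3 | h3 <;> rcases hyD k hk (by simp [hkx]) with h4 | h4 <;>
      rw [h3, h4] at h2
    · rw [mul_assoc, left_eq_mul] at h2
      exact absurd (mul_eq_one_iff_eq_inv.1 h2) hne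
    · right; right
      rw [eq_inv_iff_mul_eq_one, sq, sq, mul_assoc, ← mul_assoc y x x, ← h2, mul_inv_cancel]
    · right; left
      rw [mul_inv_rev, mul_assoc, eq_inv_mul_iff_mul_eq, ← mul_inv_eq_iff_eq_mul] at h2
      exact h2
    · left
      rw [mul_inv_rev, mul_assoc, eq_inv_mul_iff_mul_eq, eq_inv_mul_iff_mul_eq, ← mul_assoc,
        mul_inv_eq_iff_eq_mul] at h2
      exact h2.symm

end PointStabilizer

theorem stmt_4 {R : Type*} [Group R] [Finite R] (G : Subgroup (Equiv.Perm R))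
    (hreg : Set.range (fun r : R => Equiv.mulRight r) ⊂ (G : Set (Equiv.Perm R)))
    (htrans : MulAction.IsPretransitive G R) :
    ({S : Set R | S⁻¹ = S ∧
        ∀ g ∈ G, ∀ r t : R, t * r⁻¹ ∈ S ↔ g t * (g r)⁻¹ ∈ S}.ncard : ℝ)
      ≤ 2 ^ (((Nat.card R : ℝ) + ({x : R | x ^ 2 = 1}.ncard : ℝ)) / 2
          - (Nat.card R : ℝ) / 96) ∨
    ((∀ x y : R, x * y = y * x) ∧ 2 < Monoid.exponent R) ∨
    IsGeneralizedDicyclic R := by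
  set D : Set R := {x : R | ∀ h ∈ G, h 1 = 1 → h x = x ∨ h x = x⁻¹} with hD
  by_cases hcard : 24 * Dᶜ.ncard < Nat.card R
  · exact Or.inr (abelian_or_dicyclic_of_stabilizer G hreg hcard)
  left
  set F : Set (Set R) := {S : Set R | S⁻¹ = S ∧
    ∀ g ∈ G, ∀ r t : R, t * r⁻¹ ∈ S ↔ g t * (g r)⁻¹ ∈ S} with hF
  let s : Setoid R :=
    { r := fun x y => ∀ S ∈ F, x ∈ S ↔ y ∈ S
      iseqv := ⟨fun _ _ _ => Iff.rfl, fun h S hS => (h S hS).symm,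
        fun h h' S hS => (h S hS).trans (h' S hS)⟩ }
  have h1 : F.ncard ≤ 2 ^ Nat.card (Quotient s) :=
    ncard_le_two_pow_quotient F s fun S hS x y hxy => hxy S hS
  have h2 := four_mul_card_quotient_add_le s
    (fun x S hS => by rw [← Set.mem_inv, hS.1]) Dᶜ (fun x hx => by
      simp only [hD, Set.mem_compl_iff, Set.mem_ofPred_eq, not_forall, not_or] at hx
      obtain ⟨h, hh, hh1, hx1, hx2⟩ := hx
      refine ⟨h x, fun S hS => ?_, hx1, hx2⟩
      simpa [hh1] using hS.2 h hh 1 x)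
  calc (F.ncard : ℝ) ≤ 2 ^ ((Nat.card (Quotient s) : ℕ) : ℝ) := by
        rw [Real.rpow_natCast]; exact_mod_cast h1
    _ ≤ _ := by
        refine Real.rpow_le_rpow_of_exponent_le one_le_two ?_
        have h3 : (4 * Nat.card (Quotient s) + Dᶜ.ncard : ℝ) ≤
            2 * (Nat.card R + {x : R | x ^ 2 = 1}.ncard) := by exact_mod_cast h2
        have h4 : (Nat.card R : ℝ) ≤ 24 * Dᶜ.ncard := by exact_mod_cast not_lt.1 hcard
        linarith
end

section
/- Let G be a finite group acting transitively and faithfully on a finite set Ω and let α ∈ Ω. If |Ω|/2 < |Ω_{α,1}| + |Ω_{α,2}| < |Ω|, then for every β ∈ Ω_{α,4} the set Ω_{α,2} ∩ Ω_{β,2} is nonempty. -/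
open MulAction

section Suborbits

variable {G Ω : Type*} [Group G] [MulAction G Ω]

theorem card_suborbit_eq_relIndex (α δ : Ω) :
    Nat.card (orbit (stabilizer G α) δ) =
      (stabilizer G δ).relIndex (stabilizer G α) := by
  have h : stabilizer (stabilizer G α) δ = (stabilizer G δ).subgroupOf (stabilizer G α) := by
    ext g
    simp [Subgroup.mem_subgroupOf, Subgroup.smul_def]
  rw [Subgroup.relIndex, ← h, index_stabilizer, Set.ncard]
  rfl

theorem card_suborbit_mul_card [IsPretransitive G Ω] (α δ : Ω) :
    Nat.card (orbit (stabilizer G α) δ) * Nat.card Ω =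
      (stabilizer G δ ⊓ stabilizer G α).index := by
  rw [card_suborbit_eq_relIndex, ← index_stabilizer_of_transitive G α,
    ← Subgroup.inf_relIndex_right, Subgroup.relIndex_mul_index inf_le_right]

theorem card_suborbit_comm [IsPretransitive G Ω] [Finite Ω] (α δ : Ω) :
    Nat.card (orbit (stabilizer G α) δ) = Nat.card (orbit (stabilizer G δ) α) := by
  have : Nonempty Ω := ⟨α⟩
  apply Nat.eq_of_mul_eq_mul_right (Nat.card_pos (α := Ω))
  rw [card_suborbit_mul_card, card_suborbit_mul_card, inf_comm]

theorem card_suborbit_smul_smul [IsPretransitive G Ω] [Finite Ω] (g : G) (α δ : Ω) :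
    Nat.card (orbit (stabilizer G (g • α)) (g • δ)) =
      Nat.card (orbit (stabilizer G α) δ) := by
  have : Nonempty Ω := ⟨α⟩
  have hpair (x y : Ω) : stabilizer G x ⊓ stabilizer G y = stabilizer G (x, y) := by
    ext h
    simp
  apply Nat.eq_of_mul_eq_mul_right (Nat.card_pos (α := Ω))
  rw [card_suborbit_mul_card, card_suborbit_mul_card, hpair, hpair, index_stabilizer,
    index_stabilizer, ← Prod.smul_mk, orbit_smul]

theorem stabilizer_eq_of_card_suborbit_eq_one [IsPretransitive G Ω] [Finite Ω] {α δ : Ω}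
    (h : Nat.card (orbit (stabilizer G α) δ) = 1) : stabilizer G α = stabilizer G δ := by
  have h' := card_suborbit_comm (G := G) α δ ▸ h
  rw [card_suborbit_eq_relIndex, Subgroup.relIndex_eq_one] at h h'
  exact le_antisymm h h'

theorem ncard_suborbits_eq [IsPretransitive G Ω] [Finite Ω] (α β : Ω) (i : ℕ) :
    {δ : Ω | Nat.card (orbit (stabilizer G α) δ) = i}.ncard =
      {δ : Ω | Nat.card (orbit (stabilizer G β) δ) = i}.ncard := by
  obtain ⟨g, rfl⟩ := exists_smul_eq G α β
  rw [← Set.ncard_image_of_injective _ (MulAction.injective g)]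
  congr 1
  ext δ
  constructor
  · rintro ⟨ε, hε, rfl⟩
    exact (card_suborbit_smul_smul g α ε).trans hε
  · intro hδ
    refine ⟨g⁻¹ • δ, ?_, smul_inv_smul g δ⟩
    rw [Set.mem_ofPred_eq, ← card_suborbit_smul_smul g, smul_inv_smul]
    exact hδ

end Suborbits

theorem stmt_6 {G Ω : Type*} [Group G] [Finite G] [Finite Ω] [MulAction G Ω]
    [IsPretransitive G Ω] [FaithfulSMul G Ω] (α : Ω)
    (h1 : (Nat.card Ω : ℚ) / 2 <
      ({δ : Ω | Nat.card (orbit (stabilizer G α) δ) = 1}.ncard : ℚ)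
      + ({δ : Ω | Nat.card (orbit (stabilizer G α) δ) = 2}.ncard : ℚ))
    (h2 : ({δ : Ω | Nat.card (orbit (stabilizer G α) δ) = 1}.ncard : ℚ)
      + ({δ : Ω | Nat.card (orbit (stabilizer G α) δ) = 2}.ncard : ℚ)
      < (Nat.card Ω : ℚ)) :
    ∀ β ∈ {δ : Ω | Nat.card (orbit (stabilizer G α) δ) = 4},
      ({δ : Ω | Nat.card (orbit (stabilizer G α) δ) = 2} ∩
        {δ : Ω | Nat.card (orbit (stabilizer G β) δ) = 2}).Nonempty := by
  intro β hβ
  rw [Set.mem_ofPred_eq] at hβ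
  set A : Ω → ℕ → Set Ω := fun x i => {δ : Ω | Nat.card (orbit (stabilizer G x) δ) = i} with hA
  have hunion (x : Ω) : (A x 1 ∪ A x 2).ncard = (A x 1).ncard + (A x 2).ncard := by
    refine Set.ncard_union_eq ?_
    rw [Set.disjoint_left]
    intro δ hδ hδ'
    simp only [hA, Set.mem_ofPred_eq] at hδ hδ'
    omega
  have hα : Nat.card Ω < 2 * (A α 1 ∪ A α 2).ncard := by
    rw [hunion]
    have h : (Nat.card Ω : ℚ) < 2 * ((A α 1).ncard + (A α 2).ncard) := by linarith
    exact_mod_cast h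
  have hcard : (A β 1 ∪ A β 2).ncard = (A α 1 ∪ A α 2).ncard := by
    rw [hunion, hunion, ncard_suborbits_eq (G := G) β α 1, ncard_suborbits_eq (G := G) β α 2]
  obtain ⟨δ, hδα, hδβ⟩ : ((A α 1 ∪ A α 2) ∩ (A β 1 ∪ A β 2)).Nonempty := by
    rw [Set.nonempty_iff_ne_empty, ne_eq, ← Set.disjoint_iff_inter_eq_empty]
    intro hdisj
    have hle := Set.ncard_le_card ((A α 1 ∪ A α 2) ∪ (A β 1 ∪ A β 2))
    rw [Set.ncard_union_eq hdisj] at hle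
    omega
  simp only [hA, Set.mem_union, Set.mem_ofPred_eq] at hδα hδβ
  have hne_α : Nat.card (orbit (stabilizer G α) δ) ≠ 1 := by
    intro h
    rw [stabilizer_eq_of_card_suborbit_eq_one h, card_suborbit_comm] at hβ
    omega
  have hne_β : Nat.card (orbit (stabilizer G β) δ) ≠ 1 := by
    intro h
    rw [card_suborbit_comm, stabilizer_eq_of_card_suborbit_eq_one h, card_suborbit_comm] at hβ
    omega
  exact ⟨δ, hδα.resolve_left hne_α, hδβ.resolve_left hne_β⟩
end

section
/- Let Γ be a finite vertex-transitive graph of valency 2 with vertex set V, let ω₁ and ω₂ be two adjacent vertices of Γ, and let W ⊆ V be a subset containing ω₁ and ω₂ such that for any two distinct vertices δ₁, δ₂ ∈ W one has V \ (Γ(δ₁) ∪ Γ(δ₂)) ⊆ W, where Γ(δ) denotes the neighbourhood of δ in Γ. Then either W = V or |V| ≤ 6. -/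
theorem stmt_10 {V : Type*} [Fintype V] (Γ : SimpleGraph V)
    (htrans : ∀ v w : V, ∃ φ : Γ ≃g Γ, φ v = w)
    (hval : ∀ v : V, (Γ.neighborSet v).ncard = 2)
    (ω₁ ω₂ : V) (hadj : Γ.Adj ω₁ ω₂)
    (W : Set V) (hω₁ : ω₁ ∈ W) (hω₂ : ω₂ ∈ W)
    (hW : ∀ δ₁ ∈ W, ∀ δ₂ ∈ W, δ₁ ≠ δ₂ →
      ∀ v : V, v ∉ Γ.neighborSet δ₁ ∪ Γ.neighborSet δ₂ → v ∈ W) :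
    W = Set.univ ∨ Fintype.card V ≤ 6 := by
  refine or_iff_not_imp_left.2 fun hne => ?_
  obtain ⟨v, hv⟩ := (Set.ne_univ_iff_exists_notMem W).1 hne
  have hsub : (W \ Γ.neighborSet v).ncard ≤ 1 := by
    refine (Set.ncard_le_one (Set.toFinite _)).2 fun a ha b hb => ?_
    by_contra hab
    refine hv (hW a ha.1 b hb.1 hab v ?_)
    rintro (h | h)
    · exact ha.2 (SimpleGraph.Adj.symm h)
    · exact hb.2 (SimpleGraph.Adj.symm h)
  have h₁ : (Γ.neighborSet ω₁ \ {ω₂}).ncard = 1 := by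
    rw [Set.ncard_sdiff_singleton_of_mem (show ω₂ ∈ Γ.neighborSet ω₁ from hadj), hval]
  have h₂ : (Γ.neighborSet ω₂ \ {ω₁}).ncard = 1 := by
    rw [Set.ncard_sdiff_singleton_of_mem (show ω₁ ∈ Γ.neighborSet ω₂ from hadj.symm), hval]
  have hcover : (Set.univ : Set V) ⊆ ((W \ Γ.neighborSet v) ∪ Γ.neighborSet v) ∪
      ((Γ.neighborSet ω₁ \ {ω₂}) ∪ (Γ.neighborSet ω₂ \ {ω₁})) := by
    intro x _
    by_cases hx : x ∈ W
    · left
      by_cases hxv : x ∈ Γ.neighborSet v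
      · exact Or.inr hxv
      · exact Or.inl ⟨hx, hxv⟩
    · right
      have hmem : x ∈ Γ.neighborSet ω₁ ∪ Γ.neighborSet ω₂ := by
        by_contra h
        exact hx (hW ω₁ hω₁ ω₂ hω₂ hadj.ne x h)
      rcases hmem with h | h
      · exact Or.inl ⟨h, fun e => hx (e ▸ hω₂)⟩
      · exact Or.inr ⟨h, fun e => hx (e ▸ hω₁)⟩
  have hcard := Set.ncard_le_ncard hcover (Set.toFinite _)
  rw [Set.ncard_univ, Nat.card_eq_fintype_card] at hcard
  have := Set.ncard_union_le ((W \ Γ.neighborSet v) ∪ Γ.neighborSet v)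
    ((Γ.neighborSet ω₁ \ {ω₂}) ∪ (Γ.neighborSet ω₂ \ {ω₁}))
  have := Set.ncard_union_le (W \ Γ.neighborSet v) (Γ.neighborSet v)
  have := Set.ncard_union_le (Γ.neighborSet ω₁ \ {ω₂}) (Γ.neighborSet ω₂ \ {ω₁})
  have := hval v
  omega
end

section
/- Let G be a finite group acting transitively and faithfully on a finite set Ω and let α ∈ Ω. If |Ω|/2 < |Ω_{α,1}| + |Ω_{α,2}| < |Ω|, then either (a) |Ω_{α,1}| + |Ω_{α,2}| < (5/6)·|Ω|, or (b) all of the following hold: (i) |Ω_{α,4}| ≤ 2·|Ω_{α,1}|; (ii) G_α is an elementary abelian 2-group; (iii) for every β ∈ Ω_{α,4}, G_α and G_β commute elementwise; and (iv) for every β ∈ Ω_{α,4}, G_α ∩ G_β = 1 and the subgroup generated by G_α and G_β is an elementary abelian normal 2-subgroup of G of order 16 equal to the internal direct product G_α × G_β. -/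
open MulAction

section Subgroups

variable {G : Type*} [Group G] [Finite G]

/-- The second subgroup meets the first one in a subgroup of index at most two. -/
def Near (H K : Subgroup G) : Prop := Nat.card H ≤ 2 * Nat.card (H ⊓ K : Subgroup G)

/-- The subgroups of `H` containing `K` as a subgroup of index two. -/
noncomputable def doublesBetween (K H : Subgroup G) : Finset (Subgroup G) :=
  (Set.toFinite {M : Subgroup G | K ≤ M ∧ M ≤ H ∧ Nat.card M = 2 * Nat.card K}).toFinset

theorem mem_doublesBetween {K H M : Subgroup G} :
    M ∈ doublesBetween K H ↔ K ≤ M ∧ M ≤ H ∧ Nat.card M = 2 * Nat.card K := by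
  simp [doublesBetween]

theorem sup_eq_of_card_eq_two_mul {A C J : Subgroup G} (hA : A ≤ J) (hC : C ≤ J)
    (hAJ : Nat.card J = 2 * Nat.card A) (hCA : Nat.card C = Nat.card A) (hne : A ≠ C) :
    A ⊔ C = J := by
  have h1 : Nat.card A < Nat.card (A ⊔ C : Subgroup G) := by
    by_contra! h
    have h2 : A = A ⊔ C := Subgroup.eq_of_le_of_card_ge le_sup_left h
    have h3 : C ≤ A := h2 ▸ le_sup_right
    exact hne (Subgroup.eq_of_le_of_card_ge h3 hCA.ge).symm
  obtain ⟨k, hk⟩ := Subgroup.card_dvd_of_le (le_sup_left : A ≤ A ⊔ C)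
  refine Subgroup.eq_of_le_of_card_ge (sup_le hA hC) ?_
  have : 2 ≤ k := by
    by_contra! h
    interval_cases k <;> omega
  rw [hAJ, hk, mul_comm]
  exact Nat.mul_le_mul_left _ this

theorem inf_eq_of_mem_doublesBetween {K H M M' : Subgroup G} (hM : M ∈ doublesBetween K H)
    (hM' : M' ∈ doublesBetween K H) (hne : M ≠ M') : M ⊓ M' = K := by
  rw [mem_doublesBetween] at hM hM'
  have hK : K ≤ M ⊓ M' := le_inf hM.1 hM'.1
  by_contra h
  have h1 : Nat.card K < Nat.card (M ⊓ M' : Subgroup G) := by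
    by_contra! h2
    exact h (Subgroup.eq_of_le_of_card_ge hK h2).symm
  have h0 : 0 < Nat.card (M ⊓ M' : Subgroup G) := Nat.card_pos
  obtain ⟨k, hk⟩ := Subgroup.card_dvd_of_le (inf_le_left : M ⊓ M' ≤ M)
  have hk1 : k = 1 := by
    have : k < 2 := by
      by_contra! h2
      have := Nat.mul_le_mul_left (Nat.card (M ⊓ M' : Subgroup G)) h2
      omega
    interval_cases k
    · have : 0 < Nat.card M := Nat.card_pos
      omega
    · rfl
  rw [hk1, mul_one] at hk
  have h3 : M ⊓ M' = M := Subgroup.eq_of_le_of_card_ge inf_le_left hk.le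
  exact hne (Subgroup.eq_of_le_of_card_ge (inf_eq_left.1 h3) (by omega))

open Finset in
open Classical in
theorem card_doublesBetween_le {K H : Subgroup G} (hKH : K ≤ H)
    (hH : Nat.card H = 4 * Nat.card K) : #(doublesBetween K H) ≤ 3 := by
  have := Fintype.ofFinite G
  have hcard (M : Subgroup G) (hM : K ≤ M) :
      #({x | x ∈ M ∧ x ∉ K} : Finset G) + Nat.card K = Nat.card M := by
    rw [Nat.card_eq_fintype_card, Nat.card_eq_fintype_card, Fintype.card_subtype,
      Fintype.card_subtype, ← card_filter_add_card_filter_not (s := {x | x ∈ M}) (· ∈ K),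
      filter_filter, filter_filter, add_comm]
    congr 2
    ext x
    simpa using @hM x
  have hdisj : (doublesBetween K H : Set (Subgroup G)).PairwiseDisjoint
      fun M => ({x | x ∈ M ∧ x ∉ K} : Finset G) := by
    intro M hM M' hM' hne
    have hinf := inf_eq_of_mem_doublesBetween hM hM' hne
    refine Finset.disjoint_left.2 fun x hx hx' => ?_
    simp only [mem_filter, mem_univ, true_and] at hx hx'
    exact hx.2 (hinf ▸ Subgroup.mem_inf.2 ⟨hx.1, hx'.1⟩)
  have hunion := card_biUnion hdisj
  have hconst : ∀ M ∈ doublesBetween K H, #({x | x ∈ M ∧ x ∉ K} : Finset G) = Nat.card K := by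
    intro M hM
    rw [mem_doublesBetween] at hM
    have := hcard M hM.1
    omega
  rw [sum_congr rfl hconst, sum_const, smul_eq_mul] at hunion
  have hle : #((doublesBetween K H).biUnion fun M => ({x | x ∈ M ∧ x ∉ K} : Finset G)) ≤
      #({x | x ∈ H ∧ x ∉ K} : Finset G) := by
    refine card_le_card (biUnion_subset.2 fun M hM x hx => ?_)
    rw [mem_doublesBetween] at hM
    simp only [mem_filter, mem_univ, true_and] at hx ⊢
    exact ⟨hM.2.1 hx.1, hx.2⟩
  have h3 := hcard H hKH
  have : 0 < Nat.card K := Nat.card_pos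
  by_contra! h
  have := Nat.mul_le_mul_right (Nat.card K) h
  omega

omit [Finite G] in
theorem Near.symm {H K : Subgroup G} (hHK : Nat.card H = Nat.card K) (h : Near H K) :
    Near K H := by
  rwa [Near, inf_comm, ← hHK]

omit [Finite G] in
theorem card_inf_mul_relIndex (H K : Subgroup G) :
    Nat.card (H ⊓ K : Subgroup G) * K.relIndex H = Nat.card H := by
  have h := Subgroup.relIndex_mul_relIndex ⊥ (H ⊓ K) H bot_le inf_le_left
  rwa [Subgroup.relIndex_bot_left, Subgroup.relIndex_bot_left, Subgroup.inf_relIndex_left] at h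

/-- A common neighbour `J` of two subgroups that are not near contains their intersection. -/
theorem of_near_of_near_of_not_near {H J K : Subgroup G} (hJ : Nat.card J = Nat.card H)
    (hHJ : Near H J) (hJK : Near J K) (hHK : ¬ Near H K) :
    Nat.card H = 4 * Nat.card (H ⊓ K : Subgroup G) ∧ H ⊓ K ≤ J ∧
      Nat.card H = 2 * Nat.card (H ⊓ J : Subgroup G) ∧
      Nat.card H = 2 * Nat.card (K ⊓ J : Subgroup G) := by
  have hrel {A B : Subgroup G} (h : Near A B) : B.relIndex A ≤ 2 := by
    have h1 := card_inf_mul_relIndex A B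
    have h2 : 0 < Nat.card (A ⊓ B : Subgroup G) := Nat.card_pos
    rw [Near] at h
    by_contra! h3
    have := Nat.mul_le_mul_left (Nat.card (A ⊓ B : Subgroup G)) h3
    omega
  have hp := hrel hHJ
  have hJK' := hrel hJK
  have hq : K.relIndex (H ⊓ J) ≤ K.relIndex J :=
    Subgroup.relIndex_le_of_le_right inf_le_right Subgroup.index_ne_zero_of_finite
  have hq2 : K.relIndex (H ⊓ J) ≤ 2 := hq.trans hJK'
  have e1 := card_inf_mul_relIndex H J
  have e2 := card_inf_mul_relIndex (H ⊓ J) K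
  have e3 := card_inf_mul_relIndex J K
  have hle : H ⊓ J ⊓ K ≤ H ⊓ K := inf_le_inf_right _ inf_le_left
  have h0 : 0 < Nat.card H := Nat.card_pos
  rw [Near] at hHK
  have hge := Subgroup.card_le_of_le hle
  obtain ⟨k, hk⟩ := Subgroup.card_dvd_of_le hle
  rw [inf_comm K J]
  have hp2 : J.relIndex H = 2 ∧ K.relIndex (H ⊓ J) = 2 := by
    obtain h | h | h : J.relIndex H = 0 ∨ J.relIndex H = 1 ∨ J.relIndex H = 2 := by omega
    all_goals
      obtain h' | h' | h' : K.relIndex (H ⊓ J) = 0 ∨ K.relIndex (H ⊓ J) = 1 ∨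
        K.relIndex (H ⊓ J) = 2 := by omega
      all_goals
        rw [h] at e1
        rw [h'] at e2
        omega
  have hr : K.relIndex J = 2 := by omega
  rw [hp2.1] at e1
  rw [hp2.2] at e2
  rw [hr] at e3
  have hk1 : k = 1 := by
    have : k < 2 := by
      by_contra! h
      have := Nat.mul_le_mul_left (Nat.card (H ⊓ J ⊓ K : Subgroup G)) h
      omega
    interval_cases k
    · have : 0 < Nat.card (H ⊓ K : Subgroup G) := Nat.card_pos
      omega
    · rfl
  rw [hk1, mul_one] at hk
  have heq : H ⊓ J ⊓ K = H ⊓ K := Subgroup.eq_of_le_of_card_ge hle hk.le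
  refine ⟨by omega, ?_, by omega, by omega⟩
  rw [← heq]
  exact inf_le_left.trans inf_le_right

theorem inf_sup_inf_eq_of_near {H J K : Subgroup G} (hJ : Nat.card J = Nat.card H)
    (hHJ : Near H J) (hJK : Near J K) (hHK : ¬ Near H K) : (H ⊓ J) ⊔ (K ⊓ J) = J := by
  obtain ⟨h1, h2, h3, h4⟩ := of_near_of_near_of_not_near hJ hHJ hJK hHK
  refine sup_eq_of_card_eq_two_mul inf_le_right inf_le_right (by omega) (by omega) fun h => ?_
  have h5 : H ⊓ J ≤ H ⊓ K := le_inf inf_le_left (h.trans_le inf_le_left)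
  have := Subgroup.card_le_of_le h5
  have : 0 < Nat.card H := Nat.card_pos
  omega

theorem inf_mem_doublesBetween_of_near {H J K : Subgroup G} (hJ : Nat.card J = Nat.card H)
    (hHJ : Near H J) (hJK : Near J K) (hHK : ¬ Near H K) :
    H ⊓ J ∈ doublesBetween (H ⊓ K) H := by
  obtain ⟨h1, h2, h3, h4⟩ := of_near_of_near_of_not_near hJ hHJ hJK hHK
  exact mem_doublesBetween.2 ⟨le_inf inf_le_left h2, inf_le_left, by omega⟩

omit [Finite G] in
theorem card_sup_of_commute {H K : Subgroup G} (hc : ∀ x ∈ H, ∀ y ∈ K, x * y = y * x)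
    (hd : H ⊓ K = ⊥) : Nat.card (H ⊔ K : Subgroup G) = Nat.card H * Nat.card K := by
  have hc' : ∀ (x : H) (y : K), Commute (H.subtype x) (K.subtype y) :=
    fun x y => hc x x.2 y y.2
  have hinj : Function.Injective (H.subtype.noncommCoprod K.subtype hc') := by
    rw [MonoidHom.noncommCoprod_injective]
    simpa [disjoint_iff] using hd
  have hr := MonoidHom.noncommCoprod_range (f := H.subtype) (g := K.subtype) (comm := hc')
  rw [Subgroup.range_subtype, Subgroup.range_subtype] at hr
  rw [← hr, ← Nat.card_prod]
  exact (Nat.card_congr (MonoidHom.ofInjective hinj).toEquiv).symm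

omit [Finite G] in
theorem sq_eq_one_of_mem_sup {H K : Subgroup G} (hc : ∀ x ∈ H, ∀ y ∈ K, x * y = y * x)
    (hH : ∀ x ∈ H, x ^ 2 = 1) (hK : ∀ x ∈ K, x ^ 2 = 1) : ∀ x ∈ H ⊔ K, x ^ 2 = 1 := by
  have hc' : ∀ (x : H) (y : K), Commute (H.subtype x) (K.subtype y) :=
    fun x y => hc x x.2 y y.2
  have hr := MonoidHom.noncommCoprod_range (f := H.subtype) (g := K.subtype) (comm := hc')
  rw [Subgroup.range_subtype, Subgroup.range_subtype] at hr
  intro x hx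
  rw [← hr] at hx
  obtain ⟨⟨a, b⟩, rfl⟩ := hx
  have : Commute (a : G) b := hc' a b
  simp [this.mul_pow, hH a a.2, hK b b.2]

end Subgroups

section Families

variable {G Ω : Type*} [Group G] [Finite G] [Fintype Ω]

open Finset
open Classical in
/-- A conjugation-invariant family of subgroups in which every member is near at least five sixths,
but not all, of the members. -/
structure IsMostlyNear (S : Ω → Subgroup G) (o f : ℕ) : Prop where
  card_eq : ∀ x y, Nat.card (S x) = Nat.card (S y)
  card_fiber : ∀ x, #{y | S y = S x} = o
  card_far : ∀ x, #{y | ¬ Near (S x) (S y)} = f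
  six_mul_le : 6 * f ≤ Fintype.card Ω
  pos : 0 < f
  exists_eq_map : ∀ (g : G) (x : Ω), ∃ y, S y = (S x).map (MulAut.conj g).toMonoidHom
  eq_map : ∀ x y, ∃ g : G, S y = (S x).map (MulAut.conj g).toMonoidHom

open Classical in
/-- The indices whose subgroups are near both the subgroup at `x` and the one at `y`. -/
noncomputable def commonNear (S : Ω → Subgroup G) (x y : Ω) : Finset Ω :=
  {z | Near (S x) (S z) ∧ Near (S y) (S z)}

omit [Finite G] in
theorem mem_commonNear {S : Ω → Subgroup G} {x y z : Ω} :
    z ∈ commonNear S x y ↔ Near (S x) (S z) ∧ Near (S y) (S z) := by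
  simp [commonNear]

theorem ncard_setOf_eq_card_filter (p : Ω → Prop) [DecidablePred p] :
    {x | p x}.ncard = #{x | p x} := by
  rw [Set.ncard_eq_toFinset_card', Set.toFinset_ofPred]

namespace IsMostlyNear

variable {S : Ω → Subgroup G} {o f : ℕ} {α β γ δ : Ω}

section

variable (h : IsMostlyNear S o f)

include h

omit [Finite G] in
theorem near_symm {x y : Ω} (hxy : Near (S x) (S y)) : Near (S y) (S x) :=
  hxy.symm (h.card_eq x y)

omit [Finite G] in
theorem card_le_mul_card {τ : Type*} (Y : Finset Ω) (φ : Ω → τ) (t : Finset τ)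
    (hmaps : ∀ y ∈ Y, φ y ∈ t) (hφ : ∀ x ∈ Y, ∀ y ∈ Y, φ x = φ y → S x = S y) :
    #Y ≤ o * #t := by
  classical
  refine card_le_mul_card_image_of_maps_to hmaps o fun b _ => ?_
  obtain h0 | ⟨x, hx⟩ := ({a ∈ Y | φ a = b} : Finset Ω).eq_empty_or_nonempty
  · simp [h0]
  · rw [← h.card_fiber x]
    refine card_le_card fun y hy => ?_
    simp only [mem_filter, mem_univ, true_and] at hx hy ⊢
    exact hφ y hy.1 x hx.1 (hy.2.trans hx.2.symm)

omit [Finite G] in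
theorem nonempty : Nonempty Ω := by
  have := h.six_mul_le
  have := h.pos
  exact Fintype.card_pos_iff.1 (by omega)

omit [Finite G] in
theorem fiber_pos : 0 < o := by
  classical
  obtain ⟨x⟩ := h.nonempty
  rw [← h.card_fiber x]
  exact card_pos.2 ⟨x, by simp⟩

omit [Finite G] in
theorem four_mul_le_card_commonNear (x y : Ω) : 4 * f ≤ #(commonNear S x y) := by
  classical
  have h1 : (univ : Finset Ω) ⊆ commonNear S x y ∪ ({z | ¬ Near (S x) (S z)} : Finset Ω) ∪
      ({z | ¬ Near (S y) (S z)} : Finset Ω) := by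
    intro z _
    simp only [mem_union, mem_commonNear, mem_filter, mem_univ, true_and]
    tauto
  have h2 := card_le_card h1
  have h3 := card_union_le (commonNear S x y ∪ ({z | ¬ Near (S x) (S z)} : Finset Ω))
    ({z | ¬ Near (S y) (S z)} : Finset Ω)
  have h4 := card_union_le (commonNear S x y) ({z | ¬ Near (S x) (S z)} : Finset Ω)
  rw [h.card_far] at h3 h4
  have := h.six_mul_le
  rw [card_univ] at h2
  omega

omit [Finite G] in
theorem three_mul_le_card_filter_commonNear (x y z : Ω) [DecidablePred (· ∈ commonNear S x z)] :
    3 * f ≤ #({w ∈ commonNear S x y | w ∈ commonNear S x z}) := by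
  classical
  have h1 : (univ : Finset Ω) ⊆ ({w ∈ commonNear S x y | w ∈ commonNear S x z} : Finset Ω) ∪
      ({w | ¬ Near (S x) (S w)} : Finset Ω) ∪ ({w | ¬ Near (S y) (S w)} : Finset Ω) ∪
      ({w | ¬ Near (S z) (S w)} : Finset Ω) := by
    intro w _
    simp only [mem_union, mem_commonNear, mem_filter, mem_univ, true_and]
    tauto
  have h2 := (card_le_card h1).trans <| (card_union_le _ _).trans <| add_le_add_left
    ((card_union_le _ _).trans <| add_le_add_left (card_union_le _ _) _) _
  rw [h.card_far, h.card_far, h.card_far, card_univ] at h2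
  have := h.six_mul_le
  omega

omit [Finite G] in
theorem two_mul_fiber_le (hγ : ¬ Near (S α) (S γ)) (hδ : ¬ Near (S α) (S δ)) (hne : S δ ≠ S γ) :
    2 * o ≤ f := by
  classical
  have hdisj : Disjoint ({y | S y = S γ} : Finset Ω) ({y | S y = S δ} : Finset Ω) := by
    refine Finset.disjoint_left.2 fun x hx hx' => ?_
    simp only [mem_filter, mem_univ, true_and] at hx hx'
    exact hne (hx'.symm.trans hx)
  rw [two_mul, ← h.card_far α]
  nth_rw 1 [← h.card_fiber γ]
  rw [← h.card_fiber δ, ← card_union_of_disjoint hdisj]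
  refine card_le_card fun x hx => ?_
  simp only [mem_union, mem_filter, mem_univ, true_and] at hx ⊢
  obtain hx | hx := hx <;> rw [hx] <;> assumption

omit [Finite G] in
theorem fiber_dvd : o ∣ f := by
  classical
  obtain ⟨x⟩ := h.nonempty
  rw [← h.card_far x, card_eq_sum_card_image S]
  refine dvd_sum fun M hM => ?_
  obtain ⟨y, hy, rfl⟩ := mem_image.1 hM
  rw [← h.card_fiber y]
  apply dvd_of_eq
  congr 1
  ext z
  simp only [mem_filter, mem_univ, true_and] at hy ⊢
  exact ⟨fun hz => ⟨hz ▸ hy, hz⟩, fun hz => hz.2⟩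

theorem of_mem_commonNear (hγ : ¬ Near (S α) (S γ)) (hβ : β ∈ commonNear S α γ) :
    Nat.card (S α) = 4 * Nat.card (S α ⊓ S γ : Subgroup G) ∧ S α ⊓ S γ ≤ S β ∧
      Nat.card (S α) = 2 * Nat.card (S α ⊓ S β : Subgroup G) ∧
      Nat.card (S α) = 2 * Nat.card (S γ ⊓ S β : Subgroup G) := by
  rw [mem_commonNear] at hβ
  exact of_near_of_near_of_not_near (h.card_eq _ _) hβ.1 (h.near_symm hβ.2) hγ

theorem inf_sup_inf_eq (hγ : ¬ Near (S α) (S γ)) (hβ : β ∈ commonNear S α γ) :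
    (S α ⊓ S β) ⊔ (S γ ⊓ S β) = S β := by
  rw [mem_commonNear] at hβ
  exact inf_sup_inf_eq_of_near (h.card_eq _ _) hβ.1 (h.near_symm hβ.2) hγ

theorem inf_mem_doublesBetween (hγ : ¬ Near (S α) (S γ)) (hβ : β ∈ commonNear S α γ) :
    S α ⊓ S β ∈ doublesBetween (S α ⊓ S γ) (S α) := by
  rw [mem_commonNear] at hβ
  exact inf_mem_doublesBetween_of_near (h.card_eq _ _) hβ.1 (h.near_symm hβ.2) hγ

theorem inf_mem_doublesBetween' (hγ : ¬ Near (S α) (S γ)) (hβ : β ∈ commonNear S α γ) :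
    S γ ⊓ S β ∈ doublesBetween (S α ⊓ S γ) (S γ) := by
  rw [inf_comm (S α)]
  exact h.inf_mem_doublesBetween (fun hn => hγ (h.near_symm hn))
    (mem_commonNear.2 (mem_commonNear.1 hβ).symm)

omit [Finite G] in
theorem exists_mem_commonNear (x y : Ω) : ∃ z, z ∈ commonNear S x y := by
  have h1 := h.four_mul_le_card_commonNear x y
  have h2 := h.pos
  exact card_pos.1 (by omega)

theorem card_eq_four_mul (hγ : ¬ Near (S α) (S γ)) :
    Nat.card (S α) = 4 * Nat.card (S α ⊓ S γ : Subgroup G) := by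
  obtain ⟨β, hβ⟩ := h.exists_mem_commonNear α γ
  exact (h.of_mem_commonNear hγ hβ).1

theorem card_doublesBetween_le (hγ : ¬ Near (S α) (S γ)) :
    #(doublesBetween (S α ⊓ S γ) (S α)) ≤ 3 :=
  _root_.card_doublesBetween_le inf_le_left (h.card_eq_four_mul hγ)

theorem card_doublesBetween_le' (hγ : ¬ Near (S α) (S γ)) :
    #(doublesBetween (S α ⊓ S γ) (S γ)) ≤ 3 :=
  _root_.card_doublesBetween_le inf_le_right (h.card_eq γ α ▸ h.card_eq_four_mul hγ)

theorem far_le_two_mul (hγ : ¬ Near (S α) (S γ)) : f ≤ 2 * o := by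
  classical
  have h1 := h.card_le_mul_card (commonNear S α γ)
    (fun β => (S α ⊓ S β, S γ ⊓ S β))
    (doublesBetween (S α ⊓ S γ) (S α) ×ˢ doublesBetween (S α ⊓ S γ) (S γ))
    (fun β hβ => mem_product.2 ⟨h.inf_mem_doublesBetween hγ hβ, h.inf_mem_doublesBetween' hγ hβ⟩)
    (fun β hβ β' hβ' heq => by
      rw [← h.inf_sup_inf_eq hγ hβ, ← h.inf_sup_inf_eq hγ hβ']
      rw [Prod.mk.injEq] at heq
      rw [heq.1, heq.2])
  rw [card_product] at h1
  have h2 := Nat.mul_le_mul (h.card_doublesBetween_le hγ) (h.card_doublesBetween_le' hγ)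
  have h3 := h1.trans (Nat.mul_le_mul_left o h2)
  have h4 := h.four_mul_le_card_commonNear α γ
  have h5 := h.fiber_pos
  obtain ⟨k, rfl⟩ := h.fiber_dvd
  have : k ≤ 2 := by
    by_contra! hk
    have := Nat.mul_le_mul_left o hk
    omega
  rw [mul_comm 2]
  exact Nat.mul_le_mul_left o this

theorem inf_le_of_far (hγ : ¬ Near (S α) (S γ)) (hδ : ¬ Near (S α) (S δ)) :
    S α ⊓ S γ ≤ S δ := by
  classical
  by_contra hle
  have hne : S δ ≠ S γ := fun heq => hle (heq ▸ inf_le_right)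
  have h2o := h.two_mul_fiber_le hγ hδ hne
  have hfour := h.card_eq_four_mul hγ
  have hfour' := h.card_eq_four_mul hδ
  have hsup {β : Ω} (hβ : β ∈ commonNear S α γ) (hβ' : β ∈ commonNear S α δ) :
      (S α ⊓ S γ) ⊔ (S α ⊓ S δ) = S α ⊓ S β := by
    obtain ⟨-, hle1, hc, -⟩ := h.of_mem_commonNear hγ hβ
    obtain ⟨-, hle2, -⟩ := h.of_mem_commonNear hδ hβ'
    exact sup_eq_of_card_eq_two_mul (le_inf inf_le_left hle1) (le_inf inf_le_left hle2)
      (by omega) (by omega) fun heq => hle (heq.trans_le inf_le_right)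
  have h1 := h.card_le_mul_card
    {w ∈ commonNear S α γ | w ∈ commonNear S α δ} (fun β => S γ ⊓ S β)
    (doublesBetween (S α ⊓ S γ) (S γ))
    (fun β hβ => h.inf_mem_doublesBetween' hγ (mem_filter.1 hβ).1)
    (fun β hβ β' hβ' heq => by
      rw [mem_filter] at hβ hβ'
      rw [← h.inf_sup_inf_eq hγ hβ.1, ← h.inf_sup_inf_eq hγ hβ'.1, ← hsup hβ.1 hβ.2,
        ← hsup hβ'.1 hβ'.2, heq])
  have h2 := Nat.mul_le_mul_left o (h.card_doublesBetween_le' hγ)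
  have h3 := h.three_mul_le_card_filter_commonNear α γ δ
  have := h.fiber_pos
  omega

theorem inf_le (hγ : ¬ Near (S α) (S γ)) (δ : Ω) : S α ⊓ S γ ≤ S δ := by
  by_cases h1 : Near (S α) (S δ)
  · by_cases h2 : Near (S γ) (S δ)
    · exact (h.of_mem_commonNear hγ (mem_commonNear.2 ⟨h1, h2⟩)).2.1
    · rw [inf_comm]
      exact h.inf_le_of_far (fun hn => hγ (h.near_symm hn)) h2
  · exact h.inf_le_of_far hγ h1

theorem le_sup_of_far (hγ : ¬ Near (S α) (S γ)) (hδ : ¬ Near (S α) (S δ)) :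
    S δ ≤ S α ⊔ S γ := by
  classical
  by_cases hne : S δ = S γ
  · exact hne ▸ le_sup_right
  have h2o := h.two_mul_fiber_le hγ hδ hne
  by_cases hconst : ∀ x ∈ ({w ∈ commonNear S α γ | w ∈ commonNear S α δ} : Finset Ω),
      ∀ y ∈ ({w ∈ commonNear S α γ | w ∈ commonNear S α δ} : Finset Ω), S δ ⊓ S x = S δ ⊓ S y
  · have h1 := h.card_le_mul_card
      {w ∈ commonNear S α γ | w ∈ commonNear S α δ} (fun β => S α ⊓ S β)
      (doublesBetween (S α ⊓ S γ) (S α))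
      (fun β hβ => h.inf_mem_doublesBetween hγ (mem_filter.1 hβ).1)
      (fun β hβ β' hβ' heq => by
        have hδβ := hconst β hβ β' hβ'
        rw [mem_filter] at hβ hβ'
        rw [← h.inf_sup_inf_eq hδ hβ.2, ← h.inf_sup_inf_eq hδ hβ'.2, hδβ, heq])
    have h2 := Nat.mul_le_mul_left o (h.card_doublesBetween_le hγ)
    have h3 := h.three_mul_le_card_filter_commonNear α γ δ
    have := h.fiber_pos
    omega
  · push Not at hconst
    obtain ⟨x, hx, y, hy, hxy⟩ := hconst
    rw [mem_filter] at hx hy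
    have hle {z : Ω} (hz : z ∈ commonNear S α γ) : S δ ⊓ S z ≤ S α ⊔ S γ := by
      refine inf_le_right.trans ?_
      rw [← h.inf_sup_inf_eq hγ hz]
      exact sup_le_sup inf_le_left inf_le_left
    have hcx := (h.of_mem_commonNear hδ hx.2).2.2.2
    have hcy := (h.of_mem_commonNear hδ hy.2).2.2.2
    have := h.card_eq α δ
    rw [← sup_eq_of_card_eq_two_mul (inf_le_left : S δ ⊓ S x ≤ S δ)
      (inf_le_left : S δ ⊓ S y ≤ S δ) (by omega) (by omega) hxy]
    exact sup_le (hle hx.1) (hle hy.1)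

theorem le_sup (hγ : ¬ Near (S α) (S γ)) (δ : Ω) : S δ ≤ S α ⊔ S γ := by
  by_cases h1 : Near (S α) (S δ)
  · by_cases h2 : Near (S γ) (S δ)
    · rw [← h.inf_sup_inf_eq hγ (mem_commonNear.2 ⟨h1, h2⟩)]
      exact sup_le_sup inf_le_left inf_le_left
    · rw [sup_comm]
      exact h.le_sup_of_far (fun hn => hγ (h.near_symm hn)) h2
  · exact h.le_sup_of_far hγ h1

theorem normal_sup (hγ : ¬ Near (S α) (S γ)) : (S α ⊔ S γ).Normal := by
  have hle (g : G) (x : Ω) : (S x).map (MulAut.conj g).toMonoidHom ≤ S α ⊔ S γ := by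
    obtain ⟨y, hy⟩ := h.exists_eq_map g x
    exact hy ▸ h.le_sup hγ y
  refine ⟨fun n hn g => ?_⟩
  have h1 : (S α ⊔ S γ).map (MulAut.conj g).toMonoidHom ≤ S α ⊔ S γ := by
    rw [Subgroup.map_sup]
    exact sup_le (hle g α) (hle g γ)
  exact h1 ⟨n, hn, rfl⟩

end

section

variable (h : IsMostlyNear S o f) (hcore : ∀ K : Subgroup G, (∀ x, K ≤ S x) → K = ⊥)

include h hcore

theorem inf_eq_bot (hγ : ¬ Near (S α) (S γ)) : S α ⊓ S γ = ⊥ :=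
  hcore _ (h.inf_le hγ)

theorem card_eq_four (hγ : ¬ Near (S α) (S γ)) : Nat.card (S α) = 4 := by
  rw [h.card_eq_four_mul hγ, h.inf_eq_bot hcore hγ, Subgroup.card_bot]

omit [Finite G] hcore in
theorem commute_of_mem (h4 : Nat.card (S α) = 4) (β : Ω) :
    ∀ x ∈ S β, ∀ y ∈ S β, x * y = y * x := by
  intro x hx y hy
  have : Fact (Nat.Prime 2) := ⟨Nat.prime_two⟩
  have hcomm := IsPGroup.isMulCommutative_of_card_eq_prime_sq (p := 2) (G := S β)
    (by rw [← h.card_eq α β, h4]; norm_num)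
  exact congrArg Subtype.val (hcomm.is_comm.comm ⟨x, hx⟩ ⟨y, hy⟩)

theorem sq_eq_one (hγ : ¬ Near (S α) (S γ)) (δ : Ω) : ∀ x ∈ S δ, x ^ 2 = 1 := by
  obtain ⟨β, hβ⟩ := h.exists_mem_commonNear α γ
  obtain ⟨-, -, h1, h2⟩ := h.of_mem_commonNear hγ hβ
  have h4 := h.card_eq_four hcore hγ
  have hsq {H : Subgroup G} (hH : Nat.card H = 2) : ∀ x ∈ H, x ^ 2 = 1 := by
    intro x hx
    rw [← hH]
    exact congrArg Subtype.val (pow_card_eq_one' (x := (⟨x, hx⟩ : H)))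
  have hβ2 : ∀ x ∈ S β, x ^ 2 = 1 := by
    rw [← h.inf_sup_inf_eq hγ hβ]
    exact sq_eq_one_of_mem_sup
      (fun x hx y hy => h.commute_of_mem h4 β x hx.2 y hy.2)
      (hsq (by omega)) (hsq (by omega))
  obtain ⟨g, hg⟩ := h.eq_map β δ
  rw [hg]
  rintro _ ⟨b, hb, rfl⟩
  rw [← map_pow, hβ2 b hb, map_one]

theorem not_near_of_eq_map (hγ : ¬ Near (S α) (S γ)) {x : G} (hx : x ∈ S α)
    (hδ : S δ = (S γ).map (MulAut.conj x).toMonoidHom) : ¬ Near (S α) (S δ) := by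
  have hb : S α ⊓ S δ = ⊥ := by
    rw [eq_bot_iff, hδ]
    rintro _ ⟨hz, c, hc, rfl⟩
    have hcα : c ∈ S α := by
      have hz' : x * c * x⁻¹ ∈ S α := hz
      rwa [Subgroup.mul_mem_cancel_right _ (inv_mem hx), Subgroup.mul_mem_cancel_left _ hx] at hz'
    have : c ∈ S α ⊓ S γ := ⟨hcα, hc⟩
    rw [h.inf_eq_bot hcore hγ, Subgroup.mem_bot] at this
    simp [this]
  rw [Near, hb, h.card_eq_four hcore hγ, Subgroup.card_bot]
  norm_num

theorem two_mul_fiber_le_of_not_commute (hγ : ¬ Near (S α) (S γ)) {x y : G} (hx : x ∈ S α)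
    (hy : y ∈ S γ) (hxy : x * y ≠ y * x) : 2 * o ≤ f := by
  obtain ⟨δ, hδ⟩ := h.exists_eq_map x γ
  obtain ⟨ε, hε⟩ := h.exists_eq_map y α
  have hγ' : ¬ Near (S γ) (S α) := fun hn => hγ (h.near_symm hn)
  by_cases h1 : S δ = S γ
  · by_cases h2 : S ε = S α
    · refine absurd ?_ hxy
      have hyc : x * y * x⁻¹ ∈ S γ := by
        rw [← h1, hδ]
        exact ⟨y, hy, rfl⟩
      have hxc : y * x⁻¹ * y⁻¹ ∈ S α := by
        rw [← h2, hε]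
        exact ⟨x⁻¹, inv_mem hx, rfl⟩
      have hmem : x * y * x⁻¹ * y⁻¹ ∈ S α ⊓ S γ := by
        refine Subgroup.mem_inf.2 ⟨?_, mul_mem hyc (inv_mem hy)⟩
        have := mul_mem hx hxc
        simpa only [mul_assoc] using this
      rw [h.inf_eq_bot hcore hγ, Subgroup.mem_bot, mul_inv_eq_one, mul_inv_eq_iff_eq_mul] at hmem
      exact hmem
    · exact h.two_mul_fiber_le hγ' (h.not_near_of_eq_map hcore hγ' hy hε) h2
  · exact h.two_mul_fiber_le hγ (h.not_near_of_eq_map hcore hγ hx hδ) h1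

theorem commute (hγ : ¬ Near (S α) (S γ)) : ∀ x ∈ S α, ∀ y ∈ S γ, x * y = y * x := by
  classical
  intro x hx y hy
  by_contra hxy
  have h2o := h.two_mul_fiber_le_of_not_commute hcore hγ hx hy hxy
  have h4 := h.card_eq_four hcore hγ
  have hz : Nat.card (Subgroup.zpowers x) = 2 := by
    rw [Nat.card_zpowers]
    refine orderOf_eq_prime (h.sq_eq_one hcore hγ α x hx) ?_
    rintro rfl
    simp at hxy
  have hle : Subgroup.zpowers x ≤ S α := by simpa using hx
  have hmem : Subgroup.zpowers x ∈ doublesBetween (S α ⊓ S γ) (S α) := by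
    rw [mem_doublesBetween, h.inf_eq_bot hcore hγ, hz, Subgroup.card_bot]
    exact ⟨bot_le, hle, rfl⟩
  have hinf {β : Ω} (hβ : β ∈ commonNear S α γ) (hxβ : x ∈ S β) :
      S α ⊓ S β = Subgroup.zpowers x := by
    have := (h.of_mem_commonNear hγ hβ).2.2.1
    refine (Subgroup.eq_of_le_of_card_ge ?_ (by omega)).symm
    simpa using ⟨hx, hxβ⟩
  have h1 : #({β ∈ commonNear S α γ | x ∈ S β}) ≤ o * 1 := by
    refine h.card_le_mul_card _ (fun _ => ()) {()} (by simp) fun β hβ β' hβ' _ => ?_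
    rw [mem_filter] at hβ hβ'
    have hc := (h.of_mem_commonNear hγ hβ.1).2.2.2
    have hc' := (h.of_mem_commonNear hγ hβ'.1).2.2.2
    have hγα := h.card_eq γ α
    have heq : S γ ⊓ S β = S γ ⊓ S β' := by
      by_contra hne
      have hsup : (S γ ⊓ S β) ⊔ (S γ ⊓ S β') = S γ :=
        sup_eq_of_card_eq_two_mul inf_le_left inf_le_left (by omega) (by omega) hne
      have hcent {η : Ω} (hη : x ∈ S η) : S γ ⊓ S η ≤ Subgroup.centralizer {x} := by
        intro z hz
        rw [Subgroup.mem_centralizer_singleton_iff]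
        exact h.commute_of_mem h4 η z hz.2 x hη
      have hy' : y ∈ Subgroup.centralizer {x} :=
        sup_le (hcent hβ.2) (hcent hβ'.2) (hsup.symm ▸ hy)
      rw [Subgroup.mem_centralizer_singleton_iff] at hy'
      exact hxy hy'.symm
    rw [← h.inf_sup_inf_eq hγ hβ.1, ← h.inf_sup_inf_eq hγ hβ'.1, hinf hβ.1 hβ.2,
      hinf hβ'.1 hβ'.2, heq]
  have h2 := h.card_le_mul_card {β ∈ commonNear S α γ | ¬ x ∈ S β}
    (fun β => (S α ⊓ S β, S γ ⊓ S β))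
    ((doublesBetween (S α ⊓ S γ) (S α)).erase (Subgroup.zpowers x) ×ˢ
      doublesBetween (S α ⊓ S γ) (S γ))
    (fun β hβ => by
      rw [mem_filter] at hβ
      refine mem_product.2 ⟨mem_erase.2 ⟨fun heq => hβ.2 ?_, h.inf_mem_doublesBetween hγ hβ.1⟩,
        h.inf_mem_doublesBetween' hγ hβ.1⟩
      have : x ∈ S α ⊓ S β := heq.ge (Subgroup.mem_zpowers x)
      exact this.2)
    (fun β hβ β' hβ' heq => by
      rw [mem_filter] at hβ hβ'
      rw [← h.inf_sup_inf_eq hγ hβ.1, ← h.inf_sup_inf_eq hγ hβ'.1]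
      rw [Prod.mk.injEq] at heq
      rw [heq.1, heq.2])
  rw [card_product, card_erase_of_mem hmem] at h2
  have h3 := h2.trans (Nat.mul_le_mul_left o (Nat.mul_le_mul
    (Nat.sub_le_sub_right (h.card_doublesBetween_le hγ) 1) (h.card_doublesBetween_le' hγ)))
  have h5 := card_filter_add_card_filter_not (s := commonNear S α γ) (fun β => x ∈ S β)
  have h6 := h.four_mul_le_card_commonNear α γ
  have := h.fiber_pos
  omega

end

end IsMostlyNear

end Families

section Stabilizers

variable {G Ω : Type*} [Group G] [Finite G] [MulAction G Ω]

omit [Finite G] in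
theorem card_orbit_stabilizer_mul (α δ : Ω) :
    Nat.card (stabilizer G α ⊓ stabilizer G δ : Subgroup G) *
      Nat.card (orbit (stabilizer G α) δ) = Nat.card (stabilizer G α) := by
  rw [← card_inf_mul_relIndex (stabilizer G α) (stabilizer G δ), Subgroup.relIndex]
  have : (stabilizer G δ).subgroupOf (stabilizer G α) = stabilizer (stabilizer G α) δ := rfl
  rw [this, index_stabilizer, Nat.card_coe_set_eq]

theorem near_stabilizer_iff (α δ : Ω) :
    Near (stabilizer G α) (stabilizer G δ) ↔
      Nat.card (orbit (stabilizer G α) δ) = 1 ∨ Nat.card (orbit (stabilizer G α) δ) = 2 := by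
  have h1 := card_orbit_stabilizer_mul (G := G) α δ
  have h2 : 0 < Nat.card (stabilizer G α ⊓ stabilizer G δ : Subgroup G) := Nat.card_pos
  have h3 : 0 < Nat.card (stabilizer G α) := Nat.card_pos
  rw [Near]
  constructor
  · intro h
    have : Nat.card (orbit (stabilizer G α) δ) < 3 := by
      by_contra! h4
      have := Nat.mul_le_mul_left (Nat.card (stabilizer G α ⊓ stabilizer G δ : Subgroup G)) h4
      omega
    interval_cases Nat.card (orbit (stabilizer G α) δ) <;> omega
  · rintro (h | h) <;> rw [h] at h1 <;> omega

omit [Finite G] in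
theorem card_stabilizer_eq [IsPretransitive G Ω] (α δ : Ω) :
    Nat.card (stabilizer G α) = Nat.card (stabilizer G δ) := by
  obtain ⟨g, rfl⟩ := exists_smul_eq G α δ
  rw [stabilizer_smul_eq_stabilizer_map_conj]
  exact (Subgroup.card_map_of_injective (MulAut.conj g).injective).symm

theorem stabilizer_eq_iff [IsPretransitive G Ω] (α δ : Ω) :
    stabilizer G δ = stabilizer G α ↔ Nat.card (orbit (stabilizer G α) δ) = 1 := by
  have h1 := card_orbit_stabilizer_mul (G := G) α δ
  have h2 : 0 < Nat.card (stabilizer G α) := Nat.card_pos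
  constructor
  · intro h
    rw [h, inf_idem] at h1
    exact Nat.eq_of_mul_eq_mul_left h2 (by omega)
  · intro h
    rw [h, mul_one] at h1
    have h3 : stabilizer G α ⊓ stabilizer G δ = stabilizer G α :=
      Subgroup.eq_of_le_of_card_ge inf_le_left h1.ge
    exact (Subgroup.eq_of_le_of_card_ge (inf_eq_left.1 h3) (card_stabilizer_eq δ α).le).symm

theorem card_orbit_stabilizer_smul (g : G) (α δ : Ω) :
    Nat.card (orbit (stabilizer G (g • α)) (g • δ)) = Nat.card (orbit (stabilizer G α) δ) := by
  have h1 := card_orbit_stabilizer_mul (G := G) α δ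
  have h2 := card_orbit_stabilizer_mul (G := G) (g • α) (g • δ)
  rw [stabilizer_smul_eq_stabilizer_map_conj, stabilizer_smul_eq_stabilizer_map_conj,
    ← Subgroup.map_inf _ _ _ (MulAut.conj g).injective,
    Subgroup.card_map_of_injective (MulAut.conj g).injective,
    Subgroup.card_map_of_injective (MulAut.conj g).injective, ← h1,
    ← stabilizer_smul_eq_stabilizer_map_conj] at h2
  exact Nat.eq_of_mul_eq_mul_left Nat.card_pos h2

theorem ncard_setOf_card_orbit_eq [IsPretransitive G Ω] (p : ℕ → Prop) (α β : Ω) :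
    {δ : Ω | p (Nat.card (orbit (stabilizer G α) δ))}.ncard =
      {δ : Ω | p (Nat.card (orbit (stabilizer G β) δ))}.ncard := by
  obtain ⟨g, rfl⟩ := exists_smul_eq G α β
  rw [← Set.ncard_image_of_injective _ (MulAction.injective g)]
  congr 1
  ext δ
  obtain ⟨δ, rfl⟩ := MulAction.surjective g δ
  rw [(MulAction.injective g).mem_set_image, Set.mem_ofPred_eq, Set.mem_ofPred_eq,
    card_orbit_stabilizer_smul]

end Stabilizers

theorem stmt_11 {G Ω : Type*} [Group G] [Finite G] [Finite Ω] [MulAction G Ω]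
    [IsPretransitive G Ω] [FaithfulSMul G Ω] (α : Ω)
    (h1 : (Nat.card Ω : ℚ) / 2 <
      ({δ : Ω | Nat.card (orbit (stabilizer G α) δ) = 1}.ncard : ℚ)
      + ({δ : Ω | Nat.card (orbit (stabilizer G α) δ) = 2}.ncard : ℚ))
    (h2 : ({δ : Ω | Nat.card (orbit (stabilizer G α) δ) = 1}.ncard : ℚ)
      + ({δ : Ω | Nat.card (orbit (stabilizer G α) δ) = 2}.ncard : ℚ)
      < (Nat.card Ω : ℚ)) :
    (({δ : Ω | Nat.card (orbit (stabilizer G α) δ) = 1}.ncard : ℚ)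
      + ({δ : Ω | Nat.card (orbit (stabilizer G α) δ) = 2}.ncard : ℚ)
      < (5 : ℚ) / 6 * Nat.card Ω) ∨
    (({δ : Ω | Nat.card (orbit (stabilizer G α) δ) = 4}.ncard ≤
        2 * {δ : Ω | Nat.card (orbit (stabilizer G α) δ) = 1}.ncard) ∧
      (∀ x ∈ stabilizer G α, x ^ 2 = 1) ∧
      (∀ β ∈ {δ : Ω | Nat.card (orbit (stabilizer G α) δ) = 4},
        ∀ x ∈ stabilizer G α, ∀ y ∈ stabilizer G β, x * y = y * x) ∧
      (∀ β ∈ {δ : Ω | Nat.card (orbit (stabilizer G α) δ) = 4},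
        stabilizer G α ⊓ stabilizer G β = ⊥ ∧
        (stabilizer G α ⊔ stabilizer G β).Normal ∧
        Nat.card ↥(stabilizer G α ⊔ stabilizer G β) = 16 ∧
        (∀ x ∈ stabilizer G α ⊔ stabilizer G β, x ^ 2 = 1) ∧
        Nat.card ↥(stabilizer G α ⊔ stabilizer G β) =
          Nat.card (stabilizer G α) * Nat.card (stabilizer G β))) := by
  classical
  have := Fintype.ofFinite Ω
  rw [or_iff_not_imp_left, not_lt]
  intro h5
  have hfar (x : Ω) : {y : Ω | ¬ Near (stabilizer G x) (stabilizer G y)} =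
      {y : Ω | ¬ (Nat.card (orbit (stabilizer G x) y) = 1 ∨
        Nat.card (orbit (stabilizer G x) y) = 2)} := by
    simp_rw [near_stabilizer_iff]
  have hsum : {δ : Ω | Nat.card (orbit (stabilizer G α) δ) = 1}.ncard +
      {δ : Ω | Nat.card (orbit (stabilizer G α) δ) = 2}.ncard +
      {δ : Ω | ¬ Near (stabilizer G α) (stabilizer G δ)}.ncard = Nat.card Ω := by
    rw [hfar, ← Set.ncard_union_eq, ← Set.ncard_add_ncard_compl]
    · rfl
    · refine Set.disjoint_left.2 fun x hx hx' => ?_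
      rw [Set.mem_ofPred_eq] at hx hx'
      omega
  have h : IsMostlyNear (fun x : Ω => stabilizer G x)
      {δ : Ω | Nat.card (orbit (stabilizer G α) δ) = 1}.ncard
      {y : Ω | ¬ Near (stabilizer G α) (stabilizer G y)}.ncard :=
    { card_eq := card_stabilizer_eq
      card_fiber := fun x => by
        rw [← ncard_setOf_eq_card_filter]
        simp_rw [stabilizer_eq_iff]
        exact ncard_setOf_card_orbit_eq (G := G) (· = 1) x α
      card_far := fun x => by
        rw [← ncard_setOf_eq_card_filter, hfar, hfar]
        exact ncard_setOf_card_orbit_eq (G := G) (fun n => ¬ (n = 1 ∨ n = 2)) x α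
      six_mul_le := by
        rw [← Nat.card_eq_fintype_card, ← @Nat.cast_le ℚ]
        rw [← hsum] at h5 ⊢
        push_cast at h5 ⊢
        linarith
      pos := by
        rw [← hsum] at h2
        norm_cast at h2
        omega
      exists_eq_map := fun g x => ⟨g • x, stabilizer_smul_eq_stabilizer_map_conj g x⟩
      eq_map := fun x y => by
        obtain ⟨g, rfl⟩ := exists_smul_eq G x y
        exact ⟨g, stabilizer_smul_eq_stabilizer_map_conj g x⟩ }
  have hcore : ∀ K : Subgroup G, (∀ x : Ω, K ≤ stabilizer G x) → K = ⊥ := by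
    intro K hK
    rw [eq_bot_iff]
    intro k hk
    exact Subgroup.mem_bot.2 (eq_of_smul_eq_smul fun x : Ω => by simpa using hK x hk)
  have hfour {β : Ω} (hβ : Nat.card (orbit (stabilizer G α) β) = 4) :
      ¬ Near (stabilizer G α) (stabilizer G β) := by
    rw [near_stabilizer_iff, hβ]
    norm_num
  obtain ⟨γ, hγ⟩ := Set.nonempty_of_ncard_ne_zero h.pos.ne'
  have hsq := h.sq_eq_one hcore hγ
  refine ⟨(Set.ncard_le_ncard fun β hβ => hfour hβ).trans (h.far_le_two_mul hγ), hsq α,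
    fun β hβ => h.commute hcore (hfour hβ), fun β hβ => ?_⟩
  · have hcomm := h.commute hcore (hfour hβ)
    have hbot := h.inf_eq_bot hcore (hfour hβ)
    have hcard := card_sup_of_commute hcomm hbot
    refine ⟨hbot, h.normal_sup (hfour hβ), ?_, sq_eq_one_of_mem_sup hcomm (hsq α) (hsq β), hcard⟩
    rw [hcard, ← card_stabilizer_eq α β, h.card_eq_four hcore (hfour hβ)]
end

section
/- Let R be a finite group, let U be a proper subgroup of R, and let r ∈ U be a central involution of R. Define τ : R → R by x^τ = x for x ∈ U and x^τ = x·r for x ∈ R \ U. Then at least one of the following holds: (a) the number of inverse-closed subsets S ⊆ R with S^τ = S is at most 2^{c(R) − |R|/48}; (b) R is generalized dicyclic; (c) R is isomorphic to C₄ × C₂^ℓ for some non-negative integer ℓ. -/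
/-- A subgroup containing more than half of the elements is the whole group. -/
theorem Subgroup.eq_top_of_card_lt_two_mul {G : Type*} [Group G] [Fintype G] (K : Subgroup G)
    (S : Finset G) (hS : ∀ g ∈ S, g ∈ K) (h : Fintype.card G < 2 * S.card) : K = ⊤ := by
  classical
  have h1 : S.card ≤ Nat.card K := by
    rw [Nat.card_eq_fintype_card, Fintype.card_subtype]
    exact Finset.card_le_card fun g hg => by simpa using hS g hg
  have h2 := K.card_mul_index
  rw [Nat.card_eq_fintype_card (α := G)] at h2
  have h3 : K.index ≠ 0 := K.index_ne_zero_of_finite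
  rw [← Subgroup.index_eq_one]
  by_contra h4
  have : 2 ≤ K.index := by omega
  nlinarith

/-- The complement of an intersection is at most as large as the complements together. -/
theorem Finset.card_filter_not_and_le {α : Type*} [Fintype α] (p q : α → Prop)
    [DecidablePred p] [DecidablePred q] :
    (univ.filter fun a => ¬(p a ∧ q a)).card
      ≤ (univ.filter fun a => ¬p a).card + (univ.filter fun a => ¬q a).card := by
  classical
  refine (card_le_card ?_).trans (card_union_le _ _)
  intro a
  simp only [mem_filter, mem_univ, true_and, mem_union]
  tauto

/-- Left translation preserves the size of a decidable set. -/
theorem Finset.card_filter_mul_left {G : Type*} [Group G] [Fintype G] (p : G → Prop)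
    [DecidablePred p] (x : G) :
    (univ.filter fun g => p (x * g)).card = (univ.filter p).card := by
  refine card_bij (fun g _ => x * g) (by simp) (by simp) fun b hb => ⟨x⁻¹ * b, ?_, by simp⟩
  simpa using hb

open Finset in
/-- A homomorphism agreeing with inversion on more than three quarters of the elements
agrees with inversion everywhere. -/
theorem MonoidHom.forall_eq_inv_of_three_quarters {G K : Type*} [Group G] [Fintype G] [Group K]
    [DecidableEq K] (ι f : G →* K) (hι : Function.Injective ι)
    (h : 4 * (univ.filter fun g => ¬f g = (ι g)⁻¹).card < Fintype.card G) :
    ∀ g, f g = (ι g)⁻¹ := by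
  classical
  have key (p : G → Prop) [DecidablePred p] :
      (univ.filter p).card + (univ.filter fun g => ¬p g).card = Fintype.card G := by
    simpa using card_filter_add_card_filter_not (s := (univ : Finset G)) p
  have hcent : ∀ x, f x = (ι x)⁻¹ → x ∈ Subgroup.center G := by
    intro x hx
    have h1 : Subgroup.centralizer {x} = ⊤ := by
      apply Subgroup.eq_top_of_card_lt_two_mul _
        (univ.filter fun g => f g = (ι g)⁻¹ ∧ f (x * g) = (ι (x * g))⁻¹)
      · intro g hg
        simp only [mem_filter, mem_univ, true_and] at hg
        obtain ⟨hg1, hg2⟩ := hg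
        rw [map_mul, hx, hg1, ← mul_inv_rev, ← map_mul, inv_inj] at hg2
        rw [Subgroup.mem_centralizer_singleton_iff]
        exact hι hg2
      · have h2 := key fun g => f g = (ι g)⁻¹ ∧ f (x * g) = (ι (x * g))⁻¹
        have h3 := card_filter_not_and_le (fun g => f g = (ι g)⁻¹)
          (fun g => f (x * g) = (ι (x * g))⁻¹)
        have h4 := card_filter_mul_left (fun g => ¬f g = (ι g)⁻¹) x
        omega
    rw [Subgroup.mem_center_iff]
    intro g
    have : g ∈ Subgroup.centralizer {x} := h1 ▸ Subgroup.mem_top g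
    exact Subgroup.mem_centralizer_singleton_iff.1 this
  have hkey := key fun g => f g = (ι g)⁻¹
  have hcomm : Subgroup.center G = ⊤ := by
    apply Subgroup.eq_top_of_card_lt_two_mul _ (univ.filter fun g => f g = (ι g)⁻¹)
    · intro g hg
      exact hcent g (by simpa using hg)
    · omega
  have hc (a b : G) : a * b = b * a :=
    Subgroup.mem_center_iff.1 (hcomm ▸ Subgroup.mem_top b : b ∈ Subgroup.center G) a
  let J : Subgroup G :=
    { carrier := {g | f g = (ι g)⁻¹}
      one_mem' := by simp
      mul_mem' := by
        intro a b ha hb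
        simp only [Set.mem_ofPred_eq] at *
        rw [map_mul, ha, hb, ← mul_inv_rev, ← map_mul, hc]
      inv_mem' := by
        intro a ha
        simp only [Set.mem_ofPred_eq] at *
        rw [map_inv, ha, map_inv] }
  have hJ : J = ⊤ := by
    apply Subgroup.eq_top_of_card_lt_two_mul _ (univ.filter fun g => f g = (ι g)⁻¹)
    · intro g hg
      exact (by simpa using hg : f g = (ι g)⁻¹)
    · omega
  intro g
  exact (hJ ▸ Subgroup.mem_top g : g ∈ J)

open Finset in
/-- If conjugation by `x` inverts more than three quarters of the elements of a subgroup `H`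
then it inverts every element of `H`. -/
theorem Subgroup.conj_eq_inv_of_three_quarters {R : Type*} [Group R] [Fintype R] [DecidableEq R]
    (H : Subgroup R) [DecidablePred (· ∈ H)] (x : R)
    (h : 4 * (univ.filter fun g => g ∈ H ∧ ¬x * g * x⁻¹ = g⁻¹).card < Nat.card H) :
    ∀ g ∈ H, x * g * x⁻¹ = g⁻¹ := by
  have := MonoidHom.forall_eq_inv_of_three_quarters H.subtype
    ((MulAut.conj x).toMonoidHom.comp H.subtype) H.subtype_injective ?_
  · intro g hg
    simpa using this ⟨g, hg⟩
  · rw [Nat.card_eq_fintype_card] at h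
    refine lt_of_le_of_lt (Nat.mul_le_mul_left 4 ?_) h
    refine card_le_card_of_injOn (fun g => (g : R)) ?_ (fun a _ b _ hab => Subtype.ext hab)
    intro g hg
    exact mem_coe.2 (mem_filter.2 ⟨mem_univ _, g.2, (mem_filter.1 (mem_coe.1 hg)).2⟩)

theorem IsGeneralizedDicyclic.of_conj_eq_inv {R : Type*} [Group R] [Finite R] (A : Subgroup R)
    (x : R) (hA : A.index = 2) (hx : x ∉ A) (hx2 : x ^ 2 ≠ 1) (hx4 : (x ^ 2) ^ 2 = 1)
    (hinv : ∀ a ∈ A, x * a * x⁻¹ = a⁻¹) (hexp : ∃ a ∈ A, a ^ 2 ≠ 1) :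
    IsGeneralizedDicyclic R := by
  refine ⟨A, x, ?_, ?_, hA, hx, Subgroup.sq_mem_of_index_two hA x, hx2, hx4, hinv⟩
  · rintro ⟨a, ha⟩ ⟨b, hb⟩
    ext
    have h1 := hinv _ (A.mul_mem ha hb)
    have h2 : x * (a * b) * x⁻¹ = (x * a * x⁻¹) * (x * b * x⁻¹) := by group
    rw [h2, hinv a ha, hinv b hb, ← mul_inv_rev, inv_inj] at h1
    exact h1.symm
  · obtain ⟨a, ha, ha2⟩ := hexp
    have h0 : Monoid.exponent A ≠ 0 := Monoid.exponent_ne_zero_of_finite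
    have h1 : (⟨a, ha⟩ : A) ^ Monoid.exponent A = 1 := Monoid.pow_exponent_eq_one _
    have h2 : a ^ Monoid.exponent A = 1 := by simpa [Subtype.ext_iff] using h1
    by_contra hlt
    have : Monoid.exponent A = 1 ∨ Monoid.exponent A = 2 := by omega
    rcases this with h | h <;> rw [h] at h2
    · simp_all
    · exact ha2 h2

/-- A finite abelian group with an elementary abelian `2`-subgroup of index two whose
complement contains an element of order four is a direct product of a cyclic group of order four
and an elementary abelian `2`-group. -/
theorem AddSubgroup.exists_addEquiv_zmod_four_prod {A : Type*} [AddCommGroup A] [Finite A]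
    (U : AddSubgroup A) (hU : U.index = 2) (hU2 : ∀ u ∈ U, 2 • u = 0) (x : A) (hx : x ∉ U)
    (hx2 : 2 • x ≠ 0) : ∃ ℓ : ℕ, Nonempty (A ≃+ ZMod 4 × (Fin ℓ → ZMod 2)) := by
  have h2x : 2 • x ∈ U := AddSubgroup.two_smul_mem_of_index_two hU x
  let : Module (ZMod 2) U := AddCommGroup.zmodModule fun u => Subtype.ext (hU2 u u.2)
  obtain ⟨W, hW⟩ := Submodule.exists_isCompl (Submodule.span (ZMod 2) {(⟨2 • x, h2x⟩ : U)})
  let b := Module.finBasis (ZMod 2) W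
  let e : (Fin (Module.finrank (ZMod 2) W) → ZMod 2) ≃+ W := b.equivFun.symm.toAddEquiv
  have h4 : 4 • x = 0 := by
    have := hU2 _ h2x
    rwa [smul_smul] at this
  let f : ZMod 4 →+ A := ZMod.lift 4 ⟨zmultiplesHom A x, by simpa using mod_cast h4⟩
  let g : (Fin (Module.finrank (ZMod 2) W) → ZMod 2) →+ A :=
    (U.subtype.comp W.toAddSubgroup.subtype).comp e.toAddMonoidHom
  have hf (k : ℕ) : f k = k • x := by
    have := ZMod.lift_coe 4 ⟨zmultiplesHom A x, by simpa using mod_cast h4⟩ (k : ℤ)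
    simpa [f] using this
  have hgU (w) : g w ∈ U := ((e w : W) : U).2
  refine ⟨_, ⟨(AddEquiv.ofBijective (f.coprod g) ⟨?_, fun a => ?_⟩).symm⟩⟩
  · rw [injective_iff_map_eq_zero]
    rintro ⟨a, w⟩ haw
    rw [AddMonoidHom.coprod_apply] at haw
    simp only at haw
    obtain ⟨k, hk, rfl⟩ : ∃ k < 4, ((k : ℕ) : ZMod 4) = a := ⟨a.val, a.val_lt, by simp⟩
    rw [hf] at haw
    have hkU : k • x ∈ U := by
      rw [eq_neg_of_add_eq_zero_left haw]
      exact U.neg_mem (hgU w)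
    interval_cases k
    · have h0 : ((e w : W) : U) = (0 : U) := Subtype.ext (by
        rw [zero_nsmul, zero_add] at haw
        exact haw)
      have : e w = 0 := Subtype.ext h0
      simpa using this
    · simp [hx] at hkU
    · exfalso
      have h0 : (⟨2 • x, h2x⟩ : U) = -((e w : W) : U) :=
        Subtype.ext (eq_neg_of_add_eq_zero_left haw)
      have h1 := Submodule.disjoint_def.1 hW.disjoint _ (Submodule.mem_span_singleton_self _)
        (h0 ▸ W.neg_mem (e w).2)
      exact hx2 (congrArg Subtype.val h1)
    · rw [succ_nsmul, AddSubgroup.add_mem_cancel_left _ h2x] at hkU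
      exact absurd hkU hx
  · have hrange : ∀ u ∈ U, u ∈ (f.coprod g).range := by
      intro u hu
      obtain ⟨s, hs, w, hw, hsw⟩ := Submodule.mem_sup.1
        (hW.sup_eq_top ▸ Submodule.mem_top : (⟨u, hu⟩ : U) ∈ _ ⊔ W)
      obtain ⟨c, rfl⟩ := Submodule.mem_span_singleton.1 hs
      obtain ⟨k, rfl⟩ : ∃ k : ℕ, (k : ZMod 2) = c := ⟨c.val, by simp⟩
      refine ⟨(((k * 2 : ℕ) : ZMod 4), e.symm ⟨w, hw⟩), ?_⟩
      rw [AddMonoidHom.coprod_apply]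
      simp only
      rw [hf, mul_smul]
      rw [Nat.cast_smul_eq_nsmul] at hsw
      simpa [g] using congrArg Subtype.val hsw
    by_cases ha : a ∈ U
    · exact hrange a ha
    · have h1 : a + x ∈ U := by
        rw [AddSubgroup.add_mem_iff_of_index_two hU]
        tauto
      have hxr : x ∈ (f.coprod g).range := ⟨(((1 : ℕ) : ZMod 4), 0), by
        rw [AddMonoidHom.coprod_apply]
        simp only
        rw [hf]
        simp⟩
      have h2 := (f.coprod g).range.sub_mem (hrange _ h1) hxr
      rwa [add_sub_cancel_right] at h2

theorem conj_eq_inv_of_mul_sq_eq {G : Type*} [Group G] {x g : G} (h : (x * g) ^ 2 = x ^ 2) :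
    x * g * x⁻¹ = g⁻¹ := by
  rw [sq, sq, mul_assoc, mul_left_cancel_iff] at h
  rw [mul_inv_eq_iff_eq_mul, eq_inv_mul_iff_mul_eq, h]

theorem mul_mul_eq_of_sq_eq {G : Type*} [Group G] {x g : G} (hg : g ^ 2 = x ^ 2)
    (h : (x * g) ^ 2 = x ^ 2) : x * g * x = g := by
  have h1 := conj_eq_inv_of_mul_sq_eq h
  rw [mul_inv_eq_iff_eq_mul] at h1
  rw [h1, mul_assoc, ← sq, ← hg, sq, inv_mul_cancel_left]

open Finset in
/-- A group is generalized dicyclic or isomorphic to `C₄ × C₂^ℓ` when most elements outside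
a subgroup of index two square to a fixed central involution. -/
theorem isGeneralizedDicyclic_or_of_index_two {R : Type*} [Group R] [Fintype R] [DecidableEq R]
    (U : Subgroup R) [DecidablePred (· ∈ U)] (hU : U.index = 2) (r : R)
    (hr2 : r ^ 2 = 1) (hr1 : r ≠ 1)
    (x : R) (hxU : x ∉ U) (hxr : x ^ 2 = r)
    (hB : 8 * (univ.filter fun g => g ∉ U ∧ g ^ 2 ≠ r).card < Nat.card R) :
    IsGeneralizedDicyclic R ∨
    (∃ ℓ : ℕ, Nonempty (R ≃* Multiplicative (ZMod 4 × (Fin ℓ → ZMod 2)))) := by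
  have hinv : ∀ g ∈ U, x * g * x⁻¹ = g⁻¹ := by
    apply Subgroup.conj_eq_inv_of_three_quarters
    have h1 : (univ.filter fun g => g ∈ U ∧ ¬x * g * x⁻¹ = g⁻¹).card
        ≤ (univ.filter fun g => g ∉ U ∧ g ^ 2 ≠ r).card := by
      refine card_le_card_of_injOn (fun g => x * g) ?_ (fun a _ b _ hab => mul_left_cancel hab)
      intro g hg
      obtain ⟨hg1, hg2⟩ := (mem_filter.1 (mem_coe.1 hg)).2
      refine mem_coe.2 (mem_filter.2 ⟨mem_univ _, ?_, fun h => hg2 ?_⟩)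
      · rwa [U.mul_mem_cancel_right hg1]
      · exact conj_eq_inv_of_mul_sq_eq (h.trans hxr.symm)
    have h2 := U.card_mul_index
    rw [hU] at h2
    omega
  by_cases hexp : ∃ a ∈ U, a ^ 2 ≠ 1
  · exact Or.inl (.of_conj_eq_inv U x hU hxU (hxr ▸ hr1) (hxr ▸ hr2) hinv hexp)
  · right
    push Not at hexp
    have hxc : ∀ u ∈ U, x * u = u * x := by
      intro u hu
      rw [← mul_inv_eq_iff_eq_mul, hinv u hu, inv_eq_iff_mul_eq_one, ← sq, hexp u hu]
    have huc : ∀ u ∈ U, ∀ v ∈ U, u * v = v * u := by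
      intro u hu v hv
      have hi (w) (hw : w ∈ U) : w⁻¹ = w := by
        rw [inv_eq_iff_mul_eq_one, ← sq, hexp w hw]
      rw [← hi _ (U.mul_mem hu hv), mul_inv_rev, hi u hu, hi v hv]
    have hdec (a : R) : ∃ u ∈ U, a = u ∨ a = x * u := by
      by_cases ha : a ∈ U
      · exact ⟨a, ha, Or.inl rfl⟩
      · refine ⟨x⁻¹ * a, ?_, Or.inr (by group)⟩
        rw [Subgroup.mul_mem_iff_of_index_two hU, inv_mem_iff]
        tauto
    have hcomm (a b : R) : a * b = b * a := by
      obtain ⟨u, hu, hau⟩ := hdec a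
      obtain ⟨v, hv, hbv⟩ := hdec b
      have h1 : Commute x u := hxc u hu
      have h2 : Commute x v := hxc v hv
      have h3 : Commute u v := huc u hu v hv
      have h4 : Commute x x := rfl
      rcases hau with rfl | rfl <;> rcases hbv with rfl | rfl
      · exact h3
      · exact h1.symm.mul_right h3
      · exact h2.mul_left h3
      · exact (h4.mul_right h2).mul_left (h1.symm.mul_right h3)
    let : CommGroup R := { (inferInstance : Group R) with mul_comm := hcomm }
    obtain ⟨ℓ, ⟨e⟩⟩ := AddSubgroup.exists_addEquiv_zmod_four_prod (A := Additive R)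
      (Subgroup.toAddSubgroup U) hU hexp x hxU
      (fun h => hr1 (hxr ▸ h : r = 1))
    exact ⟨ℓ, ⟨AddEquiv.toMultiplicativeRight e⟩⟩

open Finset in
/-- If more than two thirds of the elements square to `r ≠ 1`, then an element `x` with
`x ^ 2 = r` that is inverted by some conjugation has a centralizer of index two. -/
theorem Subgroup.index_centralizer_eq_two {R : Type*} [Group R] [Fintype R] [DecidableEq R]
    (r : R) (hr1 : r ≠ 1)
    (hN : 3 * (univ.filter fun g : R => ¬g ^ 2 = r).card < Nat.card R)
    (x y : R) (hx : x ^ 2 = r) (hxy : x * y * x = y) :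
    (Subgroup.centralizer {x}).index = 2 := by
  classical
  have h1 : (univ.filter fun g => g ^ 2 = r ∧ (x * g) ^ 2 = r).card
      ≤ (univ.filter fun g => g ∈ Subgroup.centralizer {x}).card := by
    refine card_le_card_of_injOn (fun g => y⁻¹ * g) ?_ (fun a _ b _ hab => mul_left_cancel hab)
    intro g hg
    obtain ⟨hg1, hg2⟩ := (mem_filter.1 (mem_coe.1 hg)).2
    refine mem_coe.2 (mem_filter.2 ⟨mem_univ _, ?_⟩)
    have hxg : x * g * x = g := mul_mul_eq_of_sq_eq (hg1.trans hx.symm) (hg2.trans hx.symm)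
    rw [Subgroup.mem_centralizer_singleton_iff]
    have h2 : x * y⁻¹ = y⁻¹ * x⁻¹ := by
      calc x * y⁻¹ = x * (x * y * x)⁻¹ := by rw [hxy]
        _ = y⁻¹ * x⁻¹ := by group
    have h3 : g * x = x⁻¹ * g := by rw [eq_inv_mul_iff_mul_eq, ← mul_assoc, hxg]
    rw [mul_assoc, h3, ← mul_assoc, ← h2, mul_assoc]
  have h0 : Nat.card (Subgroup.centralizer {x})
      = (univ.filter fun g => g ∈ Subgroup.centralizer {x}).card := by
    rw [Nat.card_eq_fintype_card, Fintype.card_subtype]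
  have h2 := card_filter_add_card_filter_not (s := (univ : Finset R))
    fun g => g ^ 2 = r ∧ (x * g) ^ 2 = r
  have h3 := card_filter_not_and_le (fun g => g ^ 2 = r) (fun g => (x * g) ^ 2 = r)
  have h4 := card_filter_mul_left (fun g => ¬g ^ 2 = r) x
  have h5 := (Subgroup.centralizer {x}).card_mul_index
  have h6 : (Subgroup.centralizer {x}).index ≠ 0 := Subgroup.index_ne_zero_of_finite
  have h7 : (Subgroup.centralizer {x}).index ≠ 1 := by
    rw [Ne, Subgroup.index_eq_one]
    intro h
    have h8 : y ∈ Subgroup.centralizer {x} := h ▸ Subgroup.mem_top y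
    rw [Subgroup.mem_centralizer_singleton_iff] at h8
    rw [mul_assoc, h8, ← mul_assoc, ← sq, hx, mul_eq_right] at hxy
    exact hr1 hxy
  rw [card_univ] at h2
  rw [← Nat.card_eq_fintype_card] at h2
  by_contra h8
  have h9 : 3 ≤ (Subgroup.centralizer {x}).index := by omega
  have := Nat.mul_le_mul_left (Nat.card (Subgroup.centralizer {x})) h9
  omega

open Finset in
/-- A group in which more than two thirds of the elements square to a central involution `r`,
and which contains two elements generating a quaternion group with center `⟨r⟩`, is generalized
dicyclic. -/
theorem IsGeneralizedDicyclic.of_quaternion_pair {R : Type*} [Group R] [Fintype R]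
    [DecidableEq R] (r : R) (hr2 : r ^ 2 = 1) (hr1 : r ≠ 1)
    (hN : 3 * (univ.filter fun g : R => ¬g ^ 2 = r).card < Nat.card R)
    (x y : R) (hx : x ^ 2 = r) (hy : y ^ 2 = r) (hxy : x * y * x = y) :
    IsGeneralizedDicyclic R := by
  classical
  have hyx : y * x * y = x := by
    have h1 : x * y = y * x⁻¹ := by rw [eq_mul_inv_iff_mul_eq, hxy]
    rw [mul_assoc, h1, ← mul_assoc, ← sq, hy, ← hx, sq, mul_inv_cancel_right]
  have hX := Subgroup.index_centralizer_eq_two r hr1 hN x y hx hxy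
  have hY := Subgroup.index_centralizer_eq_two r hr1 hN y x hy hyx
  have hxX : x ∈ Subgroup.centralizer {x} := Subgroup.mem_centralizer_singleton_iff.2 rfl
  have hyY : y ∈ Subgroup.centralizer {y} := Subgroup.mem_centralizer_singleton_iff.2 rfl
  have hyX : y ∉ Subgroup.centralizer {x} := by
    rw [Subgroup.mem_centralizer_singleton_iff]
    intro h
    rw [mul_assoc, h, ← mul_assoc, ← sq, hx, mul_eq_right] at hxy
    exact hr1 hxy
  have hxY : x ∉ Subgroup.centralizer {y} := by
    rw [Subgroup.mem_centralizer_singleton_iff]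
    intro h
    rw [mul_assoc, h, ← mul_assoc, ← sq, hy, mul_eq_right] at hyx
    exact hr1 hyx
  have hcx {a : R} (ha : a ∈ Subgroup.centralizer {x}) : Commute a x :=
    Subgroup.mem_centralizer_singleton_iff.1 ha
  have hcy {a : R} (ha : a ∈ Subgroup.centralizer {y}) : Commute a y :=
    Subgroup.mem_centralizer_singleton_iff.1 ha
  have hmX {a b : R} := Subgroup.mul_mem_iff_of_index_two hX (a := a) (b := b)
  have hmY {a b : R} := Subgroup.mul_mem_iff_of_index_two hY (a := a) (b := b)
  generalize Subgroup.centralizer {x} = X at *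
  generalize Subgroup.centralizer {y} = Y at *
  have hD : ∀ d ∈ X ⊓ Y, (1 : R) * d * 1⁻¹ = d⁻¹ := by
    apply Subgroup.conj_eq_inv_of_three_quarters
    have hidx : (X ⊓ Y).index ≤ 4 := Subgroup.index_inf_le.trans (by rw [hX, hY])
    have hcard := (X ⊓ Y).card_mul_index
    have hcard' := Nat.mul_le_mul_left (Nat.card ↥(X ⊓ Y)) hidx
    have hF : Nat.card ↥(X ⊓ Y) =
        (univ.filter fun g => g ∈ X ⊓ Y ∧ (1 : R) * g * 1⁻¹ = g⁻¹).card
        + (univ.filter fun g => g ∈ X ⊓ Y ∧ ¬(1 : R) * g * 1⁻¹ = g⁻¹).card := by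
      rw [Nat.card_eq_fintype_card, Fintype.card_subtype, ← filter_filter, ← filter_filter,
        card_filter_add_card_filter_not]
    have hsq (g : R) : (1 : R) * g * 1⁻¹ = g⁻¹ ↔ g ^ 2 = 1 := by
      rw [one_mul, inv_one, mul_one, sq, eq_inv_iff_mul_eq_one]
    simp only [hsq] at hF ⊢
    have hsplit : (univ.filter fun g : R => ¬g ^ 2 = r).card =
        (univ.filter fun g : R => ¬g ^ 2 = r ∧ g ∈ X ∧ g ∈ Y).card
        + (univ.filter fun g : R => ¬g ^ 2 = r ∧ g ∈ X ∧ g ∉ Y).card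
        + (univ.filter fun g : R => ¬g ^ 2 = r ∧ g ∉ X ∧ g ∈ Y).card
        + (univ.filter fun g : R => ¬g ^ 2 = r ∧ g ∉ X ∧ g ∉ Y).card := by
      simp only [← filter_filter]
      rw [card_filter_add_card_filter_not, add_assoc, card_filter_add_card_filter_not,
        card_filter_add_card_filter_not]
    have h1 : (univ.filter fun g => g ∈ X ⊓ Y ∧ g ^ 2 = 1).card
        ≤ (univ.filter fun g : R => ¬g ^ 2 = r ∧ g ∈ X ∧ g ∈ Y).card := by
      refine card_le_card fun g hg => ?_
      obtain ⟨hg1, hg2⟩ := (mem_filter.1 hg).2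
      exact mem_filter.2 ⟨mem_univ _, hg2 ▸ hr1.symm, hg1⟩
    have htrans (z : R) (hz : z ^ 2 = r) (hcz : ∀ d ∈ X ⊓ Y, Commute z d) (p : R → Prop)
        [DecidablePred p] (hp : ∀ d ∈ X ⊓ Y, p (z * d)) :
        (univ.filter fun g => g ∈ X ⊓ Y ∧ ¬g ^ 2 = 1).card
        ≤ (univ.filter fun g : R => ¬g ^ 2 = r ∧ p g).card := by
      refine card_le_card_of_injOn (fun g => z * g) ?_ (fun a _ b _ hab => mul_left_cancel hab)
      intro g hg
      obtain ⟨hg1, hg2⟩ := (mem_filter.1 (mem_coe.1 hg)).2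
      refine mem_coe.2 (mem_filter.2 ⟨mem_univ _, ?_, hp g hg1⟩)
      rw [(hcz g hg1).mul_pow, hz, mul_eq_left]
      exact hg2
    have h2 := htrans x hx (fun d hd => (hcx hd.1).symm) (fun g => g ∈ X ∧ g ∉ Y) (fun d hd => by
      have := hd.1; have := hd.2; simp only [hmX, hmY]; tauto)
    have h3 := htrans y hy (fun d hd => (hcy hd.2).symm) (fun g => g ∉ X ∧ g ∈ Y) (fun d hd => by
      have := hd.1; have := hd.2; simp only [hmX, hmY]; tauto)
    have h4 := htrans (x * y) (by rw [sq, ← mul_assoc, hxy, ← sq, hy])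
      (fun d hd => ((hcx hd.1).symm).mul_left (hcy hd.2).symm)
      (fun g => g ∉ X ∧ g ∉ Y) (fun d hd => by
      have := hd.1; have := hd.2; simp only [hmX, hmY]; tauto)
    omega
  simp only [one_mul, inv_one, mul_one] at hD
  refine .of_conj_eq_inv X y hX hyX (hy ▸ hr1) (hy ▸ hr2) (fun a ha => ?_) ⟨x, hxX, hx ▸ hr1⟩
  by_cases haY : a ∈ Y
  · rw [← hD a ⟨ha, haY⟩, ← (hcy haY).eq, mul_inv_cancel_right]
  · have hxa : x * a ∈ X ⊓ Y := ⟨X.mul_mem hxX ha, hmY.2 (by tauto)⟩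
    have h1 := hcy hxa.2
    have h2 := hD _ hxa
    have h3 : y * x⁻¹ * y⁻¹ = x := by
      rw [mul_inv_eq_iff_eq_mul, mul_inv_eq_iff_eq_mul, hxy]
    have h4 : y * (x * a) * y⁻¹ = x * a := by rw [← h1.eq, mul_inv_cancel_right]
    calc y * a * y⁻¹ = (y * x⁻¹ * y⁻¹) * (y * (x * a) * y⁻¹) := by group
      _ = a⁻¹ := by rw [h3, h4, h2, mul_inv_rev, ← mul_assoc, ← (hcx ha).inv_left.eq, mul_inv_cancel_right]

open Finset in
/-- If all but fewer than one twelfth of the elements lie in the proper subgroup `U` or square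
to the involution `r ∈ U`, the group is generalized dicyclic or `C₄ × C₂^ℓ`. -/
theorem isGeneralizedDicyclic_or_of_card_lt {R : Type*} [Group R] [Fintype R] [DecidableEq R]
    (U : Subgroup R) [DecidablePred (· ∈ U)] (hU : U ≠ ⊤) (r : R) (hrU : r ∈ U)
    (hr2 : r ^ 2 = 1) (hr1 : r ≠ 1)
    (hB : 12 * (univ.filter fun g => g ∉ U ∧ g ^ 2 ≠ r).card < Nat.card R) :
    IsGeneralizedDicyclic R ∨
    (∃ ℓ : ℕ, Nonempty (R ≃* Multiplicative (ZMod 4 × (Fin ℓ → ZMod 2)))) := by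
  have hidx0 : U.index ≠ 0 := U.index_ne_zero_of_finite
  have hidx1 : U.index ≠ 1 := by rwa [Ne, Subgroup.index_eq_one]
  have hcard := U.card_mul_index
  have hUcard : Nat.card U = (univ.filter fun g => g ∈ U).card := by
    rw [Nat.card_eq_fintype_card, Fintype.card_subtype]
  have htot : Nat.card R = (univ.filter fun g => g ∉ U ∧ g ^ 2 = r).card
      + (univ.filter fun g => ¬(g ∉ U ∧ g ^ 2 = r)).card := by
    rw [card_filter_add_card_filter_not, card_univ, Nat.card_eq_fintype_card]
  have hcompl : (univ.filter fun g => ¬(g ∉ U ∧ g ^ 2 = r)).card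
      ≤ Nat.card U + (univ.filter fun g => g ∉ U ∧ g ^ 2 ≠ r).card := by
    rw [hUcard]
    refine (card_le_card ?_).trans (card_union_le _ _)
    intro g
    simp only [mem_filter, mem_univ, true_and, mem_union]
    tauto
  have hex : ∃ x, x ∉ U ∧ x ^ 2 = r := by
    by_contra! h
    rw [filter_false_of_mem (s := univ) (p := fun g => g ∉ U ∧ g ^ 2 = r)
      (fun g _ hg => h g hg.1 hg.2), card_empty] at htot
    have : 2 ≤ U.index := by omega
    have := Nat.mul_le_mul_left (Nat.card U) this
    omega
  obtain ⟨x, hxU, hxr⟩ := hex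
  by_cases hidx2 : U.index = 2
  · exact isGeneralizedDicyclic_or_of_index_two U hidx2 r hr2 hr1 x hxU hxr (by omega)
  left
  have hidx3 : 3 ≤ U.index := by omega
  have hU3 := Nat.mul_le_mul_left (Nat.card U) hidx3
  obtain ⟨y, ⟨hyU, hyr⟩, hxyU, hxyr⟩ :
      ∃ y, (y ∉ U ∧ y ^ 2 = r) ∧ (x * y ∉ U ∧ (x * y) ^ 2 = r) := by
    by_contra! h
    have h1 := card_filter_not_and_le (fun g => g ∉ U ∧ g ^ 2 = r)
      (fun g => x * g ∉ U ∧ (x * g) ^ 2 = r)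
    rw [filter_true_of_mem
      (p := fun g => ¬((g ∉ U ∧ g ^ 2 = r) ∧ x * g ∉ U ∧ (x * g) ^ 2 = r))
      (fun g _ hg => h g hg.1 hg.2.1 hg.2.2), card_univ, ← Nat.card_eq_fintype_card,
      card_filter_mul_left (fun g => ¬(g ∉ U ∧ g ^ 2 = r)) x] at h1
    omega
  have hxy : x * y * x = y := mul_mul_eq_of_sq_eq (hyr.trans hxr.symm) (hxyr.trans hxr.symm)
  have hidx4 : 4 ≤ U.index := by
    classical
    have h1 : x⁻¹ * y ∉ U := by
      have : x⁻¹ * y = r⁻¹ * (x * y) := by rw [← hxr]; group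
      rwa [this, U.mul_mem_cancel_left (U.inv_mem hrU)]
    have h2 : y⁻¹ * (x * y) ∉ U := by
      have : x * y = y * x⁻¹ := by rw [eq_mul_inv_iff_mul_eq, hxy]
      rwa [this, inv_mul_cancel_left, inv_mem_iff]
    have h3 : ({((1 : R) : R ⧸ U), (x : R ⧸ U), (y : R ⧸ U), ((x * y : R) : R ⧸ U)} :
        Finset (R ⧸ U)).card = 4 := by
      rw [card_insert_of_notMem, card_insert_of_notMem, card_pair]
      · rwa [Ne, QuotientGroup.eq]
      · simp only [mem_insert, mem_singleton, not_or, QuotientGroup.eq]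
        exact ⟨h1, by rwa [inv_mul_cancel_left]⟩
      · simp only [mem_insert, mem_singleton, not_or, QuotientGroup.eq, inv_one, one_mul]
        exact ⟨hxU, hyU, hxyU⟩
    rw [Subgroup.index, ← h3, Nat.card_eq_fintype_card]
    exact card_le_univ _
  have hU4 := Nat.mul_le_mul_left (Nat.card U) hidx4
  refine .of_quaternion_pair r hr2 hr1 ?_ x y hxr hyr hxy
  have hsub : (univ.filter fun g : R => ¬g ^ 2 = r).card
      ≤ (univ.filter fun g => ¬(g ∉ U ∧ g ^ 2 = r)).card := by
    refine card_le_card fun g => ?_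
    simp only [mem_filter, mem_univ, true_and]
    tauto
  omega

open Finset in
/-- If every class of a setoid has weight at least `4`, then the total weight is at least four
times the number of classes. -/
theorem four_mul_card_quotient_le {α : Type*} [Fintype α] [DecidableEq α] (s : Setoid α)
    [DecidableRel s.r] (w : α → ℕ)
    (hw : ∀ x, ∃ t : Finset α, (∀ y ∈ t, s.r y x) ∧ 4 ≤ ∑ y ∈ t, w y) :
    4 * Fintype.card (Quotient s) ≤ ∑ x, w x := by
  classical
  rw [← sum_fiberwise (s := univ) (g := fun x => (⟦x⟧ : Quotient s)) (f := w),
    ← card_univ, mul_comm, ← smul_eq_mul]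
  refine card_nsmul_le_sum _ _ _ fun q _ => ?_
  induction q using Quotient.inductionOn with
  | h x =>
    obtain ⟨t, ht, ht4⟩ := hw x
    refine ht4.trans (sum_le_sum_of_subset fun y hy => ?_)
    simpa using Quotient.sound (ht y hy)

/-- There are at most `2 ^ k` sets that are unions of classes of a setoid with `k` classes. -/
theorem ncard_le_two_pow_card_quotient {α : Type*} [Finite α] (P : Set (Set α)) (s : Setoid α)
    (hP : ∀ S ∈ P, ∀ x y, s.r x y → x ∈ S → y ∈ S) :
    P.ncard ≤ 2 ^ Nat.card (Quotient s) := by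
  classical
  have := Fintype.ofFinite (Quotient s)
  have h1 : (Set.univ : Set (Set (Quotient s))).ncard = 2 ^ Nat.card (Quotient s) := by
    rw [Set.ncard_univ, Nat.card_eq_fintype_card, Fintype.card_set, Nat.card_eq_fintype_card]
  rw [← h1]
  refine Set.ncard_le_ncard_of_injOn (fun S => Quotient.mk s '' S) (fun _ _ => Set.mem_univ _) ?_
  have key (S : Set α) (hS : S ∈ P) (x : α) : x ∈ S ↔ Quotient.mk s x ∈ Quotient.mk s '' S :=
    ⟨fun h => ⟨x, h, rfl⟩, fun ⟨y, hy, hyx⟩ => hP S hS y x (Quotient.exact hyx) hy⟩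
  intro S hS T hT hST
  ext x
  simp only at hST
  rw [key S hS, key T hT, hST]

open Finset in
theorem stmt_12 {R : Type*} [Group R] [Finite R] (U : Subgroup R) (hU : U ≠ ⊤)
    (r : R) (hrU : r ∈ U) (hr2 : r ^ 2 = 1) (hr1 : r ≠ 1)
    (hrc : r ∈ Subgroup.center R)
    (τ : R → R) (hτU : ∀ x ∈ U, τ x = x) (hτn : ∀ x : R, x ∉ U → τ x = x * r) :
    ({S : Set R | S⁻¹ = S ∧ τ '' S = S}.ncard : ℝ)
      ≤ 2 ^ (((Nat.card R : ℝ) + ({x : R | x ^ 2 = 1}.ncard : ℝ)) / 2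
          - (Nat.card R : ℝ) / 48) ∨
    IsGeneralizedDicyclic R ∨
    (∃ ℓ : ℕ, Nonempty (R ≃* Multiplicative (ZMod 4 × (Fin ℓ → ZMod 2)))) := by
  classical
  have := Fintype.ofFinite R
  by_cases hB : 12 * (univ.filter fun g => g ∉ U ∧ g ^ 2 ≠ r).card < Nat.card R
  · exact Or.inr (isGeneralizedDicyclic_or_of_card_lt U hU r hrU hr2 hr1 hB)
  left
  have hrr : r * r = 1 := by rw [← sq, hr2]
  have hrcomm (x : R) : Commute x r := Subgroup.mem_center_iff.1 hrc x
  let P : Set (Set R) := {S : Set R | S⁻¹ = S ∧ τ '' S = S}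
  let s : Setoid R :=
    { r := fun x y => ∀ S ∈ P, (x ∈ S ↔ y ∈ S)
      iseqv := ⟨fun _ _ _ => Iff.rfl, fun h S hS => (h S hS).symm,
        fun h h' S hS => (h S hS).trans (h' S hS)⟩ }
  have hs_inv (x : R) : s.r x⁻¹ x := by
    rintro S ⟨hS, -⟩
    rw [← Set.mem_inv, hS]
  have hs_mul (x : R) (hx : x ∉ U) : s.r (x * r) x := by
    have hstep (S : Set R) (hS : τ '' S = S) (z : R) (hz : z ∉ U) (hzS : z ∈ S) : z * r ∈ S := by
      rw [← hτn z hz, ← hS]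
      exact ⟨z, hzS, rfl⟩
    rintro S ⟨-, hS⟩
    refine ⟨fun h => ?_, hstep S hS x hx⟩
    have := hstep S hS (x * r) (by rwa [U.mul_mem_cancel_right hrU]) h
    rwa [mul_assoc, hrr, mul_one] at this
  let w : R → ℕ := fun x =>
    if x ∈ U then (if x ^ 2 = 1 then 4 else 2) else if x ^ 2 = 1 ∨ x ^ 2 = r then 2 else 1
  have hquot : 4 * Fintype.card (Quotient s) ≤ ∑ x, w x := by
    apply four_mul_card_quotient_le
    intro x
    have hinv_ne (h : x ^ 2 ≠ 1) : x ≠ x⁻¹ := by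
      rwa [Ne, eq_inv_iff_mul_eq_one, ← sq]
    by_cases hx : x ∈ U
    · by_cases hx2 : x ^ 2 = 1
      · exact ⟨{x}, by simp, by simp [w, hx, hx2]⟩
      · refine ⟨{x, x⁻¹}, ?_, ?_⟩
        · simp only [mem_insert, mem_singleton, forall_eq_or_imp, forall_eq]
          exact ⟨s.refl x, hs_inv x⟩
        · rw [sum_pair (hinv_ne hx2)]
          simp [w, hx, hx2]
    · have hxr : x ≠ x * r := by simpa using hr1
      have hxrU : x * r ∉ U := by rwa [U.mul_mem_cancel_right hrU]
      have hsq : (x * r) ^ 2 = x ^ 2 := by rw [(hrcomm x).mul_pow, hr2, mul_one]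
      by_cases hx2 : x ^ 2 = 1 ∨ x ^ 2 = r
      · refine ⟨{x, x * r}, ?_, ?_⟩
        · simp only [mem_insert, mem_singleton, forall_eq_or_imp, forall_eq]
          exact ⟨s.refl x, hs_mul x hx⟩
        · rw [sum_pair hxr]
          simp only [w, hx, hxrU, hsq, hx2, if_true, if_false]
          norm_num
      · rw [not_or] at hx2
        refine ⟨{x, x⁻¹, x * r, x⁻¹ * r}, ?_, ?_⟩
        · have hx' : x⁻¹ ∉ U := by rwa [inv_mem_iff]
          simp only [mem_insert, mem_singleton, forall_eq_or_imp, forall_eq]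
          exact ⟨s.refl x, hs_inv x, hs_mul x hx, s.trans (hs_mul _ hx') (hs_inv x)⟩
        · have hw1 (y : R) : 1 ≤ w y := by
            simp only [w]
            split_ifs <;> norm_num
          have hne : x ≠ x⁻¹ * r := by
            rw [Ne, eq_inv_mul_iff_mul_eq, ← sq]
            exact hx2.2
          have hne' : x⁻¹ ≠ x * r := by
            intro h
            rw [inv_eq_iff_mul_eq_one, ← mul_assoc, ← sq] at h
            rw [mul_eq_one_iff_eq_inv.1 h, inv_eq_iff_mul_eq_one.2 hrr] at hx2
            exact hx2.2 rfl
          have hcard : ({x, x⁻¹, x * r, x⁻¹ * r} : Finset R).card = 4 := by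
            rw [card_insert_of_notMem, card_insert_of_notMem, card_pair]
            · simpa using hinv_ne hx2.1
            · simpa using ⟨hne', hr1⟩
            · simpa using ⟨hinv_ne hx2.1, hr1, hne⟩
          calc 4 = ∑ y ∈ ({x, x⁻¹, x * r, x⁻¹ * r} : Finset R), 1 := by simp [hcard]
            _ ≤ _ := sum_le_sum fun y _ => hw1 y
  have hwsum : ∑ x, w x + (univ.filter fun g => g ∉ U ∧ g ^ 2 ≠ r).card
      ≤ 2 * Nat.card R + 2 * (univ.filter fun g : R => g ^ 2 = 1).card := by
    rw [Nat.card_eq_fintype_card, ← card_univ, card_filter, card_filter, card_eq_sum_ones,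
      mul_sum, mul_sum, ← sum_add_distrib, ← sum_add_distrib]
    refine sum_le_sum fun x _ => ?_
    simp only [w]
    split_ifs <;> simp_all
  have hI : {x : R | x ^ 2 = 1}.ncard = (univ.filter fun g : R => g ^ 2 = 1).card := by
    rw [← Set.ncard_coe_finset]
    simp
  have hP : P.ncard ≤ 2 ^ Nat.card (Quotient s) :=
    ncard_le_two_pow_card_quotient P s fun S hS x y hxy => (hxy S hS).1
  rw [hI]
  calc (P.ncard : ℝ) ≤ (2 : ℝ) ^ (Nat.card (Quotient s) : ℝ) := by
        rw [Real.rpow_natCast]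
        exact mod_cast hP
    _ ≤ _ := by
        refine Real.rpow_le_rpow_of_exponent_le one_le_two ?_
        rw [Nat.card_eq_fintype_card (α := Quotient s)]
        have h1 : (48 * Fintype.card (Quotient s) + Nat.card R : ℝ)
            ≤ 24 * Nat.card R + 24 * (univ.filter fun g : R => g ^ 2 = 1).card := by
          norm_cast
          omega
        linarith
end

section
/- Let G be a finite group acting transitively on a finite set Ω, let ω ∈ Ω, and let i be a positive integer. Then |Fix_Ω(G_ω)| divides |Ω_{ω,i}|, where Ω_{ω,i} := {δ ∈ Ω : the G_ω-orbit of δ has cardinality i}. -/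
open MulAction

section

variable {G Ω : Type*} [Group G] [MulAction G Ω]

/-- The points with the same stabilizer as `g • ω` are the translates by `g` of the points with the
same stabilizer as `ω`. -/
theorem ncard_stabilizer_eq_stabilizer_smul (g : G) (ω : Ω) :
    {δ : Ω | stabilizer G δ = stabilizer G (g • ω)}.ncard =
      {δ : Ω | stabilizer G δ = stabilizer G ω}.ncard := by
  rw [← Set.ncard_image_of_injective {δ : Ω | stabilizer G δ = stabilizer G ω}
    (MulAction.injective g)]
  congr 1
  ext δ
  obtain ⟨ε, rfl⟩ := MulAction.surjective g δ
  rw [Function.Injective.mem_set_image (MulAction.injective g)]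
  simp only [Set.mem_ofPred_eq, stabilizer_smul_eq_stabilizer_map_conj]
  exact (Subgroup.map_injective (MulAut.conj g).injective).eq_iff

/-- In a finite transitive group, a point stabilizer contained in another one is equal to it. -/
theorem stabilizer_eq_of_le [Finite G] [IsPretransitive G Ω] {δ ω : Ω}
    (h : stabilizer G ω ≤ stabilizer G δ) : stabilizer G δ = stabilizer G ω := by
  obtain ⟨g, rfl⟩ := exists_smul_eq G ω δ
  refine (Subgroup.eq_of_le_of_card_ge h ?_).symm
  rw [stabilizer_smul_eq_stabilizer_map_conj,
    Subgroup.card_map_of_injective (MulAut.conj g).injective]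

/-- The size of the orbit of a point under a subgroup depends only on the stabilizer of the
point. -/
theorem card_orbit_subgroup_eq_relIndex (H : Subgroup G) (δ : Ω) :
    Nat.card (orbit H δ) = (stabilizer G δ).relIndex H := by
  rw [Nat.card_coe_set_eq, ← index_stabilizer]
  rfl

end

theorem stmt_14 {G Ω : Type*} [Group G] [Finite G] [Finite Ω] [MulAction G Ω]
    [IsPretransitive G Ω] (ω : Ω) (i : ℕ) (hi : 0 < i) :
    {δ : Ω | ∀ x ∈ stabilizer G ω, x • δ = δ}.ncard ∣
      {δ : Ω | Nat.card (orbit (stabilizer G ω) δ) = i}.ncard := by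
  classical
  have := Fintype.ofFinite Ω
  have hfix : {δ : Ω | ∀ x ∈ stabilizer G ω, x • δ = δ} =
      {δ : Ω | stabilizer G δ = stabilizer G ω} := by
    ext δ
    exact ⟨fun h => stabilizer_eq_of_le h, fun h x hx => h.ge hx⟩
  simp only [hfix, card_orbit_subgroup_eq_relIndex]
  rw [Set.ncard_eq_toFinset_card' {δ : Ω | (stabilizer G δ).relIndex (stabilizer G ω) = i},
    Finset.card_eq_sum_card_image (fun δ : Ω => stabilizer G δ)]
  refine Finset.dvd_sum fun K hK => ?_
  obtain ⟨δ, hδ, rfl⟩ := Finset.mem_image.mp hK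
  rw [Set.mem_toFinset, Set.mem_ofPred_eq] at hδ
  obtain ⟨g, rfl⟩ := exists_smul_eq G ω δ
  rw [← ncard_stabilizer_eq_stabilizer_smul g ω, ← Set.ncard_coe_finset]
  apply dvd_of_eq
  congr 1
  ext ε
  simp only [Set.mem_ofPred_eq, Finset.coe_filter, Set.mem_toFinset]
  exact ⟨fun h => ⟨h ▸ hδ, h⟩, fun h => h.2⟩
end
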